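/- There is an injective homomorphism of 𝕂-algebras ι : 𝔇_n → 𝒟_n determined on generators by ι(E_i) = Σ_{r=−i}^{i−1} w_i^r = 𝐢 Σ_{r=−i}^{i−1} q^{i+r} X_{V_{i,−i}} X_{V_{i,1−i}} ⋯ X_{V_{i,r}}, ι(K_i) = q^{2i} X_{V_{i,−i}} X_{V_{i,1−i}} ⋯ X_{V_{i,i}}, ι(F_{θ(i)}) = Σ_{r=−i}^{i−1} m_i^r = 𝐢 Σ_{r=−i}^{i−1} q^{i+r} X_{Λ_{i,−i}} X_{Λ_{i,1−i}} ⋯ X_{Λ_{i,r}}, and ι(K'_{θ(i)}) = q^{2i} X_{Λ_{i,−i}} X_{Λ_{i,1−i}} ⋯ X_{Λ_{i,i}}, for 1 ≤ i ≤ n (with K_i^{−1}, (K_i')^{−1} sent to the inverses of the images of K_i, K_i'). -/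

import Mathlib

noncomputable section

/-- The ground field `𝕂 = ℂ(q)`, the field of rational functions over `ℂ`. -/
abbrev Kq : Type := RatFunc ℂ

/-- The formal variable `q ∈ ℂ(q)`. -/
def qq : Kq := RatFunc.X

/-- `𝐢 = √−1 ∈ ℂ`, viewed as a constant in `𝕂 = ℂ(q)`. -/
def ii : Kq := RatFunc.C Complex.I

/-- `θ(i) = n + 1 − i`. -/
def th (n : ℕ) (i : ℤ) : ℤ := (n : ℤ) + 1 - i

/-- Labels for the vertices of the `𝒟ₙ`-quiver: `V i r` stands for `V_{i,r}`
(the canonical labels), and `C i` stands for the central vertex `Λ_{i,0}`. -/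
inductive DnLabel : Type
  | V : ℤ → ℤ → DnLabel
  | C : ℤ → DnLabel
deriving DecidableEq

/-- Validity of a label for given rank `n`: `V i r` requires `1 ≤ i ≤ n`, `−i ≤ r ≤ i`;
`C i` requires `1 ≤ i ≤ n`.  There are `n² + 3n` valid labels. -/
def DnLabel.valid (n : ℕ) : DnLabel → Prop
  | .V i r => 1 ≤ i ∧ i ≤ (n : ℤ) ∧ -i ≤ r ∧ r ≤ i
  | .C i => 1 ≤ i ∧ i ≤ (n : ℤ)

instance (n : ℕ) (v : DnLabel) : Decidable (v.valid n) := by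
  cases v <;> unfold DnLabel.valid <;> infer_instance

/-- The vertex set of the `𝒟ₙ`-quiver. -/
def DnVertex (n : ℕ) := {v : DnLabel // v.valid n}

/-- The canonical label of the vertex `Λ_{i,r}`, using the identifications
`Λ_{a,b} = V_{θ(b),−θ(a)}` for `b > 0` and `Λ_{a,b} = V_{θ(−b),θ(a)}` for `b < 0`. -/
def Lam (n : ℕ) (i r : ℤ) : DnLabel :=
  if 0 < r then .V (th n r) (-(th n i))
  else if r < 0 then .V (th n (-r)) (th n i)
  else .C i

/-- The list of arrows `(source, target, doubled weight)` of the `𝒟ₙ`-quiver, obtained by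
amalgamating two copies of the Fock–Goncharov `(n+1)`-triangle quiver along two pairs of
sides.  Solid (weight `1`) arrows get doubled weight `2`, dashed (weight `1/2`) arrows get
doubled weight `1`.  The families are: the horizontal `V_i`- and `Λ_i`-path arrows, the
dashed boundary arrows along the two frozen columns, and, for each `1 ≤ i < n`, the
oriented cycle `V_{i,0} → V_{i+1,−1} → ⋯ → V_{n,i−n} → Λ_{i,0} → V_{n,n−i} → ⋯ → V_{i+1,1} → V_{i,0}`
through the central column. -/
def dnArrows (n : ℕ) : List (DnLabel × DnLabel × ℤ) :=
  ((List.range n).flatMap fun i0 =>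
    (List.range (2 * i0 + 2)).map fun k =>
      (DnLabel.V ((i0 : ℤ) + 1) (-((i0 : ℤ) + 1) + k),
       DnLabel.V ((i0 : ℤ) + 1) (-((i0 : ℤ) + 1) + k + 1), 2))
  ++ ((List.range n).flatMap fun i0 =>
    (List.range (2 * i0 + 2)).map fun k =>
      (Lam n ((i0 : ℤ) + 1) (-((i0 : ℤ) + 1) + k),
       Lam n ((i0 : ℤ) + 1) (-((i0 : ℤ) + 1) + k + 1), 2))
  ++ ((List.range (n - 1)).map fun i0 =>
      (DnLabel.V ((i0 : ℤ) + 1) (-((i0 : ℤ) + 1)),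
       DnLabel.V ((i0 : ℤ) + 2) (-((i0 : ℤ) + 2)), 1))
  ++ ((List.range (n - 1)).map fun i0 =>
      (DnLabel.V ((i0 : ℤ) + 2) ((i0 : ℤ) + 2),
       DnLabel.V ((i0 : ℤ) + 1) ((i0 : ℤ) + 1), 1))
  ++ ((List.range (n - 1)).flatMap fun i0 =>
      (((List.range (n - 1 - i0)).map fun k =>
          (DnLabel.V ((i0 : ℤ) + 1 + k) (-(k : ℤ)),
           DnLabel.V ((i0 : ℤ) + 2 + k) (-(k : ℤ) - 1), 2))
        ++ [(DnLabel.V (n : ℤ) ((i0 : ℤ) + 1 - n), DnLabel.C ((i0 : ℤ) + 1), 2),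
            (DnLabel.C ((i0 : ℤ) + 1), DnLabel.V (n : ℤ) ((n : ℤ) - (i0 + 1)), 2)]
        ++ ((List.range (n - 1 - i0)).map fun k =>
          (DnLabel.V ((i0 : ℤ) + 2 + k) ((k : ℤ) + 1),
           DnLabel.V ((i0 : ℤ) + 1 + k) (k : ℤ), 2))))

/-- The doubled exchange matrix `2·ε_{uv}` of the `𝒟ₙ`-quiver. -/
def eps2 (n : ℕ) (u v : DnLabel) : ℤ :=
  ((dnArrows n).map fun a =>
    (if a.1 = u ∧ a.2.1 = v then a.2.2 else 0)
      - (if a.1 = v ∧ a.2.1 = u then a.2.2 else 0)).sum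

/-- The defining relations of the quantum torus algebra `𝒟ₙ`: generators `X_v^{±1}`
(`Sum.inl v` is `X_v`, `Sum.inr v` is `X_v⁻¹`) with `X_u X_v = q^{2 ε_{vu}} X_v X_u`. -/
inductive DnRel (n : ℕ) :
    FreeAlgebra Kq (DnVertex n ⊕ DnVertex n) →
      FreeAlgebra Kq (DnVertex n ⊕ DnVertex n) → Prop
  | comm (u v : DnVertex n) :
      DnRel n (FreeAlgebra.ι Kq (Sum.inl u) * FreeAlgebra.ι Kq (Sum.inl v))
        ((qq ^ eps2 n v.1 u.1) • (FreeAlgebra.ι Kq (Sum.inl v) * FreeAlgebra.ι Kq (Sum.inl u)))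
  | mul_inv (v : DnVertex n) :
      DnRel n (FreeAlgebra.ι Kq (Sum.inl v) * FreeAlgebra.ι Kq (Sum.inr v)) 1
  | inv_mul (v : DnVertex n) :
      DnRel n (FreeAlgebra.ι Kq (Sum.inr v) * FreeAlgebra.ι Kq (Sum.inl v)) 1

/-- The quantum torus algebra `𝒟ₙ`. -/
abbrev Dtorus (n : ℕ) := RingQuot (DnRel n)

/-- The cluster variable `X_v ∈ 𝒟ₙ` attached to a label (junk value `1` on invalid labels). -/
def Xg (n : ℕ) (v : DnLabel) : Dtorus n :=
  if h : v.valid n then RingQuot.mkAlgHom Kq (DnRel n) (FreeAlgebra.ι Kq (Sum.inl ⟨v, h⟩)) else 1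

/-- The inverse cluster variable `X_v⁻¹ ∈ 𝒟ₙ` (junk value `1` on invalid labels). -/
def Xinv (n : ℕ) (v : DnLabel) : Dtorus n :=
  if h : v.valid n then RingQuot.mkAlgHom Kq (DnRel n) (FreeAlgebra.ι Kq (Sum.inr ⟨v, h⟩)) else 1

/-- The ordered product `X_{V_{i,−i}} X_{V_{i,1−i}} ⋯ X_{V_{i,r}}`. -/
def Vprod (n : ℕ) (i r : ℤ) : Dtorus n :=
  ((List.range (r + i + 1).toNat).map fun k => Xg n (.V i (-i + k))).prod

/-- The ordered product `X_{Λ_{i,−i}} X_{Λ_{i,1−i}} ⋯ X_{Λ_{i,r}}`. -/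
def Lprod (n : ℕ) (i r : ℤ) : Dtorus n :=
  ((List.range (r + i + 1).toNat).map fun k => Xg n (Lam n i (-i + k))).prod

/-- `w_i^r = 𝐢 q^{i+r} X_{V_{i,−i}} X_{V_{i,1−i}} ⋯ X_{V_{i,r}}`. -/
def ww (n : ℕ) (i r : ℤ) : Dtorus n := (ii * qq ^ (i + r)) • Vprod n i r

/-- `m_i^r = 𝐢 q^{i+r} X_{Λ_{i,−i}} X_{Λ_{i,1−i}} ⋯ X_{Λ_{i,r}}`. -/
def mm (n : ℕ) (i r : ℤ) : Dtorus n := (ii * qq ^ (i + r)) • Lprod n i r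


/-- Index set `{1, …, n} ⊂ ℤ`. -/
def Idx (n : ℕ) := {i : ℤ // 1 ≤ i ∧ i ≤ (n : ℤ)}

/-- `θ` as a map on the index set. -/
def thIdx (n : ℕ) (i : Idx n) : Idx n :=
  ⟨th n i.1, by obtain ⟨h1, h2⟩ := i.2; unfold th; constructor <;> omega⟩

/-- Generators of the Drinfeld double `𝔇ₙ`. -/
inductive DDGen (n : ℕ) : Type
  | E : Idx n → DDGen n
  | F : Idx n → DDGen n
  | K : Idx n → DDGen n
  | K' : Idx n → DDGen n
  | Kinv : Idx n → DDGen n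
  | K'inv : Idx n → DDGen n

/-- The Cartan matrix of type `Aₙ`. -/
def cartanA (i j : ℤ) : ℤ := if i = j then 2 else if (i - j).natAbs = 1 then -1 else 0

/-- Shorthand for the generators inside the free algebra. -/
def ddg (n : ℕ) (g : DDGen n) : FreeAlgebra Kq (DDGen n) := FreeAlgebra.ι Kq g

/-- The defining relations of the Drinfeld double `𝔇ₙ`. -/
inductive DDRel (n : ℕ) : FreeAlgebra Kq (DDGen n) → FreeAlgebra Kq (DDGen n) → Prop
  | KE (i j : Idx n) : DDRel n (ddg n (.K i) * ddg n (.E j))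
      ((qq ^ cartanA i.1 j.1) • (ddg n (.E j) * ddg n (.K i)))
  | K'E (i j : Idx n) : DDRel n (ddg n (.K' i) * ddg n (.E j))
      ((qq ^ (-cartanA i.1 j.1)) • (ddg n (.E j) * ddg n (.K' i)))
  | KF (i j : Idx n) : DDRel n (ddg n (.K i) * ddg n (.F j))
      ((qq ^ (-cartanA i.1 j.1)) • (ddg n (.F j) * ddg n (.K i)))
  | K'F (i j : Idx n) : DDRel n (ddg n (.K' i) * ddg n (.F j))
      ((qq ^ cartanA i.1 j.1) • (ddg n (.F j) * ddg n (.K' i)))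
  | KK (i j : Idx n) : DDRel n (ddg n (.K i) * ddg n (.K j)) (ddg n (.K j) * ddg n (.K i))
  | KK' (i j : Idx n) : DDRel n (ddg n (.K i) * ddg n (.K' j)) (ddg n (.K' j) * ddg n (.K i))
  | K'K' (i j : Idx n) : DDRel n (ddg n (.K' i) * ddg n (.K' j)) (ddg n (.K' j) * ddg n (.K' i))
  | K_Kinv (i : Idx n) : DDRel n (ddg n (.K i) * ddg n (.Kinv i)) 1
  | Kinv_K (i : Idx n) : DDRel n (ddg n (.Kinv i) * ddg n (.K i)) 1
  | K'_K'inv (i : Idx n) : DDRel n (ddg n (.K' i) * ddg n (.K'inv i)) 1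
  | K'inv_K' (i : Idx n) : DDRel n (ddg n (.K'inv i) * ddg n (.K' i)) 1
  | EF (i j : Idx n) : DDRel n (ddg n (.E i) * ddg n (.F j))
      (ddg n (.F j) * ddg n (.E i)
        + (if i.1 = j.1 then qq - qq⁻¹ else 0) • (ddg n (.K i) - ddg n (.K' i)))
  | serreE (i j : Idx n) (h : (i.1 - j.1).natAbs = 1) :
      DDRel n (ddg n (.E i) * ddg n (.E i) * ddg n (.E j)
          + ddg n (.E j) * (ddg n (.E i) * ddg n (.E i)))
        ((qq + qq⁻¹) • (ddg n (.E i) * ddg n (.E j) * ddg n (.E i)))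
  | serreF (i j : Idx n) (h : (i.1 - j.1).natAbs = 1) :
      DDRel n (ddg n (.F i) * ddg n (.F i) * ddg n (.F j)
          + ddg n (.F j) * (ddg n (.F i) * ddg n (.F i)))
        ((qq + qq⁻¹) • (ddg n (.F i) * ddg n (.F j) * ddg n (.F i)))
  | EEc (i j : Idx n) (h : 1 < (i.1 - j.1).natAbs) :
      DDRel n (ddg n (.E i) * ddg n (.E j)) (ddg n (.E j) * ddg n (.E i))
  | FFc (i j : Idx n) (h : 1 < (i.1 - j.1).natAbs) :
      DDRel n (ddg n (.F i) * ddg n (.F j)) (ddg n (.F j) * ddg n (.F i))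

/-- The Drinfeld double `𝔇ₙ` of the quantum Borel subalgebra of `U_q(sl_{n+1})`. -/
abbrev DDalg (n : ℕ) := RingQuot (DDRel n)

/-- The generators of `𝔇ₙ`. -/
def DDgen (n : ℕ) (g : DDGen n) : DDalg n := RingQuot.mkAlgHom Kq (DDRel n) (ddg n g)

/-- The defining property of the embedding `ι : 𝔇ₙ → 𝒟ₙ`:
`ι(E_i) = Σ_{r=−i}^{i−1} w_i^r`, `ι(K_i) = q^{2i} X_{V_{i,−i}} ⋯ X_{V_{i,i}}`,
`ι(F_{θ(i)}) = Σ_{r=−i}^{i−1} m_i^r`, `ι(K'_{θ(i)}) = q^{2i} X_{Λ_{i,−i}} ⋯ X_{Λ_{i,i}}`,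
and `K_i^{−1}`, `(K_i')^{−1}` are sent to the inverses of the images of `K_i`, `K_i'`. -/
def iotaSpec (n : ℕ) (f : DDalg n →ₐ[Kq] Dtorus n) : Prop :=
  ∀ i : Idx n,
    f (DDgen n (.E i)) = ∑ r ∈ Finset.Icc (-i.1) (i.1 - 1), ww n i.1 r ∧
    f (DDgen n (.K i)) = (qq ^ (2 * i.1)) • Vprod n i.1 i.1 ∧
    f (DDgen n (.F (thIdx n i))) = ∑ r ∈ Finset.Icc (-i.1) (i.1 - 1), mm n i.1 r ∧
    f (DDgen n (.K' (thIdx n i))) = (qq ^ (2 * i.1)) • Lprod n i.1 i.1 ∧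
    f (DDgen n (.Kinv i)) * f (DDgen n (.K i)) = 1 ∧
    f (DDgen n (.K i)) * f (DDgen n (.Kinv i)) = 1 ∧
    f (DDgen n (.K'inv i)) * f (DDgen n (.K' i)) = 1 ∧
    f (DDgen n (.K' i)) * f (DDgen n (.K'inv i)) = 1

section QCommutation

variable {A : Type*} [Ring A] [Algebra Kq A]

/-- `a` and `b` commute up to the factor `q ^ k`. -/
def QC (k : ℤ) (a b : A) : Prop := a * b = (qq ^ k) • (b * a)

theorem qq_ne_zero : qq ≠ 0 := RatFunc.X_ne_zero

theorem QC.of_eq {k l : ℤ} {a b : A} (h : QC k a b) (hkl : k = l) : QC l a b := hkl ▸ h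

theorem QC.symm {k : ℤ} {a b : A} (h : QC k a b) : QC (-k) b a := by
  unfold QC at *
  rw [h, smul_smul, ← zpow_add₀ qq_ne_zero]; simp

theorem QC.one_left (b : A) : QC 0 1 b := by simp [QC]

theorem QC.one_right (a : A) : QC 0 a 1 := by simp [QC]

theorem QC.mul_left {k l : ℤ} {a b c : A} (h : QC k a c) (h' : QC l b c) :
    QC (k + l) (a * b) c := by
  unfold QC at *
  rw [mul_assoc, h', mul_smul_comm, ← mul_assoc, h, smul_mul_assoc, smul_smul, mul_assoc,
    zpow_add₀ qq_ne_zero, mul_comm]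

theorem QC.mul_right {k l : ℤ} {a b c : A} (h : QC k a b) (h' : QC l a c) :
    QC (k + l) a (b * c) := by
  have := (h.symm.mul_left h'.symm).symm
  exact this.of_eq (by ring)

theorem QC.smul_left {k : ℤ} {a b : A} (x : Kq) (h : QC k a b) : QC k (x • a) b := by
  unfold QC at *
  rw [smul_mul_assoc, h, mul_smul_comm, smul_comm]

theorem QC.smul_right {k : ℤ} {a b : A} (x : Kq) (h : QC k a b) : QC k a (x • b) := by
  unfold QC at *
  rw [smul_mul_assoc, mul_smul_comm, h, smul_comm]

theorem QC.sum_left {ι : Type*} {k : ℤ} {b : A} {s : Finset ι} {g : ι → A}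
    (h : ∀ i ∈ s, QC k (g i) b) : QC k (∑ i ∈ s, g i) b := by
  unfold QC at *
  rw [Finset.sum_mul, Finset.mul_sum, Finset.smul_sum]
  exact Finset.sum_congr rfl h

theorem QC.sum_right {ι : Type*} {k : ℤ} {a : A} {s : Finset ι} {g : ι → A}
    (h : ∀ i ∈ s, QC k a (g i)) : QC k a (∑ i ∈ s, g i) := by
  unfold QC at *
  rw [Finset.sum_mul, Finset.mul_sum, Finset.smul_sum]
  exact Finset.sum_congr rfl h

theorem QC.inv_left {k : ℤ} {a a' b : A} (h1 : a * a' = 1) (h2 : a' * a = 1) (h : QC k a b) :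
    QC (-k) a' b := by
  have : b * a' = (qq ^ k) • (a' * b) := by
    calc b * a' = a' * (a * b) * a' := by rw [← mul_assoc, h2, one_mul]
      _ = (qq ^ k) • (a' * b * (a * a')) := by
        rw [h, mul_smul_comm, smul_mul_assoc]; simp only [mul_assoc]
      _ = _ := by rw [h1, mul_one]
  have h3 : QC k b a' := this
  exact h3.symm

theorem QC.comm_iff {a b : A} : QC 0 a b ↔ a * b = b * a := by simp [QC]

theorem QC.listProd_right {K : ℕ} {y : ℕ → A} {a : A} {om : ℕ → ℤ}
    (h : ∀ k < K, QC (om k) a (y k)) :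
    QC (∑ k ∈ Finset.range K, om k) a ((List.range K).map y).prod := by
  induction K with
  | zero => simpa using QC.one_right a
  | succ K ih =>
    rw [List.range_succ, List.map_append, List.prod_append, Finset.sum_range_succ]
    simpa using (ih fun k hk => h k (by omega)).mul_right (h K (by omega))

theorem QC.listProd_left {K : ℕ} {x : ℕ → A} {b : A} {om : ℕ → ℤ}
    (h : ∀ k < K, QC (om k) (x k) b) :
    QC (∑ k ∈ Finset.range K, om k) ((List.range K).map x).prod b := by
  have := (QC.listProd_right (om := fun k => -om k) fun k hk => (h k hk).symm).symm
  exact this.of_eq (by simp)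

/-- Two ordered products `q`-commute with the exponent whose mixed second difference is
the exponent of the factors. -/
theorem QC.listProd {K L : ℕ} {x y : ℕ → A} {F : ℕ → ℕ → ℤ}
    (h0 : ∀ k, F k 0 = 0) (h0' : ∀ l, F 0 l = 0)
    (h : ∀ k < K, ∀ l < L,
      QC (F (k + 1) (l + 1) - F k (l + 1) - F (k + 1) l + F k l) (x k) (y l)) :
    QC (F K L) ((List.range K).map x).prod ((List.range L).map y).prod := by
  have h1 : ∀ k < K, QC (F (k + 1) L - F k L) (x k) ((List.range L).map y).prod := by
    intro k hk
    refine (QC.listProd_right fun l hl => h k hk l hl).of_eq ?_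
    have := Finset.sum_range_sub (fun l => F (k + 1) l - F k l) L
    simp only [h0, sub_zero] at this
    rw [← this]
    exact Finset.sum_congr rfl fun l _ => by ring
  refine (QC.listProd_left h1).of_eq ?_
  rw [Finset.sum_range_sub (fun k => F k L), h0', sub_zero]

theorem serre_of_split_aux {k B : Type*} [Field k] [Ring B] [Algebra k B] {q : k} (hq : q ≠ 0)
    {a b w : B} (e1 : w * a = q • (a * w)) (e2 : w * b = q⁻¹ • (b * w))
    (e3 : a * b = (q * q) • (b * a)) :
    (a + b) * (a + b) * w + w * ((a + b) * (a + b)) =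
      (q + q⁻¹) • ((a + b) * w * (a + b)) := by
  have f1 : ∀ c, w * (a * c) = q • (a * (w * c)) := fun c => by
    rw [← mul_assoc, e1, smul_mul_assoc, mul_assoc]
  have f2 : ∀ c, w * (b * c) = q⁻¹ • (b * (w * c)) := fun c => by
    rw [← mul_assoc, e2, smul_mul_assoc, mul_assoc]
  have f3 : ∀ c, a * (b * c) = (q * q) • (b * (a * c)) := fun c => by
    rw [← mul_assoc, e3, smul_mul_assoc, mul_assoc]
  simp only [mul_add, add_mul, mul_assoc, e1, e2, f1, f2, f3, mul_smul_comm, smul_smul,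
    smul_add]
  match_scalars <;> field_simp <;> ring

/-- The `q`-Serre relation for `a + b` and `w`, where `a` and `b` lie on different sides
of `w`. -/
theorem serre_of_split {a b w : A} (h1 : QC (-1) a w) (h2 : QC 1 b w) (h3 : QC 2 a b) :
    (a + b) * (a + b) * w + w * ((a + b) * (a + b)) =
      (qq + qq⁻¹) • ((a + b) * w * (a + b)) := by
  refine serre_of_split_aux qq_ne_zero (by simpa [QC] using h1.symm)
    (by simpa [QC] using h2.symm) ?_
  have : qq ^ (2 : ℤ) = qq * qq := by rw [zpow_two]
  simpa [QC, this] using h3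

/-- The Serre relation for sums of pairwise `q`-commuting elements `x r`, `r ∈ s`, and a sum of
elements `y t`, each of which splits the `x r` by a threshold. -/
theorem serre_sum {s t : Finset ℤ} {x y : ℤ → A} (p : ℤ → ℤ → Prop) [∀ r u, Decidable (p r u)]
    (hx : ∀ r ∈ s, ∀ r' ∈ s, ∀ u ∈ t, p r u → ¬ p r' u → QC 2 (x r) (x r'))
    (h1 : ∀ r ∈ s, ∀ u ∈ t, p r u → QC (-1) (x r) (y u))
    (h2 : ∀ r ∈ s, ∀ u ∈ t, ¬ p r u → QC 1 (x r) (y u)) :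
    (∑ r ∈ s, x r) * (∑ r ∈ s, x r) * (∑ u ∈ t, y u)
      + (∑ u ∈ t, y u) * ((∑ r ∈ s, x r) * (∑ r ∈ s, x r)) =
      (qq + qq⁻¹) • ((∑ r ∈ s, x r) * (∑ u ∈ t, y u) * (∑ r ∈ s, x r)) := by
  suffices H : ∀ u ∈ t, (∑ r ∈ s, x r) * (∑ r ∈ s, x r) * y u
      + y u * ((∑ r ∈ s, x r) * (∑ r ∈ s, x r)) =
      (qq + qq⁻¹) • ((∑ r ∈ s, x r) * y u * (∑ r ∈ s, x r)) by
    generalize ∑ r ∈ s, x r = S at *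
    rw [Finset.mul_sum, Finset.sum_mul, Finset.mul_sum, Finset.sum_mul, Finset.smul_sum,
      ← Finset.sum_add_distrib]
    exact Finset.sum_congr rfl H
  intro u hu
  rw [← Finset.sum_filter_add_sum_filter_not s (fun r => p r u)]
  refine serre_of_split (QC.sum_left ?_) (QC.sum_left ?_) (QC.sum_left ?_)
  · intro r hr
    rw [Finset.mem_filter] at hr
    exact h1 r hr.1 u hu hr.2
  · intro r hr
    rw [Finset.mem_filter] at hr
    exact h2 r hr.1 u hu hr.2
  · intro r hr
    refine QC.sum_right ?_
    intro r' hr'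
    rw [Finset.mem_filter] at hr hr'
    exact hx r hr.1 r' hr'.1 u hu hr.2 hr'.2

end QCommutation

section Chains

variable {A : Type*} [Ring A] [Algebra Kq A]

/-- The first index `s` such that `w_{i+1}^s` comes after `w_i^r`. -/
def thr (r : ℤ) : ℤ := if r < 0 then r else r + 1

theorem thr_cases (r : ℤ) : r < 0 ∧ thr r = r ∨ 0 ≤ r ∧ thr r = r + 1 := by
  unfold thr; split_ifs <;> omega

/-- The commutation pattern of the elements `w_i^r`, `-i ≤ r ≤ i - 1`. -/
structure IsWChain (n : ℕ) (w : ℤ → ℤ → A) : Prop where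
  same : ∀ i r s : ℤ, 1 ≤ i → i ≤ n → -i ≤ s → s < r → r ≤ i - 1 → QC 2 (w i r) (w i s)
  next_pos : ∀ i r s : ℤ, 1 ≤ i → i + 1 ≤ n → -i ≤ r → r ≤ i - 1 → thr r ≤ s → s ≤ i →
    QC 1 (w i r) (w (i + 1) s)
  next_neg : ∀ i r s : ℤ, 1 ≤ i → i + 1 ≤ n → -i ≤ r → r ≤ i - 1 → -(i + 1) ≤ s → s < thr r →
    QC (-1) (w i r) (w (i + 1) s)
  far : ∀ i j r s : ℤ, 1 ≤ i → i + 1 < j → j ≤ n → -i ≤ r → r ≤ i - 1 → -j ≤ s → s ≤ j - 1 →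
    QC 0 (w i r) (w j s)

/-- `∑_r w_i^r`. -/
def chainSum (w : ℤ → ℤ → A) (i : ℤ) : A := ∑ r ∈ Finset.Icc (-i) (i - 1), w i r

variable {n : ℕ} {w : ℤ → ℤ → A}

theorem IsWChain.comm (hw : IsWChain n w) {i j : ℤ} (hi : 1 ≤ i) (hij : i + 1 < j) (hj : j ≤ n) :
    chainSum w i * chainSum w j = chainSum w j * chainSum w i := by
  refine QC.comm_iff.1 (QC.sum_left fun r hr => QC.sum_right fun s hs => ?_)
  rw [Finset.mem_Icc] at hr hs
  exact hw.far i j r s hi hij hj hr.1 hr.2 hs.1 hs.2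

theorem IsWChain.serre_up (hw : IsWChain n w) {i : ℤ} (hi : 1 ≤ i) (hi' : i + 1 ≤ n) :
    chainSum w i * chainSum w i * chainSum w (i + 1)
      + chainSum w (i + 1) * (chainSum w i * chainSum w i) =
      (qq + qq⁻¹) • (chainSum w i * chainSum w (i + 1) * chainSum w i) := by
  refine serre_sum (fun r s => s < thr r) ?_ ?_ ?_
  · intro r hr r' hr' u hu h1 h2
    rw [Finset.mem_Icc] at hr hr' hu
    refine hw.same i r r' hi (by omega) hr'.1 ?_ hr.2
    rcases thr_cases r with h | h <;> rcases thr_cases r' with h' | h' <;> omega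
  · intro r hr u hu h1
    rw [Finset.mem_Icc] at hr hu
    exact hw.next_neg i r u hi hi' hr.1 hr.2 hu.1 h1
  · intro r hr u hu h1
    rw [Finset.mem_Icc] at hr hu
    exact hw.next_pos i r u hi hi' hr.1 hr.2 (by omega) (by omega)

theorem IsWChain.serre_down (hw : IsWChain n w) {i : ℤ} (hi : 1 ≤ i) (hi' : i + 1 ≤ n) :
    chainSum w (i + 1) * chainSum w (i + 1) * chainSum w i
      + chainSum w i * (chainSum w (i + 1) * chainSum w (i + 1)) =
      (qq + qq⁻¹) • (chainSum w (i + 1) * chainSum w i * chainSum w (i + 1)) := by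
  refine serre_sum (fun s r => thr r ≤ s) ?_ ?_ ?_
  · intro r hr r' hr' u hu h1 h2
    rw [Finset.mem_Icc] at hr hr' hu
    exact hw.same (i + 1) r r' (by omega) hi' hr'.1 (by omega) hr.2
  · intro r hr u hu h1
    rw [Finset.mem_Icc] at hr hu
    exact (hw.next_pos i u r hi hi' hu.1 hu.2 h1 (by omega)).symm
  · intro r hr u hu h1
    rw [Finset.mem_Icc] at hr hu
    exact (hw.next_neg i u r hi hi' hu.1 hu.2 hr.1 (by omega)).symm

/-- The root vectors `[e_k, [e_{k+1}, … e_{k+l}]]` built from `q`-commutators. -/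
def rootVec (e : ℤ → A) : ℕ → ℤ → A
  | 0, k => e k
  | l + 1, k => e k * rootVec e l (k + 1) - qq⁻¹ • (rootVec e l (k + 1) * e k)

/-- The sum of the products `w_k^r w_{k+1}^s ⋯` over increasing sequences of length `l + 1`. -/
def chainTail (w : ℤ → ℤ → A) : ℕ → ℤ → ℤ → A
  | 0, k, r => w k r
  | l + 1, k, r => w k r * ∑ s ∈ Finset.Icc (thr r) k, chainTail w l (k + 1) s

theorem IsWChain.far_tail (hw : IsWChain n w) (l : ℕ) : ∀ {i j r s : ℤ}, 1 ≤ i → i + 1 < j →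
    j + l ≤ n → -i ≤ r → r ≤ i - 1 → -j ≤ s → s ≤ j - 1 →
    QC 0 (w i r) (chainTail w l j s) := by
  induction l with
  | zero =>
    intro i j r s h1 h2 h3 h4 h5 h6 h7
    exact hw.far i j r s h1 h2 (by simpa using h3) h4 h5 h6 h7
  | succ l ih =>
    intro i j r s h1 h2 h3 h4 h5 h6 h7
    push_cast at h3
    refine (hw.far i j r s h1 h2 (by omega) h4 h5 h6 h7).mul_right (k := 0) (l := 0)
      (QC.sum_right fun s' hs' => ?_)
    rw [Finset.mem_Icc] at hs'
    have := thr_cases s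
    exact ih h1 (by omega) (by omega) h4 h5 (by omega) (by omega)

theorem IsWChain.next_tail (hw : IsWChain n w) (l : ℕ) {i r s k : ℤ} (h1 : 1 ≤ i)
    (h3 : i + 1 + l ≤ n) (h4 : -i ≤ r) (h5 : r ≤ i - 1) (h6 : -(i + 1) ≤ s)
    (h : QC k (w i r) (w (i + 1) s)) : QC k (w i r) (chainTail w l (i + 1) s) := by
  cases l with
  | zero => exact h
  | succ l =>
    push_cast at h3
    refine (h.mul_right (l := 0) (QC.sum_right fun s' hs' => ?_)).of_eq (add_zero k)
    rw [Finset.mem_Icc] at hs'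
    have := thr_cases s
    exact hw.far_tail l h1 (by omega) (by omega) h4 h5 (by omega) (by omega)

theorem IsWChain.rootVec_eq (hw : IsWChain n w) (l : ℕ) : ∀ {k : ℤ}, 1 ≤ k → k + l ≤ n →
    rootVec (chainSum w) l k =
      ((1 - qq⁻¹ * qq⁻¹) ^ l) • ∑ r ∈ Finset.Icc (-k) (k - 1), chainTail w l k r := by
  induction l with
  | zero => intro k _ _; simp [rootVec, chainTail, chainSum]
  | succ l ih =>
    intro k hk hkl
    push_cast at hkl
    have hq := qq_ne_zero
    rw [rootVec, ih (by omega) (by omega)]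
    rw [mul_smul_comm, smul_mul_assoc, smul_comm, ← smul_sub, pow_succ, mul_smul]
    congr 1
    rw [chainSum, Finset.sum_mul, Finset.mul_sum, ← sub_eq_zero, Finset.smul_sum,
      ← Finset.sum_sub_distrib, Finset.smul_sum, ← Finset.sum_sub_distrib]
    refine Finset.sum_eq_zero fun r hr => ?_
    rw [Finset.mem_Icc] at hr
    have ht := thr_cases r
    have hfil : Finset.Icc (thr r) k =
        (Finset.Icc (-(k + 1)) (k + 1 - 1)).filter fun s => thr r ≤ s := by
      ext s; simp only [Finset.mem_Icc, Finset.mem_filter]; omega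
    rw [chainTail, hfil, Finset.sum_filter, Finset.mul_sum, Finset.sum_mul, Finset.mul_sum,
      Finset.smul_sum, ← Finset.sum_sub_distrib, Finset.smul_sum, ← Finset.sum_sub_distrib]
    refine Finset.sum_eq_zero fun s hs => ?_
    rw [Finset.mem_Icc] at hs
    split_ifs with hrs
    · have h := (hw.next_tail l hk (by omega) hr.1 hr.2 hs.1
        (hw.next_pos k r s hk (by omega) hr.1 hr.2 hrs (by omega))).symm
      unfold QC at h
      rw [h]
      simp only [smul_smul, zpow_neg, zpow_one]
      rw [sub_smul, one_smul, sub_self]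
    · have h := (hw.next_tail l hk (by omega) hr.1 hr.2 hs.1
        (hw.next_neg k r s hk (by omega) hr.1 hr.2 hs.1 (by omega))).symm
      unfold QC at h
      rw [h]
      simp [smul_smul, hq]

end Chains

section Exchange

/-- The total doubled weight of the arrows from `u` to `v`. -/
def arrowWeight (n : ℕ) (u v : DnLabel) : ℤ :=
  ((dnArrows n).map fun a => if a.1 = u ∧ a.2.1 = v then a.2.2 else 0).sum

theorem eps2_eq (n : ℕ) (u v : DnLabel) :
    eps2 n u v = arrowWeight n u v - arrowWeight n v u := by
  unfold eps2 arrowWeight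
  induction dnArrows n with
  | nil => simp
  | cons a l ih => simp only [List.map_cons, List.sum_cons, ih]; ring

theorem castRange_eq (N : ℕ) :
    (do let a ← List.range N; pure (a : ℤ)) = (List.range N).map fun a : ℕ => (a : ℤ) :=
  List.flatMap_pure_eq_map _ _

theorem sum_map_flatMap_range {α : Type*} (N : ℕ) (f : ℕ → List α) (h : α → ℤ) :
    (((List.range N).flatMap f).map h).sum = ∑ i ∈ Finset.range N, ((f i).map h).sum := by
  induction N with
  | zero => simp
  | succ N ih => simp [List.range_succ, Finset.sum_range_succ, ← ih]

theorem sum_map_range (N : ℕ) (h : ℕ → ℤ) :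
    ((List.range N).map h).sum = ∑ i ∈ Finset.range N, h i := by
  induction N with
  | zero => simp
  | succ N ih => simp [List.range_succ, Finset.sum_range_succ, ← ih]

theorem sum_single_range {N : ℕ} {a b : ℕ → DnLabel} {u v : DnLabel} {c : ℤ} (i' : ℕ)
    {Q : Prop} [Decidable Q]
    (hu : ∀ i < N, a i = u → b i = v → i = i' ∧ Q)
    (hw : Q → i' < N ∧ a i' = u ∧ b i' = v) :
    (∑ i ∈ Finset.range N, if a i = u ∧ b i = v then c else 0) = if Q then c else 0 := by
  split_ifs with hQ
  · obtain ⟨h1, h2, h3⟩ := hw hQ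
    rw [Finset.sum_eq_single i', if_pos ⟨h2, h3⟩]
    · intro i hi hne
      exact if_neg fun h => hne (hu i (Finset.mem_range.1 hi) h.1 h.2).1
    · intro h; exact absurd (Finset.mem_range.2 h1) h
  · refine Finset.sum_eq_zero fun i hi => if_neg fun h => ?_
    exact hQ (hu i (Finset.mem_range.1 hi) h.1 h.2).2

theorem sum_single_range_range {N : ℕ} {g : ℕ → ℕ} {a b : ℕ → ℕ → DnLabel} {u v : DnLabel}
    {c : ℤ} (i' k' : ℕ) {Q : Prop} [Decidable Q]
    (hu : ∀ i < N, ∀ k < g i, a i k = u → b i k = v → i = i' ∧ k = k' ∧ Q)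
    (hw : Q → i' < N ∧ k' < g i' ∧ a i' k' = u ∧ b i' k' = v) :
    (∑ i ∈ Finset.range N, ∑ k ∈ Finset.range (g i), if a i k = u ∧ b i k = v then c else 0)
      = if Q then c else 0 := by
  have : ∀ i ∈ Finset.range N,
      (∑ k ∈ Finset.range (g i), if a i k = u ∧ b i k = v then c else 0)
        = if i = i' ∧ Q then c else 0 := by
    intro i hi
    rw [Finset.mem_range] at hi
    refine sum_single_range k' ?_ ?_
    · intro k hk h1 h2
      obtain ⟨h, h', h''⟩ := hu i hi k hk h1 h2
      exact ⟨h', h, h''⟩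
    · rintro ⟨rfl, h⟩
      obtain ⟨h1, h2, h3, h4⟩ := hw h
      exact ⟨h2, h3, h4⟩
  rw [Finset.sum_congr rfl this]
  split_ifs with hQ
  · obtain ⟨h1, -⟩ := hw hQ
    rw [Finset.sum_eq_single i']
    · simp [hQ]
    · intro i _ hne; simp [hne]
    · intro h; exact absurd (Finset.mem_range.2 h1) h
  · simp [hQ]

theorem sum_single_range_zero {N : ℕ} {a b : ℕ → DnLabel} {u v : DnLabel} {c : ℤ}
    (hu : ∀ i < N, a i = u → b i = v → False) :
    (∑ i ∈ Finset.range N, if a i = u ∧ b i = v then c else 0) = 0 :=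
  Finset.sum_eq_zero fun i hi => if_neg fun h => hu i (Finset.mem_range.1 hi) h.1 h.2

theorem sum_single_range_range_zero {N : ℕ} {g : ℕ → ℕ} {a b : ℕ → ℕ → DnLabel}
    {u v : DnLabel} {c : ℤ} (hu : ∀ i < N, ∀ k < g i, a i k = u → b i k = v → False) :
    (∑ i ∈ Finset.range N, ∑ k ∈ Finset.range (g i), if a i k = u ∧ b i k = v then c else 0)
      = 0 := by
  refine Finset.sum_eq_zero fun i hi => Finset.sum_eq_zero fun k hk => if_neg fun h => ?_
  exact hu i (Finset.mem_range.1 hi) k (Finset.mem_range.1 hk) h.1 h.2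

theorem arrowWeight_eq (n : ℕ) (u v : DnLabel) : arrowWeight n u v =
    (∑ i ∈ Finset.range n, ∑ k ∈ Finset.range (2 * i + 2),
      if DnLabel.V ((i : ℤ) + 1) (-((i : ℤ) + 1) + k) = u ∧
        DnLabel.V ((i : ℤ) + 1) (-((i : ℤ) + 1) + k + 1) = v then 2 else 0)
    + (∑ i ∈ Finset.range n, ∑ k ∈ Finset.range (2 * i + 2),
      if Lam n ((i : ℤ) + 1) (-((i : ℤ) + 1) + k) = u ∧
        Lam n ((i : ℤ) + 1) (-((i : ℤ) + 1) + k + 1) = v then 2 else 0)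
    + (∑ i ∈ Finset.range (n - 1),
      if DnLabel.V ((i : ℤ) + 1) (-((i : ℤ) + 1)) = u ∧
        DnLabel.V ((i : ℤ) + 2) (-((i : ℤ) + 2)) = v then 1 else 0)
    + (∑ i ∈ Finset.range (n - 1),
      if DnLabel.V ((i : ℤ) + 2) ((i : ℤ) + 2) = u ∧
        DnLabel.V ((i : ℤ) + 1) ((i : ℤ) + 1) = v then 1 else 0)
    + ((∑ i ∈ Finset.range (n - 1), ∑ k ∈ Finset.range (n - 1 - i),
      if DnLabel.V ((i : ℤ) + 1 + k) (-(k : ℤ)) = u ∧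
        DnLabel.V ((i : ℤ) + 2 + k) (-(k : ℤ) - 1) = v then 2 else 0)
    + ((∑ i ∈ Finset.range (n - 1),
      if DnLabel.V (n : ℤ) ((i : ℤ) + 1 - n) = u ∧ DnLabel.C ((i : ℤ) + 1) = v then 2 else 0)
    + (∑ i ∈ Finset.range (n - 1),
      if DnLabel.C ((i : ℤ) + 1) = u ∧
        DnLabel.V (n : ℤ) ((n : ℤ) - (i + 1)) = v then 2 else 0))
    + (∑ i ∈ Finset.range (n - 1), ∑ k ∈ Finset.range (n - 1 - i),
      if DnLabel.V ((i : ℤ) + 2 + k) ((k : ℤ) + 1) = u ∧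
        DnLabel.V ((i : ℤ) + 1 + k) (k : ℤ) = v then 2 else 0)) := by
  unfold arrowWeight dnArrows
  simp only [castRange_eq, List.map_map, Function.comp_def, List.map_append, List.sum_append, sum_map_flatMap_range, sum_map_range,
    Finset.sum_add_distrib, List.map_cons, List.map_nil, List.sum_cons, List.sum_nil, add_zero]

theorem Lam_eq_V_iff {n : ℕ} {x t i r : ℤ} : Lam n x t = .V i r ↔
    0 < t ∧ i = n + 1 - t ∧ r = x - n - 1 ∨ t < 0 ∧ i = n + 1 + t ∧ r = n + 1 - x := by
  unfold Lam th
  split_ifs <;> simp <;> omega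

theorem Lam_eq_C_iff {n : ℕ} {x t i : ℤ} : Lam n x t = .C i ↔ t = 0 ∧ i = x := by
  unfold Lam th
  split_ifs <;> simp <;> omega

theorem V_eq_V_iff {x t i r : ℤ} : DnLabel.V x t = .V i r ↔ x = i ∧ t = r := by simp

theorem C_eq_C_iff {x i : ℤ} : DnLabel.C x = .C i ↔ x = i := by simp

theorem arrowWeight_VV {n : ℕ} {i r j s : ℤ} (hu : DnLabel.valid n (.V i r))
    (hv : DnLabel.valid n (.V j s)) : arrowWeight n (.V i r) (.V j s) =
      (if j = i ∧ s = r + 1 then 2 else 0)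
      + (if s = r ∧ (r < 0 ∧ j = i - 1 ∨ 0 < r ∧ j = i + 1) then 2 else 0)
      + (if r = -i ∧ j = i + 1 ∧ s = r - 1 then 1 else 0)
      + (if r = i ∧ j = i - 1 ∧ s = r - 1 then 1 else 0)
      + (if r ≤ 0 ∧ 0 < i + r ∧ j = i + 1 ∧ s = r - 1 then 2 else 0)
      + (if 1 ≤ r ∧ r < i ∧ j = i - 1 ∧ s = r - 1 then 2 else 0) := by
  obtain ⟨a1, a2, a3, a4⟩ := hu
  obtain ⟨b1, b2, b3, b4⟩ := hv
  rw [arrowWeight_eq]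
  rw [sum_single_range_range (i - 1).toNat (r + i).toNat (Q := j = i ∧ s = r + 1),
    sum_single_range_range (n - |r|).toNat
      (if r < 0 then (n + 1 - i) + (n + 1 + r) else (n + 1 - r) - (n + 1 - i)).toNat
      (Q := s = r ∧ (r < 0 ∧ j = i - 1 ∨ 0 < r ∧ j = i + 1)),
    sum_single_range (i - 1).toNat (Q := r = -i ∧ j = i + 1 ∧ s = r - 1),
    sum_single_range (i - 2).toNat (Q := r = i ∧ j = i - 1 ∧ s = r - 1),
    sum_single_range_range (i + r - 1).toNat (-r).toNat
      (Q := r ≤ 0 ∧ 0 < i + r ∧ j = i + 1 ∧ s = r - 1),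
    sum_single_range_zero, sum_single_range_zero,
    sum_single_range_range (i - r - 1).toNat (r - 1).toNat
      (Q := 1 ≤ r ∧ r < i ∧ j = i - 1 ∧ s = r - 1)]
  · ring
  all_goals simp only [Lam_eq_V_iff, V_eq_V_iff, reduceCtorEq,
    false_imp_iff, imp_false, implies_true, not_false_eq_true, abs_eq_max_neg]
  all_goals intros
  all_goals omega

theorem arrowWeight_VC {n : ℕ} {i r j : ℤ} (hu : DnLabel.valid n (.V i r))
    (hv : DnLabel.valid n (.C j)) : arrowWeight n (.V i r) (.C j) =
      (if i = n ∧ r = n + 1 - j then 2 else 0)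
      + (if i = n ∧ r = j - n ∧ j < n then 2 else 0) := by
  obtain ⟨a1, a2, a3, a4⟩ := hu
  obtain ⟨b1, b2⟩ := hv
  rw [arrowWeight_eq]
  rw [sum_single_range_range_zero,
    sum_single_range_range (j - 1).toNat (j - 1).toNat (Q := i = n ∧ r = n + 1 - j),
    sum_single_range_zero, sum_single_range_zero,
    sum_single_range_range_zero,
    sum_single_range (j - 1).toNat (Q := i = n ∧ r = j - n ∧ j < n),
    sum_single_range_zero, sum_single_range_range_zero]
  · ring
  all_goals simp only [Lam_eq_V_iff, Lam_eq_C_iff, V_eq_V_iff, C_eq_C_iff, reduceCtorEq,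
    imp_false, implies_true, not_false_eq_true]
  all_goals intros
  all_goals omega

theorem arrowWeight_CV {n : ℕ} {i j s : ℤ} (hu : DnLabel.valid n (.C i))
    (hv : DnLabel.valid n (.V j s)) : arrowWeight n (.C i) (.V j s) =
      (if j = n ∧ s = i - n - 1 then 2 else 0)
      + (if j = n ∧ s = n - i ∧ i < n then 2 else 0) := by
  obtain ⟨a1, a2⟩ := hu
  obtain ⟨b1, b2, b3, b4⟩ := hv
  rw [arrowWeight_eq]
  rw [sum_single_range_range_zero,
    sum_single_range_range (i - 1).toNat i.toNat (Q := j = n ∧ s = i - n - 1),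
    sum_single_range_zero, sum_single_range_zero,
    sum_single_range_range_zero, sum_single_range_zero,
    sum_single_range (i - 1).toNat (Q := j = n ∧ s = n - i ∧ i < n),
    sum_single_range_range_zero]
  · ring
  all_goals simp only [Lam_eq_V_iff, Lam_eq_C_iff, V_eq_V_iff, C_eq_C_iff, reduceCtorEq,
    false_imp_iff, imp_false, implies_true, not_false_eq_true]
  all_goals intros
  all_goals omega

theorem arrowWeight_CC {n : ℕ} {i j : ℤ} : arrowWeight n (.C i) (.C j) = 0 := by
  rw [arrowWeight_eq]
  rw [sum_single_range_range_zero, sum_single_range_range_zero,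
    sum_single_range_zero, sum_single_range_zero,
    sum_single_range_range_zero, sum_single_range_zero,
    sum_single_range_zero, sum_single_range_range_zero]
  · ring
  all_goals simp only [Lam_eq_C_iff, C_eq_C_iff, reduceCtorEq,
    false_imp_iff, imp_false, implies_true, not_false_eq_true]
  all_goals intros
  all_goals omega

end Exchange

section ClosedForms

/-- The exponent with which the products along `V_{i,-i}, …, V_{i,r}` and
`V_{j,-j}, …, V_{j,s}` commute. -/
def formVV (i r j s : ℤ) : ℤ :=
  if r < -i ∨ s < -j then 0
  else if j = i then (if r < s then -2 else if s < r then 2 else 0)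
  else if j = i + 1 then (if r = i ∧ s = j then 0 else if thr r ≤ s then 1 else -1)
  else if i = j + 1 then (if r = i ∧ s = j then 0 else if thr s ≤ r then -1 else 1)
  else 0

theorem formVV_self (i r s : ℤ) : formVV i r i s =
    if r < -i ∨ s < -i then 0 else if r < s then -2 else if s < r then 2 else 0 := by
  simp [formVV]

theorem formVV_next (i r s : ℤ) : formVV i r (i + 1) s =
    if r < -i ∨ s < -(i + 1) ∨ (r = i ∧ s = i + 1) then 0 else if thr r ≤ s then 1 else -1 := by
  simp [formVV, ite_or]

theorem formVV_antisymm (i r j s : ℤ) : formVV j s i r = - formVV i r j s := by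
  unfold formVV
  split_ifs <;> omega

theorem formVV_far {i j : ℤ} (h : j ≠ i) (h' : j ≠ i + 1) (h'' : i ≠ j + 1) (r s : ℤ) :
    formVV i r j s = 0 := by
  simp [formVV, h, h', h'']

theorem eps2_antisymm (n : ℕ) (u v : DnLabel) : eps2 n v u = - eps2 n u v := by
  rw [eps2_eq, eps2_eq, neg_sub]

theorem eps2_VV_self {n : ℕ} {i r s : ℤ} (hu : DnLabel.valid n (.V i r))
    (hv : DnLabel.valid n (.V i s)) : eps2 n (.V i s) (.V i r) =
      formVV i r i s - formVV i (r - 1) i s - formVV i r i (s - 1)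
        + formVV i (r - 1) i (s - 1) := by
  rw [eps2_eq, arrowWeight_VV hu hv, arrowWeight_VV hv hu]
  obtain ⟨a1, a2, a3, a4⟩ := hu
  obtain ⟨b1, b2, b3, b4⟩ := hv
  simp only [formVV_self]
  grind

theorem eps2_VV_next {n : ℕ} {i r s : ℤ} (hu : DnLabel.valid n (.V i r))
    (hv : DnLabel.valid n (.V (i + 1) s)) : eps2 n (.V (i + 1) s) (.V i r) =
      formVV i r (i + 1) s - formVV i (r - 1) (i + 1) s - formVV i r (i + 1) (s - 1)
        + formVV i (r - 1) (i + 1) (s - 1) := by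
  have e1 : arrowWeight n (.V i r) (.V (i + 1) s) =
      if (s = r ∧ 0 < r) then 2 else if s ≠ r - 1 ∨ 0 < r then 0 else if r = -i then 1 else 2 := by
    rw [arrowWeight_VV hu hv]
    obtain ⟨a1, a2, a3, a4⟩ := hu
    grind
  have e2 : arrowWeight n (.V (i + 1) s) (.V i r) =
      if (s = r ∧ r < 0) then 2 else if s ≠ r + 1 ∨ r < 0 then 0 else if r = i then 1 else 2 := by
    rw [arrowWeight_VV hv hu]
    obtain ⟨a1, a2, a3, a4⟩ := hu
    grind
  rw [eps2_eq, e1, e2]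
  obtain ⟨a1, a2, a3, a4⟩ := hu
  obtain ⟨b1, b2, b3, b4⟩ := hv
  clear e1 e2
  have g1 : formVV i r (i + 1) s =
    if (r = i ∧ s = i + 1) then 0 else if thr r ≤ s then 1 else -1 := by
    rw [formVV_next]; grind
  have g2 : formVV i (r - 1) (i + 1) s =
    if r = -i then 0 else if thr (r - 1) ≤ s then 1 else -1 := by
    rw [formVV_next]; grind
  have g3 : formVV i r (i + 1) (s - 1) =
    if s = -(i + 1) then 0 else if thr r ≤ s - 1 then 1 else -1 := by
    rw [formVV_next]; grind
  have g4 : formVV i (r - 1) (i + 1) (s - 1) =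
    if r = -i ∨ s = -(i + 1) then 0 else if thr (r - 1) ≤ s - 1 then 1 else -1 := by
    rw [formVV_next]; grind
  rw [g1, g2, g3, g4]
  unfold thr
  clear g1 g2 g3 g4
  rcases (by omega : r < 0 ∨ r = 0 ∨ 0 < r) with h | h | h
  · by_cases h2 : r = -i <;> by_cases h3 : s = -(i+1) <;> grind
  · subst h; grind
  · by_cases h2 : r = i <;> by_cases h3 : s = i + 1 <;> grind

theorem eps2_VV {n : ℕ} {i r j s : ℤ} (hu : DnLabel.valid n (.V i r))
    (hv : DnLabel.valid n (.V j s)) : eps2 n (.V j s) (.V i r) =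
      formVV i r j s - formVV i (r - 1) j s - formVV i r j (s - 1)
        + formVV i (r - 1) j (s - 1) := by
  rcases (by omega : j = i ∨ j = i + 1 ∨ i = j + 1 ∨ (j ≠ i ∧ j ≠ i + 1 ∧ i ≠ j + 1)) with
    h | h | h | ⟨h, h', h''⟩
  · subst h
    exact eps2_VV_self hu hv
  · subst h
    exact eps2_VV_next hu hv
  · subst h
    rw [eps2_antisymm, eps2_VV_next hv hu]
    simp only [formVV_antisymm (j + 1) _ j]
    ring
  · simp only [formVV_far h h' h'']
    rw [eps2_eq, arrowWeight_VV hu hv, arrowWeight_VV hv hu]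
    simp (disch := omega) only [if_neg]
    ring

theorem Lam_valid {n : ℕ} {i r : ℤ} (h : DnLabel.valid n (.V i r)) : (Lam n i r).valid n := by
  obtain ⟨h1, h2, h3, h4⟩ := h
  unfold Lam th
  split_ifs <;> simp only [DnLabel.valid] <;> omega

theorem Lam_pos {n : ℕ} {i r : ℤ} (h : 0 < r) : Lam n i r = .V (n + 1 - r) (i - n - 1) := by
  simp only [Lam, if_pos h, th, neg_sub, sub_sub]

theorem Lam_neg {n : ℕ} {i r : ℤ} (h : r < 0) : Lam n i r = .V (n + 1 + r) (n + 1 - i) := by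
  simp only [Lam, if_neg h.not_gt, if_pos h, th, sub_neg_eq_add]

theorem Lam_zero {n : ℕ} {i : ℤ} : Lam n i 0 = .C i := by simp [Lam]

theorem eps2_LL_of_le {n : ℕ} {i r j s : ℤ} (hu : DnLabel.valid n (.V i r))
    (hv : DnLabel.valid n (.V j s)) (hrs : r ≤ s) : eps2 n (Lam n j s) (Lam n i r) =
      eps2 n (.V j s) (.V i r) := by
  have hu' := Lam_valid hu
  have hv' := Lam_valid hv
  rw [eps2_eq, eps2_eq, arrowWeight_VV hu hv, arrowWeight_VV hv hu]
  rcases lt_trichotomy r 0 with h | h | h <;> rcases lt_trichotomy s 0 with h' | h' | h'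
  · rw [Lam_neg h] at *
    rw [Lam_neg h'] at *
    rw [arrowWeight_VV hu' hv', arrowWeight_VV hv' hu']
    obtain ⟨a1, a2, a3, a4⟩ := hu
    obtain ⟨b1, b2, b3, b4⟩ := hv
    clear hu' hv'
    rcases (by omega : j < i - 1 ∨ i + 1 < j ∨ i = j + 1 ∨ i = j ∨ j = i + 1) with g | g | g | g | g
    · simp (disch := omega) only [if_neg]
    · simp (disch := omega) only [if_neg]
    all_goals
      subst g
      rcases (by omega : s < r - 1 ∨ r + 1 < s ∨ r = s + 1 ∨ r = s ∨ s = r + 1) with g | g | g | g | g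
      · simp (disch := omega) only [if_neg]
      · simp (disch := omega) only [if_neg]
      all_goals
        subst g
        grind
  · subst h'
    rw [Lam_neg h] at *
    rw [Lam_zero] at *
    rw [arrowWeight_VC hu' hv', arrowWeight_CV hv' hu']
    obtain ⟨a1, a2, a3, a4⟩ := hu
    obtain ⟨b1, b2, b3, b4⟩ := hv
    clear hu' hv'
    rcases (by omega : r < -1 ∨ r = -1) with g | g
    · simp (disch := omega) only [if_neg]
      rfl
    · subst g
      rcases (by omega : j < i - 1 ∨ i + 1 < j ∨ i = j + 1 ∨ i = j ∨ j = i + 1) with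
        g | g | g | g | g
      · simp (disch := omega) only [if_neg]; rfl
      · simp (disch := omega) only [if_neg]; rfl
      all_goals
        subst g
        grind
  · rw [Lam_neg h] at *
    rw [Lam_pos h'] at *
    rw [arrowWeight_VV hu' hv', arrowWeight_VV hv' hu']
    obtain ⟨a1, a2, a3, a4⟩ := hu
    obtain ⟨b1, b2, b3, b4⟩ := hv
    simp (disch := omega) only [if_neg]
  · omega
  · subst h h'
    rw [Lam_zero, Lam_zero, arrowWeight_CC, arrowWeight_CC]
    obtain ⟨a1, a2, a3, a4⟩ := hu
    obtain ⟨b1, b2, b3, b4⟩ := hv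
    simp (disch := omega) only [if_neg]
    rfl
  · subst h
    rw [Lam_zero] at *
    rw [Lam_pos h'] at *
    rw [arrowWeight_VC hv' hu', arrowWeight_CV hu' hv']
    obtain ⟨a1, a2, a3, a4⟩ := hu
    obtain ⟨b1, b2, b3, b4⟩ := hv
    clear hu' hv'
    rcases (by omega : 1 < s ∨ s = 1) with g | g
    · simp (disch := omega) only [if_neg]
      rfl
    · subst g
      rcases (by omega : j < i - 1 ∨ i + 1 < j ∨ i = j + 1 ∨ i = j ∨ j = i + 1) with
        g | g | g | g | g
      · simp (disch := omega) only [if_neg]; rfl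
      · simp (disch := omega) only [if_neg]; rfl
      all_goals
        subst g
        grind
  · omega
  · omega
  · rw [Lam_pos h] at *
    rw [Lam_pos h'] at *
    rw [arrowWeight_VV hu' hv', arrowWeight_VV hv' hu']
    obtain ⟨a1, a2, a3, a4⟩ := hu
    obtain ⟨b1, b2, b3, b4⟩ := hv
    clear hu' hv'
    rcases (by omega : j < i - 1 ∨ i + 1 < j ∨ i = j + 1 ∨ i = j ∨ j = i + 1) with g | g | g | g | g
    · simp (disch := omega) only [if_neg]
    · simp (disch := omega) only [if_neg]
    all_goals
      subst g
      rcases (by omega : r + 1 < s ∨ r = s ∨ s = r + 1) with g | g | g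
      · simp (disch := omega) only [if_neg]
      all_goals
        subst g
        grind

theorem eps2_LL {n : ℕ} {i r j s : ℤ} (hu : DnLabel.valid n (.V i r))
    (hv : DnLabel.valid n (.V j s)) : eps2 n (Lam n j s) (Lam n i r) =
      eps2 n (.V j s) (.V i r) := by
  rcases le_total r s with h | h
  · exact eps2_LL_of_le hu hv h
  · rw [eps2_antisymm, eps2_LL_of_le hv hu h, ← eps2_antisymm]

/-- The exponent with which the product along `V_{i,-i}, …, V_{i,r}` and the product
along `Λ_{j,-j}, …, Λ_{j,s}` commute. -/
def formVL (n : ℕ) (i r j s : ℤ) : ℤ :=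
  if r < -i ∨ s < -j ∨ (r = i ∧ s = j) then 0
  else if r = i then - cartanA i (th n j)
  else if s = j then cartanA i (th n j)
  else if (r = th n j - 1 ∧ s = - th n i) ∨ (r = - th n j - 1 ∧ s = th n i) then -2
  else if (r = th n j ∧ s = - th n i - 1) ∨ (r = - th n j ∧ s = th n i - 1) then 2
  else 0

theorem cartanA_eq (i j : ℤ) :
    cartanA i j = if i = j then 2 else if i = j + 1 ∨ j = i + 1 then -1 else 0 := by
  unfold cartanA
  split_ifs <;> omega

theorem eps2_VL_neg {n : ℕ} {i r j s : ℤ} (hu : DnLabel.valid n (.V i r))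
    (hv : DnLabel.valid n (.V j s)) (h : s < 0) : eps2 n (Lam n j s) (.V i r) =
      formVL n i r j s - formVL n i (r - 1) j s - formVL n i r j (s - 1)
        + formVL n i (r - 1) j (s - 1) := by
  have hv' := Lam_valid hv
  rw [Lam_neg h] at hv' ⊢
  rw [eps2_eq, arrowWeight_VV hu hv', arrowWeight_VV hv' hu]
  obtain ⟨a, rfl⟩ : ∃ a, s = a - (n + 1) := ⟨n + 1 + s, by ring⟩
  obtain ⟨b, rfl⟩ : ∃ b, j = n + 1 - b := ⟨n + 1 - j, by ring⟩
  have ea : (n : ℤ) + 1 + (a - (n + 1)) = a := by ring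
  have eb : (n : ℤ) + 1 - (n + 1 - b) = b := by ring
  rw [ea, eb] at hv' ⊢
  have hc := cartanA_eq i b
  unfold formVL
  simp only [th, eb]
  obtain ⟨a1, a2, a3, a4⟩ := hu
  obtain ⟨b1, b2, b3, b4⟩ := hv'
  obtain ⟨c1, c2, c3, c4⟩ := hv
  generalize cartanA i b = c at *
  generalize (n : ℤ) = N at *
  have g1 : ∀ x, x = r ∨ x = r - 1 → ∀ y, y = a ∨ y = a - 1 → 
    (if x < -i ∨ y - (N + 1) < -(N + 1 - b) ∨ (x = i ∧ y - (N + 1) = (N + 1 - b)) then 0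
      else if x = i then - c else if y - (N + 1) = N + 1 - b then c else
      if (x = b - 1 ∧ y - (N + 1) = -(N + 1 - i)) ∨ (x = -b - 1 ∧ y - (N + 1) = N + 1 - i) then -2
      else if (x = b ∧ y - (N + 1) = -(N + 1 - i) - 1) ∨
        (x = - b ∧ y - (N + 1) = (N + 1 - i) - 1) then 2
      else 0) = if x < -i ∨ y < b then 0 else if x = i then -c else if x = b - 1 ∧ y = i then -2
        else if x = b ∧ y = i - 1 then 2 else 0 := by
    intro x hx y hy
    rw [if_congr (Q := x < -i ∨ y < b) (by omega) rfl rfl]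
    by_cases h1 : x < -i ∨ y < b
    · rw [if_pos h1, if_pos h1]
    rw [if_neg h1, if_neg h1]
    by_cases h2 : x = i
    · rw [if_pos h2, if_pos h2]
    rw [if_neg h2, if_neg h2, if_neg (by omega), if_congr (Q := x = b - 1 ∧ y = i) (by omega) rfl rfl,
      if_congr (P := (x = b ∧ y - (N + 1) = -(N + 1 - i) - 1) ∨ _) (Q := x = b ∧ y = i - 1)
        (by omega) rfl rfl]
  have ha : a - (N + 1) - 1 = (a - 1) - (N + 1) := by ring
  rw [ha, g1 r (Or.inl rfl) a (Or.inl rfl), g1 (r - 1) (Or.inr rfl) a (Or.inl rfl),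
    g1 r (Or.inl rfl) (a - 1) (Or.inr rfl), g1 (r - 1) (Or.inr rfl) (a - 1) (Or.inr rfl)]
  clear g1 ha
  rcases (by omega : a < i - 1 ∨ i + 1 < a ∨ i = a + 1 ∨ i = a ∨ a = i + 1) with g | g | g | g | g
  · simp (disch := omega) only [if_neg]
    grind
  · simp (disch := omega) only [if_neg]
    grind
  all_goals
    subst g
    rcases (by omega : b < r - 1 ∨ r + 1 < b ∨ r = b + 1 ∨ r = b ∨ b = r + 1) with
      g | g | g | g | g
    · simp (disch := omega) only [if_neg]
      grind
    · simp (disch := omega) only [if_neg]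
      grind
    all_goals
      subst g
      grind

theorem eps2_VL_pos {n : ℕ} {i r j s : ℤ} (hu : DnLabel.valid n (.V i r))
    (hv : DnLabel.valid n (.V j s)) (h : 0 < s) : eps2 n (Lam n j s) (.V i r) =
      formVL n i r j s - formVL n i (r - 1) j s - formVL n i r j (s - 1)
        + formVL n i (r - 1) j (s - 1) := by
  have hv' := Lam_valid hv
  rw [Lam_pos h] at hv' ⊢
  rw [eps2_eq, arrowWeight_VV hu hv', arrowWeight_VV hv' hu]
  obtain ⟨a, rfl⟩ : ∃ a, s = n + 1 - a := ⟨n + 1 - s, by ring⟩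
  obtain ⟨b, rfl⟩ : ∃ b, j = n + 1 + b := ⟨j - (n + 1), by ring⟩
  have ea : (n : ℤ) + 1 - (n + 1 - a) = a := by ring
  have eb : (n : ℤ) + 1 + b - n - 1 = b := by ring
  have ec : (n : ℤ) + 1 - (n + 1 + b) = - b := by ring
  rw [ea, eb] at hv' ⊢
  have hc := cartanA_eq i (-b)
  unfold formVL
  simp only [th, ec]
  obtain ⟨a1, a2, a3, a4⟩ := hu
  obtain ⟨b1, b2, b3, b4⟩ := hv'
  obtain ⟨c1, c2, c3, c4⟩ := hv
  generalize cartanA i (-b) = c at *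
  generalize (n : ℤ) = N at *
  have g1 : ∀ x, x = r ∨ x = r - 1 → ∀ y, y = a ∨ y = a + 1 →
    (if x < -i ∨ N + 1 - y < -(N + 1 + b) ∨ (x = i ∧ N + 1 - y = (N + 1 + b)) then 0
      else if x = i then - c else if N + 1 - y = N + 1 + b then c else
      if (x = -b - 1 ∧ N + 1 - y = -(N + 1 - i)) ∨ (x = - -b - 1 ∧ N + 1 - y = N + 1 - i) then -2
      else if (x = -b ∧ N + 1 - y = -(N + 1 - i) - 1) ∨
        (x = - -b ∧ N + 1 - y = (N + 1 - i) - 1) then 2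
      else 0) = if x < -i ∨ x = i ∧ y = -b then 0 else if x = i then -c else if y = -b then c
        else if x = b - 1 ∧ y = i then -2
        else if x = b ∧ y = i + 1 then 2 else 0 := by
    intro x hx y hy
    clear hc
    split_ifs <;> first | rfl | (exfalso; omega)
  have ha : N + 1 - a - 1 = (N + 1) - (a + 1) := by ring
  rw [ha, g1 r (Or.inl rfl) a (Or.inl rfl), g1 (r - 1) (Or.inr rfl) a (Or.inl rfl),
    g1 r (Or.inl rfl) (a + 1) (Or.inr rfl), g1 (r - 1) (Or.inr rfl) (a + 1) (Or.inr rfl)]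
  clear g1 ha
  rcases (by omega : a < i - 1 ∨ i + 1 < a ∨ i = a + 1 ∨ i = a ∨ a = i + 1) with g | g | g | g | g
  · simp (disch := omega) only [if_neg]
    grind
  · simp (disch := omega) only [if_neg]
    grind
  all_goals
    subst g
    rcases (by omega : b < r - 1 ∨ r + 1 < b ∨ r = b + 1 ∨ r = b ∨ b = r + 1) with
      g | g | g | g | g
    · simp (disch := omega) only [if_neg]
      grind
    · simp (disch := omega) only [if_neg]
      grind
    all_goals
      subst g
      grind

theorem eps2_VL_zero {n : ℕ} {i r j : ℤ} (hu : DnLabel.valid n (.V i r))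
    (hv : DnLabel.valid n (.V j 0)) : eps2 n (Lam n j 0) (.V i r) =
      formVL n i r j 0 - formVL n i (r - 1) j 0 - formVL n i r j (0 - 1)
        + formVL n i (r - 1) j (0 - 1) := by
  have hv' := Lam_valid hv
  rw [Lam_zero] at hv' ⊢
  rw [eps2_eq, arrowWeight_VC hu hv', arrowWeight_CV hv' hu]
  unfold formVL
  simp only [th]
  obtain ⟨a1, a2, a3, a4⟩ := hu
  obtain ⟨b1, b2⟩ := hv'
  generalize cartanA i _ = c
  clear hv
  obtain ⟨N, hN⟩ : ∃ N : ℤ, N = n := ⟨_, rfl⟩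
  simp only [← hN] at *
  clear hN
  have g1 : ∀ x, x = r ∨ x = r - 1 → ∀ y : ℤ, y = 0 ∨ y = 0 - 1 →
    (if x < -i ∨ y < -j ∨ (x = i ∧ y = j) then 0
      else if x = i then - c else if y = j then c else
      if (x = N + 1 - j - 1 ∧ y = -(N + 1 - i)) ∨ (x = -(N + 1 - j) - 1 ∧ y = N + 1 - i) then -2
      else if (x = N + 1 - j ∧ y = -(N + 1 - i) - 1) ∨
        (x = -(N + 1 - j) ∧ y = (N + 1 - i) - 1) then 2
      else 0) = if x < -i then 0 else if x = i then -c
        else if x = N - j ∧ i = N ∧ y = -1 then -2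
        else if x = j - N - 1 ∧ i = N ∧ y = 0 then 2 else 0 := by
    intro x hx y hy
    split_ifs <;> first | rfl | (exfalso; omega)
  rw [g1 r (Or.inl rfl) 0 (Or.inl rfl), g1 (r - 1) (Or.inr rfl) 0 (Or.inl rfl),
    g1 r (Or.inl rfl) (0 - 1) (Or.inr rfl), g1 (r - 1) (Or.inr rfl) (0 - 1) (Or.inr rfl)]
  clear g1
  rcases (by omega : i < N ∨ i = N) with h | h
  · simp (disch := omega) only [if_neg]
    grind
  · subst h
    grind

theorem eps2_VL {n : ℕ} {i r j s : ℤ} (hu : DnLabel.valid n (.V i r))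
    (hv : DnLabel.valid n (.V j s)) : eps2 n (Lam n j s) (.V i r) =
      formVL n i r j s - formVL n i (r - 1) j s - formVL n i r j (s - 1)
        + formVL n i (r - 1) j (s - 1) := by
  rcases lt_trichotomy s 0 with h | h | h
  · exact eps2_VL_neg hu hv h
  · subst h
    exact eps2_VL_zero hu hv
  · exact eps2_VL_pos hu hv h

end ClosedForms

section Torus

variable {n : ℕ}

/-- The ordered product `X_{x(a)} X_{x(a+1)} ⋯ X_{x(r)}`. -/
def pathProd (n : ℕ) (x : ℤ → DnLabel) (a r : ℤ) : Dtorus n :=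
  ((List.range (r - a + 1).toNat).map fun k : ℕ => Xg n (x (a + k))).prod

theorem Vprod_eq (n : ℕ) (i r : ℤ) : Vprod n i r = pathProd n (fun t => .V i t) (-i) r := by
  unfold Vprod pathProd
  rw [castRange_eq, List.map_map, sub_neg_eq_add]
  rfl

theorem Lprod_eq (n : ℕ) (i r : ℤ) : Lprod n i r = pathProd n (fun t => Lam n i t) (-i) r := by
  unfold Lprod pathProd
  rw [castRange_eq, List.map_map, sub_neg_eq_add]
  rfl

theorem pathProd_succ (x : ℤ → DnLabel) {a r : ℤ} (h : a ≤ r) :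
    pathProd n x a r = pathProd n x a (r - 1) * Xg n (x r) := by
  unfold pathProd
  obtain ⟨k, rfl⟩ : ∃ k : ℕ, r = a + k := ⟨(r - a).toNat, by omega⟩
  rw [show (a + k - a + 1 : ℤ).toNat = k + 1 by omega,
    show (a + k - 1 - a + 1 : ℤ).toNat = k by omega, List.range_succ]
  simp

theorem pathProd_self (x : ℤ → DnLabel) (a : ℤ) : pathProd n x a a = Xg n (x a) := by
  simp [pathProd]

theorem pathProd_of_lt (x : ℤ → DnLabel) {a r : ℤ} (h : r < a) : pathProd n x a r = 1 := by
  unfold pathProd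
  rw [show (r - a + 1).toNat = 0 by omega]
  simp

theorem Xg_comm {u v : DnLabel} (hu : u.valid n) (hv : v.valid n) :
    QC (eps2 n v u) (Xg n u) (Xg n v) := by
  have := RingQuot.mkAlgHom_rel Kq (DnRel.comm ⟨u, hu⟩ ⟨v, hv⟩)
  simpa [Xg, hu, hv, QC] using this

theorem Xg_mul_Xinv (v : DnLabel) : Xg n v * Xinv n v = 1 := by
  by_cases hv : v.valid n
  · have := RingQuot.mkAlgHom_rel Kq (DnRel.mul_inv ⟨v, hv⟩)
    simpa [Xg, Xinv, hv] using this
  · simp [Xg, Xinv, hv]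

theorem Xinv_mul_Xg (v : DnLabel) : Xinv n v * Xg n v = 1 := by
  by_cases hv : v.valid n
  · have := RingQuot.mkAlgHom_rel Kq (DnRel.inv_mul ⟨v, hv⟩)
    simpa [Xg, Xinv, hv] using this
  · simp [Xg, Xinv, hv]

theorem pathProd_comm {x y : ℤ → DnLabel} {a b c d : ℤ} {F : ℤ → ℤ → ℤ}
    (hx : ∀ r, a ≤ r → r ≤ c → (x r).valid n) (hy : ∀ s, b ≤ s → s ≤ d → (y s).valid n)
    (h0 : ∀ r, F r (b - 1) = 0) (h0' : ∀ s, F (a - 1) s = 0)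
    (h : ∀ r s, a ≤ r → r ≤ c → b ≤ s → s ≤ d →
      eps2 n (y s) (x r) = F r s - F (r - 1) s - F r (s - 1) + F (r - 1) (s - 1))
    (hac : a - 1 ≤ c) (hbd : b - 1 ≤ d) :
    QC (F c d) (pathProd n x a c) (pathProd n y b d) := by
  have key := QC.listProd (A := Dtorus n) (K := (c - a + 1).toNat) (L := (d - b + 1).toNat)
    (x := fun k : ℕ => Xg n (x (a + k))) (y := fun k : ℕ => Xg n (y (b + k)))
    (F := fun k l => F (a - 1 + k) (b - 1 + l)) (fun k => by simpa using h0 _)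
    (fun l => by simpa using h0' _) ?_
  · refine key.of_eq ?_
    congr 1 <;> omega
  · intro k hk l hl
    refine (Xg_comm (hx _ (by omega) (by omega)) (hy _ (by omega) (by omega))).of_eq ?_
    rw [h _ _ (by omega) (by omega) (by omega) (by omega)]
    push_cast
    rw [show a + (k : ℤ) - 1 = a - 1 + k by ring, show b + (l : ℤ) - 1 = b - 1 + l by ring,
      show a + (k : ℤ) = a - 1 + (k + 1) by ring, show b + (l : ℤ) = b - 1 + (l + 1) by ring]

variable {i r j s : ℤ}

theorem Vprod_Vprod (hi : 1 ≤ i ∧ i ≤ n) (hr : -i - 1 ≤ r ∧ r ≤ i) (hj : 1 ≤ j ∧ j ≤ n)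
    (hs : -j - 1 ≤ s ∧ s ≤ j) : QC (formVV i r j s) (Vprod n i r) (Vprod n j s) := by
  rw [Vprod_eq, Vprod_eq]
  refine pathProd_comm (F := fun r s => formVV i r j s) (fun t h h' => ⟨hi.1, hi.2, h, by omega⟩)
    (fun t h h' => ⟨hj.1, hj.2, h, by omega⟩) (fun _ => if_pos (by omega))
    (fun _ => if_pos (by omega)) ?_ hr.1 hs.1
  intro t u h1 h2 h3 h4
  exact eps2_VV ⟨hi.1, hi.2, h1, by omega⟩ ⟨hj.1, hj.2, h3, by omega⟩

theorem Lprod_Lprod (hi : 1 ≤ i ∧ i ≤ n) (hr : -i - 1 ≤ r ∧ r ≤ i) (hj : 1 ≤ j ∧ j ≤ n)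
    (hs : -j - 1 ≤ s ∧ s ≤ j) : QC (formVV i r j s) (Lprod n i r) (Lprod n j s) := by
  rw [Lprod_eq, Lprod_eq]
  refine pathProd_comm (F := fun r s => formVV i r j s)
    (fun t h h' => Lam_valid ⟨hi.1, hi.2, h, by omega⟩)
    (fun t h h' => Lam_valid ⟨hj.1, hj.2, h, by omega⟩) (fun _ => if_pos (by omega))
    (fun _ => if_pos (by omega)) ?_ hr.1 hs.1
  intro t u h1 h2 h3 h4
  rw [eps2_LL ⟨hi.1, hi.2, h1, by omega⟩ ⟨hj.1, hj.2, h3, by omega⟩]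
  exact eps2_VV ⟨hi.1, hi.2, h1, by omega⟩ ⟨hj.1, hj.2, h3, by omega⟩

theorem Vprod_Lprod (hi : 1 ≤ i ∧ i ≤ n) (hr : -i - 1 ≤ r ∧ r ≤ i) (hj : 1 ≤ j ∧ j ≤ n)
    (hs : -j - 1 ≤ s ∧ s ≤ j) : QC (formVL n i r j s) (Vprod n i r) (Lprod n j s) := by
  rw [Vprod_eq, Lprod_eq]
  refine pathProd_comm (F := fun r s => formVL n i r j s)
    (fun t h h' => ⟨hi.1, hi.2, h, by omega⟩)
    (fun t h h' => Lam_valid ⟨hj.1, hj.2, h, by omega⟩) (fun _ => if_pos (by omega))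
    (fun _ => if_pos (by omega)) ?_ hr.1 hs.1
  intro t u h1 h2 h3 h4
  exact eps2_VL ⟨hi.1, hi.2, h1, by omega⟩ ⟨hj.1, hj.2, h3, by omega⟩

theorem isWChain_of_formVV {w : ℤ → ℤ → Dtorus n}
    (h : ∀ {i r j s : ℤ}, 1 ≤ i ∧ i ≤ n → -i - 1 ≤ r ∧ r ≤ i → 1 ≤ j ∧ j ≤ n →
      -j - 1 ≤ s ∧ s ≤ j → QC (formVV i r j s) (w i r) (w j s)) : IsWChain n w where
  same i r s h1 h2 h3 h4 h5 := by
    refine (h ⟨h1, h2⟩ ⟨by omega, by omega⟩ ⟨h1, h2⟩ ⟨by omega, by omega⟩).of_eq ?_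
    rw [formVV_self, if_neg (by omega), if_neg (by omega), if_pos h4]
  next_pos i r s h1 h2 h3 h4 h5 h6 := by
    have := thr_cases r
    refine (h ⟨h1, by omega⟩ ⟨by omega, by omega⟩ ⟨by omega, h2⟩ ⟨by omega, by omega⟩).of_eq ?_
    rw [formVV_next, if_neg (by omega), if_pos h5]
  next_neg i r s h1 h2 h3 h4 h5 h6 := by
    have := thr_cases r
    refine (h ⟨h1, by omega⟩ ⟨by omega, by omega⟩ ⟨by omega, h2⟩ ⟨by omega, by omega⟩).of_eq ?_
    rw [formVV_next, if_neg (by omega), if_neg (by omega)]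
  far i j r s h1 h2 h3 h4 h5 h6 h7 := by
    refine (h ⟨h1, by omega⟩ ⟨by omega, by omega⟩ ⟨by omega, h3⟩ ⟨by omega, by omega⟩).of_eq ?_
    exact formVV_far (by omega) (by omega) (by omega) _ _

theorem isWChain_ww : IsWChain n (ww n) :=
  isWChain_of_formVV fun h1 h2 h3 h4 => ((Vprod_Vprod h1 h2 h3 h4).smul_left _).smul_right _

theorem isWChain_mm : IsWChain n (mm n) :=
  isWChain_of_formVV fun h1 h2 h3 h4 => ((Lprod_Lprod h1 h2 h3 h4).smul_left _).smul_right _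

theorem ww_mm (hi : 1 ≤ i ∧ i ≤ n) (hr : -i - 1 ≤ r ∧ r ≤ i) (hj : 1 ≤ j ∧ j ≤ n)
    (hs : -j - 1 ≤ s ∧ s ≤ j) : QC (formVL n i r j s) (ww n i r) (mm n j s) :=
  ((Vprod_Lprod hi hr hj hs).smul_left _).smul_right _

end Torus

section Crossing

variable {n : ℕ} {i r j s : ℤ}

theorem ii_mul_ii : ii * ii = -1 := by
  unfold ii
  rw [← map_mul, Complex.I_mul_I, map_neg, map_one]

theorem Xg_Lprod {t : ℤ} (hi : 1 ≤ i ∧ i ≤ n) (ht : -i ≤ t ∧ t ≤ i) (hj : 1 ≤ j ∧ j ≤ n)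
    (hs : -j - 1 ≤ s ∧ s ≤ j) :
    QC (formVL n i t j s - formVL n i (t - 1) j s) (Xg n (.V i t)) (Lprod n j s) := by
  rw [Lprod_eq, ← pathProd_self (fun t => DnLabel.V i t)]
  refine pathProd_comm (F := fun r s => formVL n i r j s - formVL n i (t - 1) j s)
    (fun x h h' => ⟨hi.1, hi.2, by omega, by omega⟩)
    (fun x h h' => Lam_valid ⟨hj.1, hj.2, h, by omega⟩)
    (fun x => by simp only [formVL]; rw [if_pos (by omega), if_pos (by omega), sub_zero])
    (fun x => sub_self _) ?_ (by omega) hs.1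
  intro x y h1 h2 h3 h4
  obtain rfl : x = t := le_antisymm h2 h1
  rw [eps2_VL ⟨hi.1, hi.2, ht.1, ht.2⟩ ⟨hj.1, hj.2, h3, by omega⟩]
  ring

theorem Vprod_succ (h : -i ≤ r) : Vprod n i r = Vprod n i (r - 1) * Xg n (.V i r) := by
  rw [Vprod_eq, Vprod_eq, pathProd_succ _ h]

theorem Lprod_succ (h : -i ≤ r) : Lprod n i r = Lprod n i (r - 1) * Xg n (Lam n i r) := by
  rw [Lprod_eq, Lprod_eq, pathProd_succ _ h]

theorem ww_succ (h : -i ≤ r) : ww n i r = qq • (ww n i (r - 1) * Xg n (.V i r)) := by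
  rw [ww, ww, Vprod_succ h, smul_mul_assoc, smul_smul, show i + r = 1 + (i + (r - 1)) by ring,
    zpow_add₀ qq_ne_zero, zpow_one]
  congr 1
  ring

theorem mm_succ (h : -i ≤ r) : mm n i r = qq • (mm n i (r - 1) * Xg n (Lam n i r)) := by
  rw [mm, mm, Lprod_succ h, smul_mul_assoc, smul_smul, show i + r = 1 + (i + (r - 1)) by ring,
    zpow_add₀ qq_ne_zero, zpow_one]
  congr 1
  ring

theorem sub_of_QC {A : Type*} [Ring A] [Algebra Kq A] {k : ℤ} {a b : A} (h : QC k a b) :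
    a * b - b * a = (1 - qq ^ (-k)) • (a * b) := by
  have h' : b * a = qq ^ (-k) • (a * b) := h.symm
  rw [h', sub_smul, one_smul]

theorem crossing_cancel {t u : ℤ} (hi : 1 ≤ i ∧ i ≤ n) (ht : -i ≤ t ∧ t ≤ i)
    (hj : 1 ≤ j ∧ j ≤ n) (hu : -j ≤ u ∧ u ≤ j) (hX : DnLabel.V i t = Lam n j u)
    (h1 : formVL n i t j (u - 1) = 2) (h2 : formVL n i (t - 1) j (u - 1) = 0)
    (h3 : formVL n i (t - 1) j u = -2) :
    (ww n i (t - 1) * mm n j u - mm n j u * ww n i (t - 1))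
      + (ww n i t * mm n j (u - 1) - mm n j (u - 1) * ww n i t) = 0 := by
  have c1 := ww_mm (n := n) hi (r := t - 1) (by omega) hj (s := u) (by omega)
  have c2 := ww_mm (n := n) hi (r := t) (by omega) hj (s := u - 1) (by omega)
  have c3 : QC 2 (Xg n (.V i t)) (mm n j (u - 1)) := by
    refine ((Xg_Lprod hi ht hj (s := u - 1) (by omega)).smul_right _).of_eq ?_
    rw [h1, h2, sub_zero]
  rw [h3] at c1
  rw [h1] at c2
  rw [sub_of_QC c1, sub_of_QC c2, ww_succ ht.1, mm_succ hu.1, ← hX, smul_mul_assoc, mul_assoc,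
    show _ = _ from c3, mul_smul_comm, mul_smul_comm, smul_smul, smul_smul, smul_smul, ← add_smul]
  have : (1 - qq ^ (- -2 : ℤ)) * qq + (1 - qq ^ (-2 : ℤ)) * qq * qq ^ (2 : ℤ) = 0 := by
    have := qq_ne_zero
    rw [neg_neg, zpow_neg, zpow_ofNat]
    field_simp
    ring
  rw [this, zero_smul]

theorem formVL_interior (hr : -i ≤ r ∧ r < i) (hs : -j ≤ s ∧ s < j) : formVL n i r j s =
    if (r = th n j - 1 ∧ s = - th n i) ∨ (r = - th n j - 1 ∧ s = th n i) then -2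
    else if (r = th n j ∧ s = - th n i - 1) ∨ (r = - th n j ∧ s = th n i - 1) then 2
    else 0 := by
  rw [formVL, if_neg (by omega), if_neg (by omega), if_neg (by omega)]

theorem ww_mm_interior (hi : 1 ≤ i ∧ i ≤ n) (hj : 1 ≤ j ∧ j ≤ n) (hr : -i ≤ r ∧ r < i)
    (hs : -j ≤ s ∧ s < j) (h : ¬ ((r = th n j - 1 ∧ s = - th n i) ∨
      (r = - th n j - 1 ∧ s = th n i) ∨ (r = th n j ∧ s = - th n i - 1) ∨
      (r = - th n j ∧ s = th n i - 1))) :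
    ww n i r * mm n j s - mm n j s * ww n i r = 0 := by
  have := ww_mm (n := n) hi (r := r) (by omega) hj (s := s) (by omega)
  rw [formVL_interior hr hs, if_neg (by tauto), if_neg (by tauto), QC.comm_iff] at this
  rw [this, sub_self]

theorem commutator_chainSum (w m : ℤ → ℤ → Dtorus n) : chainSum w i * chainSum m j
    - chainSum m j * chainSum w i = ∑ p ∈ Finset.Icc (-i) (i - 1) ×ˢ Finset.Icc (-j) (j - 1),
      (w i p.1 * m j p.2 - m j p.2 * w i p.1) := by
  rw [Finset.sum_sub_distrib, Finset.sum_product, Finset.sum_product_right, chainSum, chainSum,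
    Finset.sum_mul_sum, Finset.sum_mul_sum]

theorem chainSum_commutator_of_ne (hi : 1 ≤ i ∧ i ≤ n) (hj : 1 ≤ j ∧ j ≤ n) (h : i ≠ th n j) :
    chainSum (ww n) i * chainSum (mm n) j - chainSum (mm n) j * chainSum (ww n) i = 0 := by
  rw [commutator_chainSum]
  unfold th at h
  rcases lt_or_gt_of_ne h with h | h
  · refine Finset.sum_eq_zero fun p hp => ?_
    simp only [Finset.mem_product, Finset.mem_Icc] at hp
    exact ww_mm_interior hi hj (by omega) (by omega) (by unfold th; omega)
  · have hsub : ({(th n j - 1, - th n i), (th n j, - th n i - 1), (- th n j - 1, th n i),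
        (- th n j, th n i - 1)} : Finset (ℤ × ℤ)) ⊆
        Finset.Icc (-i) (i - 1) ×ˢ Finset.Icc (-j) (j - 1) := by
      intro p hp
      simp only [Finset.mem_insert, Finset.mem_singleton, Prod.ext_iff, th] at hp
      simp only [Finset.mem_product, Finset.mem_Icc]
      omega
    rw [← Finset.sum_subset hsub, Finset.sum_insert, Finset.sum_insert, Finset.sum_insert,
      Finset.sum_singleton, ← add_assoc]
    · have e1 := crossing_cancel (n := n) (t := th n j) (u := - th n i) hi
        (by unfold th; omega) hj (by unfold th; omega)
        (by rw [Lam_neg (by unfold th; omega)]; unfold th; congr 1; omega)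
        (by rw [formVL_interior (by unfold th; omega) (by unfold th; omega),
              if_neg (by unfold th; omega), if_pos (by omega)])
        (by rw [formVL_interior (by unfold th; omega) (by unfold th; omega),
              if_neg (by unfold th; omega), if_neg (by unfold th; omega)])
        (by rw [formVL_interior (by unfold th; omega) (by unfold th; omega),
              if_pos (by omega)])
      have e2 := crossing_cancel (n := n) (t := - th n j) (u := th n i) hi
        (by unfold th; omega) hj (by unfold th; omega)
        (by rw [Lam_pos (by unfold th; omega)]; unfold th; congr 1 <;> omega)
        (by rw [formVL_interior (by unfold th; omega) (by unfold th; omega),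
              if_neg (by unfold th; omega), if_pos (by omega)])
        (by rw [formVL_interior (by unfold th; omega) (by unfold th; omega),
              if_neg (by unfold th; omega), if_neg (by unfold th; omega)])
        (by rw [formVL_interior (by unfold th; omega) (by unfold th; omega),
              if_pos (by omega)])
      rw [e1, e2, add_zero]
    · simp only [Finset.mem_singleton, Prod.ext_iff, th]
      omega
    · simp only [Finset.mem_insert, Finset.mem_singleton, Prod.ext_iff, th]
      omega
    · simp only [Finset.mem_insert, Finset.mem_singleton, Prod.ext_iff, th]
      omega
    · intro p hp hp'
      simp only [Finset.mem_insert, Finset.mem_singleton, Prod.ext_iff] at hp'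
      simp only [Finset.mem_product, Finset.mem_Icc] at hp
      exact ww_mm_interior hi hj (by omega) (by omega) (by tauto)

theorem chainSum_commutator_self (hi : 1 ≤ i ∧ i ≤ n) (hj : 1 ≤ j ∧ j ≤ n) (h : i = th n j) :
    chainSum (ww n) i * chainSum (mm n) j - chainSum (mm n) j * chainSum (ww n) i =
      (qq - qq⁻¹) • (qq ^ (2 * i) • Vprod n i i - qq ^ (2 * j) • Lprod n j j) := by
  rw [commutator_chainSum]
  have h' : j = th n i := by unfold th at *; omega
  have hsub : ({(i - 1, -j), (-i, j - 1)} : Finset (ℤ × ℤ)) ⊆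
      Finset.Icc (-i) (i - 1) ×ˢ Finset.Icc (-j) (j - 1) := by
    intro p hp
    simp only [Finset.mem_insert, Finset.mem_singleton, Prod.ext_iff] at hp
    simp only [Finset.mem_product, Finset.mem_Icc]
    omega
  rw [← Finset.sum_subset hsub, Finset.sum_pair]
  · have c1 := ww_mm (n := n) hi (r := i - 1) (by omega) hj (s := -j) (by omega)
    have c2 := ww_mm (n := n) hi (r := -i) (by omega) hj (s := j - 1) (by omega)
    rw [formVL_interior (by omega) (by omega), ← h, ← h', if_pos (by omega)] at c1
    rw [formVL_interior (by omega) (by omega), ← h, ← h', if_neg (by omega),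
      if_pos (by omega)] at c2
    have c3 := c2.symm
    have e1 : ww n i (i - 1) * mm n j (-j) = (-(qq ^ (2 * i - 1))) • Vprod n i i := by
      rw [Vprod_succ (r := i) (by omega), ww, mm, Lprod_eq, pathProd_self, Lam_neg (by omega),
        smul_mul_smul_comm, show (n : ℤ) + 1 + -j = i by unfold th at h; omega,
        show (n : ℤ) + 1 - j = i by unfold th at h; omega, add_neg_cancel,
        zpow_zero, mul_one, mul_right_comm, ii_mul_ii, neg_one_mul,
        show i + (i - 1) = 2 * i - 1 by ring]
    have e2 : mm n j (j - 1) * ww n i (-i) = (-(qq ^ (2 * j - 1))) • Lprod n j j := by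
      rw [Lprod_succ (r := j) (by omega), ww, mm, Vprod_eq, pathProd_self, Lam_pos (by omega),
        smul_mul_smul_comm, show (n : ℤ) + 1 - j = i by unfold th at h; omega,
        show j - (n : ℤ) - 1 = -i by unfold th at h; omega, add_neg_cancel,
        zpow_zero, mul_one, mul_right_comm, ii_mul_ii, neg_one_mul,
        show j + (j - 1) = 2 * j - 1 by ring]
    have e3 : ∀ k : ℤ, (1 - qq ^ (- -2 : ℤ)) * -(qq ^ (2 * k - 1)) =
        (qq - qq⁻¹) * qq ^ (2 * k) := by
      intro k
      have := qq_ne_zero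
      rw [zpow_sub₀ this, zpow_one, neg_neg, zpow_ofNat]
      field_simp
      ring
    rw [← neg_sub (mm n j (j - 1) * ww n i (-i)), sub_of_QC c1, e1, sub_of_QC c3, e2, smul_smul,
      smul_smul, e3, e3, smul_sub, smul_smul, smul_smul]
    exact (sub_eq_add_neg _ _).symm
  · simp only [ne_eq, Prod.ext_iff]
    omega
  · intro p hp hp'
    simp only [Finset.mem_insert, Finset.mem_singleton, Prod.ext_iff] at hp'
    simp only [Finset.mem_product, Finset.mem_Icc] at hp
    exact ww_mm_interior hi hj (by omega) (by omega) (by omega)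

end Crossing

section Embedding

variable {n : ℕ} {i j r s : ℤ}

theorem th_th (n : ℕ) (i : ℤ) : th n (th n i) = i := by
  unfold th
  ring

theorem cartanA_comm (i j : ℤ) : cartanA i j = cartanA j i := by
  rw [cartanA_eq, cartanA_eq]
  split_ifs <;> omega

theorem cartanA_th (n : ℕ) (i j : ℤ) : cartanA (th n i) (th n j) = cartanA i j := by
  unfold th
  rw [cartanA_eq, cartanA_eq]
  split_ifs <;> omega

theorem formVV_end (hi : 1 ≤ i) (hs : -j ≤ s ∧ s ≤ j - 1) : formVV i i j s = cartanA i j := by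
  have := thr_cases i
  have := thr_cases s
  rw [cartanA_eq]
  unfold formVV
  split_ifs <;> omega

theorem formVV_end_end (i j : ℤ) : formVV i i j j = 0 := by
  unfold formVV
  split_ifs <;> omega

theorem formVL_end_left (hi : 1 ≤ i) (hs : -j ≤ s ∧ s ≤ j - 1) :
    formVL n i i j s = -cartanA i (th n j) := by
  unfold formVL
  rw [if_neg (by omega), if_pos rfl]

theorem formVL_end_right (hr : -i ≤ r ∧ r ≤ i - 1) (hj : 1 ≤ j) :
    formVL n i r j j = cartanA i (th n j) := by
  unfold formVL
  rw [if_neg (by omega), if_neg (by omega), if_pos rfl]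

theorem formVL_end_end (n : ℕ) (i j : ℤ) : formVL n i i j j = 0 := by
  unfold formVL
  rw [if_pos (by omega)]

theorem isUnit_Xg (v : DnLabel) : IsUnit (Xg n v) :=
  ⟨⟨Xg n v, Xinv n v, Xg_mul_Xinv v, Xinv_mul_Xg v⟩, rfl⟩

theorem isUnit_pathProd (x : ℤ → DnLabel) (a r : ℤ) : IsUnit (pathProd n x a r) := by
  refine List.prod_isUnit fun m hm => ?_
  obtain ⟨k, -, rfl⟩ := List.mem_map.1 hm
  exact isUnit_Xg _

theorem isUnit_zpow_smul {A : Type*} [Ring A] [Algebra Kq A] (k : ℤ) {a : A} (ha : IsUnit a) :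
    IsUnit ((qq ^ k) • a) := by
  rw [Algebra.smul_def]
  exact ((zpow_ne_zero k qq_ne_zero).isUnit.map (algebraMap Kq A)).mul ha

/-- The image of `K_i` in the quantum torus. -/
def torusK (n : ℕ) (i : ℤ) : Dtorus n := (qq ^ (2 * i)) • Vprod n i i

/-- The image of `K'_{θ(i)}` in the quantum torus. -/
def torusK' (n : ℕ) (i : ℤ) : Dtorus n := (qq ^ (2 * i)) • Lprod n i i

theorem isUnit_torusK (i : ℤ) : IsUnit (torusK n i) := by
  unfold torusK
  rw [Vprod_eq]
  exact isUnit_zpow_smul _ (isUnit_pathProd _ _ _)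

theorem isUnit_torusK' (i : ℤ) : IsUnit (torusK' n i) := by
  unfold torusK'
  rw [Lprod_eq]
  exact isUnit_zpow_smul _ (isUnit_pathProd _ _ _)

theorem torusK_chainSum_ww (hi : 1 ≤ i ∧ i ≤ n) (hj : 1 ≤ j ∧ j ≤ n) :
    QC (cartanA i j) (torusK n i) (chainSum (ww n) j) := by
  refine QC.sum_right fun s hs => ?_
  rw [Finset.mem_Icc] at hs
  rw [← formVV_end hi.1 hs]
  exact ((Vprod_Vprod hi (by omega) hj (by omega)).smul_left _).smul_right _

theorem torusK'_chainSum_mm (hi : 1 ≤ i ∧ i ≤ n) (hj : 1 ≤ j ∧ j ≤ n) :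
    QC (cartanA i j) (torusK' n i) (chainSum (mm n) j) := by
  refine QC.sum_right fun s hs => ?_
  rw [Finset.mem_Icc] at hs
  rw [← formVV_end hi.1 hs]
  exact ((Lprod_Lprod hi (by omega) hj (by omega)).smul_left _).smul_right _

theorem torusK_chainSum_mm (hi : 1 ≤ i ∧ i ≤ n) (hj : 1 ≤ j ∧ j ≤ n) :
    QC (-cartanA i (th n j)) (torusK n i) (chainSum (mm n) j) := by
  refine QC.sum_right fun s hs => ?_
  rw [Finset.mem_Icc] at hs
  rw [← formVL_end_left hi.1 hs]
  exact ((Vprod_Lprod hi (by omega) hj (by omega)).smul_left _).smul_right _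

theorem chainSum_ww_torusK' (hi : 1 ≤ i ∧ i ≤ n) (hj : 1 ≤ j ∧ j ≤ n) :
    QC (cartanA i (th n j)) (chainSum (ww n) i) (torusK' n j) := by
  refine QC.sum_left fun r hr => ?_
  rw [Finset.mem_Icc] at hr
  rw [← formVL_end_right hr hj.1]
  exact ((Vprod_Lprod hi (by omega) hj (by omega)).smul_left _).smul_right _

theorem torusK_comm (hi : 1 ≤ i ∧ i ≤ n) (hj : 1 ≤ j ∧ j ≤ n) :
    torusK n i * torusK n j = torusK n j * torusK n i := by
  rw [← QC.comm_iff, ← formVV_end_end i j]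
  exact ((Vprod_Vprod hi (by omega) hj (by omega)).smul_left _).smul_right _

theorem torusK'_comm (hi : 1 ≤ i ∧ i ≤ n) (hj : 1 ≤ j ∧ j ≤ n) :
    torusK' n i * torusK' n j = torusK' n j * torusK' n i := by
  rw [← QC.comm_iff, ← formVV_end_end i j]
  exact ((Lprod_Lprod hi (by omega) hj (by omega)).smul_left _).smul_right _

theorem torusK_torusK'_comm (hi : 1 ≤ i ∧ i ≤ n) (hj : 1 ≤ j ∧ j ≤ n) :
    torusK n i * torusK' n j = torusK' n j * torusK n i := by
  rw [← QC.comm_iff, ← formVL_end_end n i j]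
  exact ((Vprod_Lprod hi (by omega) hj (by omega)).smul_left _).smul_right _

theorem IsWChain.serre {A : Type*} [Ring A] [Algebra Kq A] {w : ℤ → ℤ → A} (hw : IsWChain n w)
    (hi : 1 ≤ i ∧ i ≤ n) (hj : 1 ≤ j ∧ j ≤ n) (h : (i - j).natAbs = 1) :
    chainSum w i * chainSum w i * chainSum w j
      + chainSum w j * (chainSum w i * chainSum w i) =
      (qq + qq⁻¹) • (chainSum w i * chainSum w j * chainSum w i) := by
  rcases (by omega : j = i + 1 ∨ i = j + 1) with rfl | rfl
  · exact hw.serre_up hi.1 hj.2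
  · exact hw.serre_down hj.1 hi.2

theorem IsWChain.comm_of_far {A : Type*} [Ring A] [Algebra Kq A] {w : ℤ → ℤ → A}
    (hw : IsWChain n w) (hi : 1 ≤ i ∧ i ≤ n) (hj : 1 ≤ j ∧ j ≤ n) (h : 1 < (i - j).natAbs) :
    chainSum w i * chainSum w j = chainSum w j * chainSum w i := by
  rcases (by omega : i + 1 < j ∨ j + 1 < i) with h | h
  · exact hw.comm hi.1 h hj.2
  · exact (hw.comm hj.1 h hi.2).symm

/-- The images of the generators of `𝔇ₙ` in the quantum torus. -/
def iotaGen (n : ℕ) : DDGen n → Dtorus n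
  | .E i => chainSum (ww n) i.1
  | .F i => chainSum (mm n) (th n i.1)
  | .K i => torusK n i.1
  | .K' i => torusK' n (th n i.1)
  | .Kinv i => Ring.inverse (torusK n i.1)
  | .K'inv i => Ring.inverse (torusK' n (th n i.1))

theorem iotaGen_rel {x y : FreeAlgebra Kq (DDGen n)} (h : DDRel n x y) :
    FreeAlgebra.lift Kq (iotaGen n) x = FreeAlgebra.lift Kq (iotaGen n) y := by
  have hth : ∀ i : Idx n, 1 ≤ th n i.1 ∧ th n i.1 ≤ n := fun i => (thIdx n i).2
  have hsub : ∀ i j : Idx n, (th n i.1 - th n j.1).natAbs = (i.1 - j.1).natAbs := by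
    intro i j
    unfold th
    omega
  induction h <;> simp only [map_mul, map_add, map_smul, map_sub, map_one, ddg,
    FreeAlgebra.lift_ι_apply, iotaGen]
  case KE i j => exact torusK_chainSum_ww i.2 j.2
  case K'E i j =>
    refine ((chainSum_ww_torusK' j.2 (hth i)).symm).of_eq ?_
    rw [th_th, cartanA_comm]
  case KF i j =>
    refine (torusK_chainSum_mm i.2 (hth j)).of_eq ?_
    rw [th_th]
  case K'F i j =>
    refine (torusK'_chainSum_mm (hth i) (hth j)).of_eq ?_
    rw [cartanA_th]
  case KK i j => exact torusK_comm i.2 j.2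
  case KK' i j => exact torusK_torusK'_comm i.2 (hth j)
  case K'K' i j => exact torusK'_comm (hth i) (hth j)
  case K_Kinv i => exact Ring.mul_inverse_cancel _ (isUnit_torusK _)
  case Kinv_K i => exact Ring.inverse_mul_cancel _ (isUnit_torusK _)
  case K'_K'inv i => exact Ring.mul_inverse_cancel _ (isUnit_torusK' _)
  case K'inv_K' i => exact Ring.inverse_mul_cancel _ (isUnit_torusK' _)
  case EF i j =>
    rw [← sub_eq_iff_eq_add']
    split_ifs with h
    · have := chainSum_commutator_self i.2 (hth j) (by rw [th_th, h])
      rw [this, h]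
      rfl
    · rw [zero_smul]
      exact chainSum_commutator_of_ne i.2 (hth j) (by rwa [th_th])
  case serreE i j h => exact isWChain_ww.serre i.2 j.2 h
  case serreF i j h => exact isWChain_mm.serre (hth i) (hth j) (by rwa [hsub])
  case EEc i j h => exact isWChain_ww.comm_of_far i.2 j.2 h
  case FFc i j h => exact isWChain_mm.comm_of_far (hth i) (hth j) (by rwa [hsub])

/-- The homomorphism `ι : 𝔇ₙ → 𝒟ₙ`. -/
def iotaHom (n : ℕ) : DDalg n →ₐ[Kq] Dtorus n :=
  RingQuot.liftAlgHom Kq ⟨FreeAlgebra.lift Kq (iotaGen n), fun _ _ h => iotaGen_rel h⟩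

theorem iotaHom_gen (g : DDGen n) : iotaHom n (DDgen n g) = iotaGen n g := by
  simp [iotaHom, DDgen, ddg]

theorem iotaHom_spec (n : ℕ) : iotaSpec n (iotaHom n) := by
  intro i
  simp only [iotaHom_gen, iotaGen]
  have h : th n (thIdx n i).1 = i.1 := th_th n i.1
  refine ⟨rfl, rfl, ?_, ?_, Ring.inverse_mul_cancel _ (isUnit_torusK _),
    Ring.mul_inverse_cancel _ (isUnit_torusK _), Ring.inverse_mul_cancel _ (isUnit_torusK' _),
    Ring.mul_inverse_cancel _ (isUnit_torusK' _)⟩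
  · rw [h]
    rfl
  · rw [h]
    rfl

end Embedding

section Leading

/-- Exponent vectors of monomials in the quantum torus. -/
abbrev ExpLat : Type := DnLabel →₀ ℤ

/-- The total degree of an exponent vector. -/
def latDeg : ExpLat →+ ℤ := Finsupp.liftAddHom fun _ => AddMonoidHom.id ℤ

theorem latDeg_single (v : DnLabel) (k : ℤ) : latDeg (Finsupp.single v k) = k := by
  simp [latDeg]

/-- The operator sending the basis vector `a` to `q ^ (φ a + k)` times the vector `a + d`. -/
def shiftOp (k : ℤ) (φ : ExpLat →+ ℤ) (d : ExpLat) : Module.End Kq (ExpLat →₀ Kq) :=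
  Finsupp.linearCombination Kq fun a => Finsupp.single (a + d) (qq ^ (φ a + k))

theorem shiftOp_single (k : ℤ) (φ : ExpLat →+ ℤ) (d a : ExpLat) (c : Kq) :
    shiftOp k φ d (Finsupp.single a c) = Finsupp.single (a + d) (c * qq ^ (φ a + k)) := by
  simp [shiftOp]

theorem shiftOp_mul (k k' : ℤ) (φ φ' : ExpLat →+ ℤ) (d d' : ExpLat) :
    shiftOp k φ d * shiftOp k' φ' d' = shiftOp (k + k' + φ d') (φ + φ') (d + d') := by
  refine Finsupp.lhom_ext fun a c => ?_
  rw [Module.End.mul_apply, shiftOp_single, shiftOp_single, shiftOp_single, add_assoc, add_comm d',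
    mul_assoc, ← zpow_add₀ qq_ne_zero, map_add, AddMonoidHom.add_apply]
  congr 3
  ring

theorem shiftOp_zero : shiftOp 0 0 0 = 1 := by
  refine Finsupp.lhom_ext fun a c => ?_
  rw [shiftOp_single]
  simp

theorem smul_shiftOp (j k : ℤ) (φ : ExpLat →+ ℤ) (d : ExpLat) :
    qq ^ j • shiftOp k φ d = shiftOp (j + k) φ d := by
  refine Finsupp.lhom_ext fun a c => ?_
  rw [LinearMap.smul_apply, shiftOp_single, shiftOp_single, Finsupp.smul_single, smul_eq_mul,
    mul_left_comm, ← zpow_add₀ qq_ne_zero, add_left_comm]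

/-- The pairing of an exponent vector with the arrows ending in `v`. -/
def latPair (n : ℕ) (v : DnLabel) : ExpLat →+ ℤ :=
  Finsupp.liftAddHom fun u => AddMonoidHom.mulRight (arrowWeight n u v)

theorem latPair_single (n : ℕ) (u v : DnLabel) :
    latPair n v (Finsupp.single u 1) = arrowWeight n u v := by
  simp [latPair]

/-- The operators by which the generators of the quantum torus act on the span of the lattice. -/
def torusGenOp (n : ℕ) : DnVertex n ⊕ DnVertex n → Module.End Kq (ExpLat →₀ Kq)
  | .inl v => shiftOp 0 (latPair n v.1) (Finsupp.single v.1 1)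
  | .inr v => shiftOp (arrowWeight n v.1 v.1) (-latPair n v.1) (-Finsupp.single v.1 1)

theorem torusGenOp_rel {n : ℕ} {x y : FreeAlgebra Kq (DnVertex n ⊕ DnVertex n)}
    (h : DnRel n x y) :
    FreeAlgebra.lift Kq (torusGenOp n) x = FreeAlgebra.lift Kq (torusGenOp n) y := by
  induction h with
  | comm u v =>
    simp only [map_mul, map_smul, FreeAlgebra.lift_ι_apply, torusGenOp, shiftOp_mul,
      smul_shiftOp, latPair_single, eps2_eq]
    congr 1
    · ring
    · exact add_comm _ _
    · exact add_comm _ _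
  | mul_inv v =>
    simp only [map_mul, map_one, FreeAlgebra.lift_ι_apply, torusGenOp, shiftOp_mul, map_neg,
      latPair_single, ← shiftOp_zero]
    congr 1
    · ring
    · exact add_neg_cancel _
    · exact add_neg_cancel _
  | inv_mul v =>
    simp only [map_mul, map_one, FreeAlgebra.lift_ι_apply, torusGenOp, shiftOp_mul,
      AddMonoidHom.neg_apply, latPair_single, ← shiftOp_zero]
    congr 1
    · ring
    · exact neg_add_cancel _
    · exact neg_add_cancel _

/-- The action of the quantum torus on the span of its exponent lattice. -/
def torusRep (n : ℕ) : Dtorus n →ₐ[Kq] Module.End Kq (ExpLat →₀ Kq) :=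
  RingQuot.liftAlgHom Kq ⟨FreeAlgebra.lift Kq (torusGenOp n), fun _ _ h => torusGenOp_rel h⟩

theorem torusRep_Xg {n : ℕ} {v : DnLabel} (hv : v.valid n) :
    torusRep n (Xg n v) = shiftOp 0 (latPair n v) (Finsupp.single v 1) := by
  simp [torusRep, Xg, hv, torusGenOp]

/-- The vectors all of whose components have degree larger than `d`. -/
def latAbove (d : ℤ) : Submodule Kq (ExpLat →₀ Kq) := Finsupp.supported Kq Kq {b | d < latDeg b}

theorem latAbove_mono {d d' : ℤ} (h : d ≤ d') : latAbove d' ≤ latAbove d :=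
  Finsupp.supported_mono fun _ hb => lt_of_le_of_lt h hb

theorem single_mem_latAbove {d : ℤ} {b : ExpLat} (h : d < latDeg b) (c : Kq) :
    Finsupp.single b c ∈ latAbove d :=
  Finsupp.single_mem_supported Kq c h

/-- `A` raises degrees by more than `d`. -/
def RaisesDeg (A : Module.End Kq (ExpLat →₀ Kq)) (d : ℤ) : Prop :=
  ∀ a, A (Finsupp.single a 1) ∈ latAbove (latDeg a + d)

/-- The terms of lowest degree of `A` consist of a nonzero multiple of the shift by `t`. -/
def HasLead (A : Module.End Kq (ExpLat →₀ Kq)) (t : ExpLat) : Prop :=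
  ∀ a, ∃ c : Kq, c ≠ 0 ∧
    A (Finsupp.single a 1) - c • Finsupp.single (a + t) 1 ∈ latAbove (latDeg a + latDeg t)

variable {A B : Module.End Kq (ExpLat →₀ Kq)} {t u : ExpLat}

theorem HasLead.raisesDeg (hA : HasLead A t) {d : ℤ} (h : d < latDeg t) : RaisesDeg A d := by
  intro a
  obtain ⟨c, -, hc⟩ := hA a
  have h1 := latAbove_mono (by omega : latDeg a + d ≤ latDeg a + latDeg t) hc
  have h2 : c • Finsupp.single (a + t) (1 : Kq) ∈ latAbove (latDeg a + d) :=
    Submodule.smul_mem _ _ (single_mem_latAbove (by rw [map_add]; omega) _)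
  simpa using add_mem h1 h2

theorem RaisesDeg.sum {ι : Type*} {s : Finset ι} {f : ι → Module.End Kq (ExpLat →₀ Kq)} {d : ℤ}
    (h : ∀ i ∈ s, RaisesDeg (f i) d) : RaisesDeg (∑ i ∈ s, f i) d := by
  intro a
  rw [LinearMap.sum_apply]
  exact sum_mem fun i hi => h i hi a

theorem HasLead.add (hA : HasLead A t) (hB : RaisesDeg B (latDeg t)) : HasLead (A + B) t := by
  intro a
  obtain ⟨c, hc, h⟩ := hA a
  refine ⟨c, hc, ?_⟩
  rw [LinearMap.add_apply, add_sub_right_comm]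
  exact add_mem h (hB a)

theorem HasLead.smul (hA : HasLead A t) {x : Kq} (hx : x ≠ 0) : HasLead (x • A) t := by
  intro a
  obtain ⟨c, hc, h⟩ := hA a
  refine ⟨x * c, mul_ne_zero hx hc, ?_⟩
  rw [LinearMap.smul_apply, mul_smul, ← smul_sub]
  exact Submodule.smul_mem _ _ h

theorem HasLead.sum {ι : Type*} [DecidableEq ι] {s : Finset ι}
    {f : ι → Module.End Kq (ExpLat →₀ Kq)} {t : ι → ExpLat} {i₀ : ι} (h₀ : i₀ ∈ s)
    (h : ∀ i ∈ s, HasLead (f i) (t i))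
    (hlt : ∀ i ∈ s, i ≠ i₀ → latDeg (t i₀) < latDeg (t i)) :
    HasLead (∑ i ∈ s, f i) (t i₀) := by
  rw [← Finset.add_sum_erase s f h₀]
  refine (h i₀ h₀).add (RaisesDeg.sum fun i hi => ?_)
  rw [Finset.mem_erase] at hi
  exact (h i hi.2).raisesDeg (hlt i hi.2 hi.1)

theorem HasLead.map_latAbove (hA : HasLead A t) {d : ℤ} {x : ExpLat →₀ Kq} (hx : x ∈ latAbove d) :
    A x ∈ latAbove (d + latDeg t) := by
  rw [latAbove, Finsupp.supported_eq_span_single] at hx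
  induction hx using Submodule.span_induction with
  | mem y hy =>
    obtain ⟨b, hb, rfl⟩ := hy
    have hb' : d < latDeg b := hb
    exact latAbove_mono (by omega) (hA.raisesDeg (sub_one_lt _) b)
  | zero => rw [map_zero]; exact zero_mem _
  | add y z _ _ hy hz => rw [map_add]; exact add_mem hy hz
  | smul c y _ hy => rw [map_smul]; exact Submodule.smul_mem _ _ hy

theorem HasLead.mul (hA : HasLead A t) (hB : HasLead B u) : HasLead (A * B) (t + u) := by
  intro a
  obtain ⟨c, hc, h⟩ := hB a
  obtain ⟨c', hc', h'⟩ := hA (a + u)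
  refine ⟨c * c', mul_ne_zero hc hc', ?_⟩
  have h1 := hA.map_latAbove h
  have h2 := Submodule.smul_mem _ c h'
  rw [map_add] at h2
  rw [map_add, ← add_assoc, add_right_comm]
  have h3 := add_mem h1 h2
  rw [map_sub, map_smul, smul_sub, smul_smul, sub_add_sub_cancel, add_assoc a u, add_comm u] at h3
  exact h3

theorem HasLead.one : HasLead 1 0 := by
  intro a
  refine ⟨1, one_ne_zero, ?_⟩
  simp

theorem HasLead.pow (hA : HasLead A t) (k : ℕ) : HasLead (A ^ k) (k • t) := by
  induction k with
  | zero => simpa using HasLead.one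
  | succ k ih => rw [pow_succ, succ_nsmul]; exact ih.mul hA

theorem HasLead.listProd {N : ℕ} {f : ℕ → Module.End Kq (ExpLat →₀ Kq)} {t : ℕ → ExpLat}
    (h : ∀ k < N, HasLead (f k) (t k)) :
    HasLead ((List.range N).map f).prod (∑ k ∈ Finset.range N, t k) := by
  induction N with
  | zero => simpa using HasLead.one
  | succ N ih =>
    rw [List.range_succ, List.map_append, List.prod_append, Finset.sum_range_succ]
    simpa using (ih fun k hk => h k (by omega)).mul (h N (by omega))

/-- `A` maps basis vectors to nonzero multiples of their shifts by `t`. -/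
def IsShift (A : Module.End Kq (ExpLat →₀ Kq)) (t : ExpLat) : Prop :=
  ∀ a, ∃ c : Kq, c ≠ 0 ∧ A (Finsupp.single a 1) = c • Finsupp.single (a + t) 1

theorem IsShift.hasLead (hA : IsShift A t) : HasLead A t := by
  intro a
  obtain ⟨c, hc, h⟩ := hA a
  refine ⟨c, hc, ?_⟩
  rw [h, sub_self]
  exact zero_mem _

theorem IsShift.smul (hA : IsShift A t) {x : Kq} (hx : x ≠ 0) : IsShift (x • A) t := by
  intro a
  obtain ⟨c, hc, h⟩ := hA a
  exact ⟨x * c, mul_ne_zero hx hc, by rw [LinearMap.smul_apply, h, smul_smul]⟩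

theorem IsShift.mul (hA : IsShift A t) (hB : IsShift B u) : IsShift (A * B) (t + u) := by
  intro a
  obtain ⟨c, hc, h⟩ := hB a
  obtain ⟨c', hc', h'⟩ := hA (a + u)
  refine ⟨c * c', mul_ne_zero hc hc', ?_⟩
  rw [Module.End.mul_apply, h, map_smul, h', smul_smul, add_assoc a u, add_comm u]

theorem IsShift.one : IsShift 1 0 := fun a => ⟨1, one_ne_zero, by simp⟩

theorem IsShift.inv (hA : IsShift A t) (h : B * A = 1) : IsShift B (-t) := by
  intro a
  obtain ⟨c, hc, h'⟩ := hA (a + -t)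
  refine ⟨c⁻¹, inv_ne_zero hc, ?_⟩
  have h2 : B (A (Finsupp.single (a + -t) 1)) = Finsupp.single (a + -t) 1 := by
    rw [← Module.End.mul_apply, h, Module.End.one_apply]
  rw [h', map_smul, neg_add_cancel_right] at h2
  rw [← h2, smul_smul, inv_mul_cancel₀ hc, one_smul]

theorem IsShift.zpow {u : (Module.End Kq (ExpLat →₀ Kq))ˣ} (hu : IsShift u.1 t) (k : ℤ) :
    IsShift (u ^ k).1 (k • t) := by
  have hn : ∀ k : ℕ, IsShift (u ^ k).1 (k • t) := by
    intro k
    induction k with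
    | zero => simpa using IsShift.one
    | succ k ih => rw [pow_succ, succ_nsmul]; exact ih.mul hu
  obtain ⟨k, rfl | rfl⟩ := k.eq_nat_or_neg
  · simpa using hn k
  · have h := (hn k).inv (B := (u ^ (-(k : ℤ))).1) (by
      rw [← Units.val_mul, ← zpow_natCast, ← zpow_add, neg_add_cancel, zpow_zero, Units.val_one])
    rwa [neg_smul, natCast_zsmul]

/-- A linear map is injective if it sends a spanning family to operators whose leading shifts
determine the members of the family. -/
theorem injective_of_hasLead {ι M : Type*} [AddCommGroup M] [Module Kq M]
    (g : M →ₗ[Kq] Module.End Kq (ExpLat →₀ Kq)) (x : ι → M) (t : ι → ExpLat)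
    (hspan : Submodule.span Kq (Set.range x) = ⊤) (hlead : ∀ i, HasLead (g (x i)) (t i))
    (ht : ∀ i j, t i = t j → x i = x j) : Function.Injective g := by
  rw [injective_iff_map_eq_zero]
  intro y hy
  have hy' : y ∈ Submodule.span Kq (Set.range x) := hspan ▸ Submodule.mem_top
  obtain ⟨c, rfl⟩ := (Finsupp.mem_span_iff_linearCombination _ _ _).1 hy'
  by_contra hne
  have hc : c ≠ 0 := by
    rintro rfl
    exact hne (map_zero _)
  have hch : ∀ s : Set.range x, ∃ i, x i = s := fun s => s.2
  choose p hp using hch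
  obtain ⟨s₀, hs₀, hmin⟩ := Finset.exists_min_image c.support (fun s => latDeg (t (p s)))
    (Finsupp.support_nonempty_iff.2 hc)
  have hcoef : ∀ s ∈ c.support, s ≠ s₀ →
      g s.1 (Finsupp.single 0 1) (t (p s₀)) = 0 := by
    intro s hs hss
    obtain ⟨a, -, ha⟩ := hlead (p s) 0
    have h1 : g s.1 (Finsupp.single 0 1) (t (p s₀)) =
        (a • Finsupp.single (0 + t (p s)) (1 : Kq)) (t (p s₀)) := by
      rw [hp, latAbove, Finsupp.mem_supported'] at ha
      have := ha (t (p s₀)) (by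
        have := hmin s hs
        simpa using this)
      rwa [Finsupp.sub_apply, sub_eq_zero] at this
    rw [h1, zero_add, Finsupp.smul_apply, Finsupp.single_eq_of_ne, smul_zero]
    intro he
    exact hss (Subtype.ext (by rw [← hp s, ← hp s₀, ht _ _ he]))
  obtain ⟨a, ha0, ha⟩ := hlead (p s₀) 0
  have h1 : g s₀.1 (Finsupp.single 0 1) (t (p s₀)) = a := by
    rw [hp, latAbove, Finsupp.mem_supported'] at ha
    have := ha (t (p s₀)) (by simp)
    rw [Finsupp.sub_apply, sub_eq_zero] at this
    simpa using this
  have h2 : g (Finsupp.linearCombination Kq Subtype.val c) (Finsupp.single 0 1) (t (p s₀)) =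
      c s₀ * a := by
    rw [Finsupp.linearCombination_apply, Finsupp.sum, map_sum, LinearMap.sum_apply,
      Finsupp.finsetSum_apply, Finset.sum_eq_single_of_mem s₀ hs₀]
    · rw [map_smul, LinearMap.smul_apply, Finsupp.smul_apply, h1, smul_eq_mul]
    · intro s hs hss
      rw [map_smul, LinearMap.smul_apply, Finsupp.smul_apply, hcoef s hs hss, smul_zero]
  rw [hy] at h2
  exact mul_ne_zero (Finsupp.mem_support_iff.1 hs₀) ha0 h2.symm

end Leading

section QBrackets

variable {k A : Type*} [Field k] [Ring A] [Algebra k A] {q : k} {a b c z : A}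

/-- The `q`-Serre relation, quadratic in `a` and linear in `b`. -/
def QSerre (q : k) (a b : A) : Prop := a * a * b + b * (a * a) = (q + q⁻¹) • (a * b * a)

/-- The `q`-commutator `ab - q⁻¹ba`. -/
def qBr (q : k) (a b : A) : A := a * b - q⁻¹ • (b * a)

theorem qBr_assoc (h : a * c = c * a) : qBr q a (qBr q b c) = qBr q (qBr q a b) c := by
  have h1 : ∀ x, a * (c * x) = c * (a * x) := fun x => by rw [← mul_assoc, h, mul_assoc]
  unfold qBr
  simp only [mul_sub, sub_mul, mul_assoc, mul_smul_comm, smul_mul_assoc, h, h1]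
  match_scalars <;> ring

theorem qBr_comm_left (ha : c * a = a * c) (hb : c * b = b * c) :
    c * qBr q a b = qBr q a b * c := by
  have h1 : ∀ x, c * (a * x) = a * (c * x) := fun x => by rw [← mul_assoc, ha, mul_assoc]
  have h2 : ∀ x, c * (b * x) = b * (c * x) := fun x => by rw [← mul_assoc, hb, mul_assoc]
  unfold qBr
  simp only [mul_sub, sub_mul, mul_assoc, mul_smul_comm, smul_mul_assoc, ha, h1, hb, h2]

theorem QSerre.qBr_right_of_comm (h : QSerre q a b) (hc : a * c = c * a) :
    QSerre q a (qBr q b c) := by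
  have hc' : ∀ x, c * (a * x) = a * (c * x) := fun x => by rw [← mul_assoc, ← hc, mul_assoc]
  have h1 : a * (a * b) + b * (a * a) = (q + q⁻¹) • (a * (b * a)) := by
    simpa only [QSerre, mul_assoc] using h
  have h2 := congrArg (fun x => x * c) h1
  have h3 := congrArg (fun x => c * x) h1
  simp only [add_mul, mul_add, smul_mul_assoc, mul_smul_comm, mul_assoc] at h2 h3
  unfold QSerre qBr
  simp only [mul_sub, sub_mul, mul_assoc, mul_smul_comm, smul_mul_assoc, hc, hc', smul_sub]
    at h2 h3 ⊢
  linear_combination (norm := module) h2 - q⁻¹ • h3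

theorem QSerre.qBr_left_of_comm (h : QSerre q c b) (hc : a * c = c * a) :
    QSerre q c (qBr q a b) := by
  have hc' : ∀ x, c * (a * x) = a * (c * x) := fun x => by rw [← mul_assoc, ← hc, mul_assoc]
  have h1 : c * (c * b) + b * (c * c) = (q + q⁻¹) • (c * (b * c)) := by
    simpa only [QSerre, mul_assoc] using h
  have h2 := congrArg (fun x => x * a) h1
  have h3 := congrArg (fun x => a * x) h1
  simp only [add_mul, mul_add, smul_mul_assoc, mul_smul_comm, mul_assoc] at h2 h3
  unfold QSerre qBr
  simp only [mul_sub, sub_mul, mul_assoc, mul_smul_comm, smul_mul_assoc, ← hc, hc', smul_sub]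
    at h2 h3 ⊢
  linear_combination (norm := module) h3 - q⁻¹ • h2

theorem QSerre.mul_qBr (hq : q ≠ 0) (h : QSerre q b z) :
    b * qBr q b z = q • (qBr q b z * b) := by
  have h1 : b * (b * z) + z * (b * b) = (q + q⁻¹) • (b * (z * b)) := by
    simpa only [QSerre, mul_assoc] using h
  have h2 := eq_sub_of_add_eq h1
  unfold qBr
  simp only [mul_sub, sub_mul, mul_assoc, mul_smul_comm, smul_mul_assoc, h2]
  match_scalars <;> field_simp
  ring

theorem QSerre.mul_qBr' (hq : q ≠ 0) (h : QSerre q z b) :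
    z * qBr q b z = q⁻¹ • (qBr q b z * z) := by
  have h1 : z * (z * b) + b * (z * z) = (q + q⁻¹) • (z * (b * z)) := by
    simpa only [QSerre, mul_assoc] using h
  have h2 := eq_sub_of_add_eq h1
  unfold qBr
  simp only [mul_sub, sub_mul, mul_assoc, mul_smul_comm, smul_mul_assoc, h2]
  match_scalars <;> field_simp
  ring

theorem QSerre.of_mul_qBr (hq : q ≠ 0) (h : z * qBr q b z = q⁻¹ • (qBr q b z * z)) :
    QSerre q z b := by
  unfold qBr at h
  unfold QSerre
  simp only [mul_sub, sub_mul, mul_assoc, mul_smul_comm, smul_mul_assoc, smul_sub] at h ⊢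
  rw [← sub_eq_zero] at h ⊢
  rw [← smul_zero (-q), ← h]
  match_scalars <;> field_simp
  ring

theorem qBr_middle_comm (hq : q ≠ 0) (hq' : q * q + 1 ≠ 0) (hbz : b * z = z * b)
    (h1 : QSerre q c b) (h2 : QSerre q c z) :
    c * qBr q b (qBr q c z) = qBr q b (qBr q c z) * c := by
  have hZ := h2.mul_qBr hq
  have hW := h1.mul_qBr' hq
  have hcz : c * z = qBr q c z + q⁻¹ • (z * c) := by unfold qBr; rw [sub_add_cancel]
  have hcb : c * b = q • (b * c - qBr q b c) := by
    unfold qBr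
    rw [sub_sub_cancel, smul_smul, mul_inv_cancel₀ hq, one_smul]
  have hU1 : qBr q b (qBr q c z) = b * qBr q c z - q⁻¹ • (qBr q c z * b) := rfl
  have hU2 : qBr q b (qBr q c z) = qBr q b c * z - q⁻¹ • (z * qBr q b c) := by
    rw [qBr_assoc hbz]
    rfl
  generalize qBr q b (qBr q c z) = U at *
  generalize qBr q c z = Z at *
  generalize qBr q b c = W at *
  have hZ' : ∀ x, c * (Z * x) = q • (Z * (c * x)) := fun x => by
    rw [← mul_assoc, hZ, smul_mul_assoc, mul_assoc]
  have hW' : ∀ x, c * (W * x) = q⁻¹ • (W * (c * x)) := fun x => by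
    rw [← mul_assoc, hW, smul_mul_assoc, mul_assoc]
  have hcz' : ∀ x, c * (z * x) = Z * x + q⁻¹ • (z * (c * x)) := fun x => by
    rw [← mul_assoc, hcz, add_mul, smul_mul_assoc, mul_assoc]
  have hcb' : ∀ x, c * (b * x) = q • (b * (c * x) - W * x) := fun x => by
    rw [← mul_assoc, hcb, smul_mul_assoc, sub_mul, mul_assoc]
  have e1 : c * U = q⁻¹ • (W * Z - Z * W) + (q⁻¹ * q⁻¹) • (U * c) := by
    rw [hU2]
    simp only [mul_sub, sub_mul, mul_add, mul_assoc, mul_smul_comm, smul_mul_assoc, hW', hW, hcz,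
      hcz']
    match_scalars <;> ring
  have e2 : c * U = (q * q) • (U * c) - q • (W * Z - Z * W) := by
    rw [hU1]
    simp only [mul_sub, sub_mul, mul_assoc, mul_smul_comm, smul_mul_assoc, hZ', hZ, hcb,
      hcb', smul_sub]
    match_scalars <;> field_simp
  have e3 : (q * q + 1) • (c * U) = (q * q + 1) • (U * c) := by
    rw [add_smul, one_smul]
    nth_rewrite 1 [e1]
    rw [e2]
    match_scalars <;> field_simp <;> ring
  exact smul_right_injective A hq' e3

end QBrackets

section RootVectors

variable {A : Type*} [Ring A] [Algebra Kq A] {N : ℤ} {e : ℤ → A}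

/-- The defining relations of the positive part of the quantum group of type `A_N`. -/
structure IsSerreSystem (N : ℤ) (e : ℤ → A) : Prop where
  comm : ∀ i j : ℤ, 1 ≤ i → i + 1 < j → j ≤ N → e i * e j = e j * e i
  serre_up : ∀ i : ℤ, 1 ≤ i → i + 1 ≤ N → QSerre qq (e i) (e (i + 1))
  serre_down : ∀ i : ℤ, 1 ≤ i → i + 1 ≤ N → QSerre qq (e (i + 1)) (e i)

theorem rootVec_succ (e : ℤ → A) (l : ℕ) (k : ℤ) :
    rootVec e (l + 1) k = qBr qq (e k) (rootVec e l (k + 1)) := rfl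

theorem QC.qBr_left {k : ℤ} {a b c : A} (hb : QC k b c) (ha : a * c = c * a) :
    QC k (qBr qq a b) c := by
  have h1 : QC 0 a c := QC.comm_iff.2 ha
  have h2 := (h1.mul_left hb).of_eq (zero_add k)
  have h3 := (hb.mul_left h1).of_eq (add_zero k)
  unfold qBr
  unfold QC at h2 h3 ⊢
  rw [sub_mul, mul_sub, h2, smul_mul_assoc, h3, mul_smul_comm, smul_sub, smul_comm]

theorem qq_mul_self_add_one_ne_zero : qq * qq + 1 ≠ 0 := by
  intro h
  have h1 : (RatFunc.X * RatFunc.X + 1 : RatFunc ℂ) =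
      algebraMap (Polynomial ℂ) _ (Polynomial.X ^ 2 + 1) := by
    simp [pow_two]
  unfold qq at h
  rw [h1, map_eq_zero_iff _ (RatFunc.algebraMap_injective ℂ)] at h
  have := congrArg (Polynomial.eval 0) h
  simp at this

theorem IsSerreSystem.far (he : IsSerreSystem N e) (l : ℕ) : ∀ {j k : ℤ}, 1 ≤ j → j + 1 < k →
    k + l ≤ N → e j * rootVec e l k = rootVec e l k * e j := by
  induction l with
  | zero =>
    intro j k h1 h2 h3
    exact he.comm j k h1 h2 (by simpa using h3)
  | succ l ih =>
    intro j k h1 h2 h3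
    push_cast at h3
    exact qBr_comm_left (he.comm j k h1 h2 (by omega)) (ih h1 (by omega) (by omega))

theorem IsSerreSystem.qserre_left (he : IsSerreSystem N e) (l : ℕ) {k : ℤ} (h1 : 1 ≤ k)
    (h2 : k + 1 + l ≤ N) : QSerre qq (e k) (rootVec e l (k + 1)) := by
  cases l with
  | zero => exact he.serre_up k h1 (by simpa using h2)
  | succ l =>
    push_cast at h2
    exact (he.serre_up k h1 (by omega)).qBr_right_of_comm
      (he.far l h1 (by omega) (by omega))

theorem IsSerreSystem.middle (he : IsSerreSystem N e) (l : ℕ) {k : ℤ} (h1 : 1 ≤ k)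
    (h2 : k + 2 + l ≤ N) : e (k + 1) * rootVec e (l + 2) k = rootVec e (l + 2) k * e (k + 1) := by
  rw [rootVec_succ, rootVec_succ]
  have h := he.far l h1 (k := k + 1 + 1) (by omega) (by omega)
  exact qBr_middle_comm qq_ne_zero qq_mul_self_add_one_ne_zero h (he.serre_down k h1 (by omega))
    (he.qserre_left l (by omega) (by omega))

theorem IsSerreSystem.qserre_right (he : IsSerreSystem N e) (l : ℕ) : ∀ {k : ℤ}, 1 ≤ k →
    k + 1 + l ≤ N → QSerre qq (rootVec e l (k + 1)) (e k) := by
  induction l with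
  | zero =>
    intro k h1 h2
    exact he.serre_down k h1 (by simpa using h2)
  | succ l ih =>
    intro k h1 h2
    push_cast at h2
    refine QSerre.of_mul_qBr qq_ne_zero ?_
    have hc := he.middle l h1 (by omega)
    have hz := ih (k := k + 1) (by omega) (by omega)
    have hk := he.far l h1 (k := k + 1 + 1) (by omega) (by omega)
    have hz' := (hz.qBr_left_of_comm hk).mul_qBr' qq_ne_zero
    rw [← qBr_assoc hk] at hz'
    have hz'' : QC (-1) (rootVec e l (k + 1 + 1)) (rootVec e (l + 2) k) := by
      unfold QC
      rw [zpow_neg_one]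
      exact hz'
    have h := hz''.qBr_left hc
    unfold QC at h
    rw [zpow_neg_one] at h
    exact h

theorem IsSerreSystem.inner (he : IsSerreSystem N e) (l : ℕ) : ∀ {j k : ℤ}, 1 ≤ k → k < j →
    j < k + l → k + l ≤ N → e j * rootVec e l k = rootVec e l k * e j := by
  induction l with
  | zero => intro j k _ h2 h3; simp at h3; omega
  | succ l ih =>
    intro j k h1 h2 h3 h4
    push_cast at h3 h4
    rcases (by omega : j = k + 1 ∨ k + 1 < j) with rfl | h
    · obtain ⟨l, rfl⟩ : ∃ l', l = l' + 1 := ⟨l - 1, by omega⟩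
      push_cast at h4
      exact he.middle l h1 (by omega)
    · exact qBr_comm_left (he.comm k j h1 h (by omega)).symm
        (ih (by omega) h (by omega) (by omega))

theorem IsSerreSystem.rootVec_rootVec (he : IsSerreSystem N e) (l d : ℕ) : ∀ {k : ℤ}, 1 ≤ k →
    k + 1 + d + l ≤ N →
    QC 1 (rootVec e (l + 1 + d) k) (rootVec e l (k + 1 + d)) := by
  induction d with
  | zero =>
    intro k h1 h2
    have h := (he.qserre_right l h1 (by simpa using h2)).mul_qBr' qq_ne_zero
    have h' : QC (-1) (rootVec e l (k + 1)) (rootVec e (l + 1) k) := by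
      unfold QC
      rw [zpow_neg_one]
      exact h
    simpa using h'.symm
  | succ d ih =>
    intro k h1 h2
    push_cast at h2 ⊢
    have := ih (k := k + 1) (by omega) (by omega)
    rw [show k + 1 + 1 + (d : ℤ) = k + 1 + (d + 1) by ring] at this
    exact this.qBr_left (he.far l h1 (by omega) (by omega))

end RootVectors

section Spanning

variable {A : Type*} [Ring A] [Algebra Kq A]

theorem mul_mem_of_mem_adjoin {S : Set A} {W : Submodule Kq A}
    (hS : ∀ s ∈ S, ∀ w ∈ W, s * w ∈ W) {x : A} (hx : x ∈ Algebra.adjoin Kq S) :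
    ∀ w ∈ W, x * w ∈ W := by
  induction hx using Algebra.adjoin_induction with
  | mem s hs => exact hS s hs
  | algebraMap r =>
    intro w hw
    rw [← Algebra.smul_def]
    exact W.smul_mem r hw
  | add x y _ _ hx hy =>
    intro w hw
    rw [add_mul]
    exact W.add_mem (hx w hw) (hy w hw)
  | mul x y _ _ hx hy =>
    intro w hw
    rw [mul_assoc]
    exact hx _ (hy w hw)

theorem mem_of_mem_adjoin {S : Set A} {W : Submodule Kq A} (h1 : (1 : A) ∈ W)
    (hS : ∀ s ∈ S, ∀ w ∈ W, w * s ∈ W) {x : A} (hx : x ∈ Algebra.adjoin Kq S) : x ∈ W := by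
  suffices h : ∀ w ∈ W, w * x ∈ W by simpa using h 1 h1
  induction hx using Algebra.adjoin_induction with
  | mem s hs => exact hS s hs
  | algebraMap r =>
    intro w hw
    rw [← Algebra.commutes, ← Algebra.smul_def]
    exact W.smul_mem r hw
  | add x y _ _ hx hy =>
    intro w hw
    rw [mul_add]
    exact W.add_mem (hx w hw) (hy w hw)
  | mul x y _ _ hx hy =>
    intro w hw
    rw [← mul_assoc]
    exact hy _ (hx w hw)

/-- If every generator `s` satisfies `s t = q^k t s` for some `k`, elements of the generated
subalgebra can be moved past `t`. -/
theorem exists_mul_eq_of_qc {S : Set A} {t : A} (h : ∀ s ∈ S, ∃ k, QC k s t) {x : A}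
    (hx : x ∈ Algebra.adjoin Kq S) : ∃ y ∈ Algebra.adjoin Kq S, x * t = t * y := by
  induction hx using Algebra.adjoin_induction with
  | mem s hs =>
    obtain ⟨k, hk⟩ := h s hs
    exact ⟨_, Subalgebra.smul_mem _ (Algebra.subset_adjoin hs) (qq ^ k),
      by rw [mul_smul_comm]; exact hk⟩
  | algebraMap r => exact ⟨_, Subalgebra.algebraMap_mem _ r, Algebra.commutes r t⟩
  | add x y _ _ hx hy =>
    obtain ⟨x', hx', ex⟩ := hx
    obtain ⟨y', hy', ey⟩ := hy
    exact ⟨_, add_mem hx' hy', by rw [add_mul, ex, ey, mul_add]⟩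
  | mul x y _ _ hx hy =>
    obtain ⟨x', hx', ex⟩ := hx
    obtain ⟨y', hy', ey⟩ := hy
    exact ⟨_, mul_mem hx' hy', by rw [mul_assoc, ey, ← mul_assoc, ex, mul_assoc]⟩

/-- The mirror image of `exists_mul_eq_of_qc`. -/
theorem exists_mul_eq_of_qc' {S : Set A} {t : A} (h : ∀ s ∈ S, ∃ k, QC k t s) {x : A}
    (hx : x ∈ Algebra.adjoin Kq S) : ∃ y ∈ Algebra.adjoin Kq S, t * x = y * t := by
  induction hx using Algebra.adjoin_induction with
  | mem s hs =>
    obtain ⟨k, hk⟩ := h s hs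
    exact ⟨_, Subalgebra.smul_mem _ (Algebra.subset_adjoin hs) (qq ^ k),
      by rw [smul_mul_assoc]; exact hk⟩
  | algebraMap r => exact ⟨_, Subalgebra.algebraMap_mem _ r, (Algebra.commutes r t).symm⟩
  | add x y _ _ hx hy =>
    obtain ⟨x', hx', ex⟩ := hx
    obtain ⟨y', hy', ey⟩ := hy
    exact ⟨_, add_mem hx' hy', by rw [mul_add, ex, ey, add_mul]⟩
  | mul x y _ _ hx hy =>
    obtain ⟨x', hx', ex⟩ := hx
    obtain ⟨y', hy', ey⟩ := hy
    exact ⟨_, mul_mem hx' hy', by rw [← mul_assoc, ex, mul_assoc, ey, mul_assoc]⟩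

theorem one_mem_prod {N : ℕ} {B : ℕ → Submodule Kq A} (h : ∀ k, (1 : A) ∈ B k) :
    (1 : A) ∈ ((List.range N).map B).prod := by
  induction N with
  | zero => simpa using Submodule.one_le.1 (le_refl (1 : Submodule Kq A))
  | succ N ih =>
    rw [List.range_succ, List.map_append, List.prod_append]
    simpa using Submodule.mul_mem_mul ih (h N)

theorem prod_mono {N : ℕ} {B C : ℕ → Submodule Kq A} (h : ∀ k < N, B k ≤ C k) :
    ((List.range N).map B).prod ≤ ((List.range N).map C).prod := by
  induction N with
  | zero => simp
  | succ N ih =>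
    simp only [List.range_succ, List.map_append, List.prod_append, List.map_cons, List.map_nil,
      List.prod_cons, List.prod_nil, mul_one]
    exact mul_le_mul' (ih fun k hk => h k (by omega)) (h N (by omega))

/-- A product of subspaces is stable under right multiplication by `y` if one factor is, and
`y` can be moved past the factors to the right of it. -/
theorem mul_mem_prod {N j : ℕ} {B : ℕ → Submodule Kq A} {y : A} (hj : j < N)
    (hy : ∀ b ∈ B j, b * y ∈ B j)
    (h : ∀ k, j < k → k < N → ∀ b ∈ B k, ∃ b₁ ∈ B k, ∃ b₂ ∈ B k, b * y = y * b₁ + b₂) :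
    ∀ x ∈ ((List.range N).map B).prod, x * y ∈ ((List.range N).map B).prod := by
  induction N with
  | zero => omega
  | succ N ih =>
    simp only [List.range_succ, List.map_append, List.prod_append, List.map_cons, List.map_nil,
      List.prod_cons, List.prod_nil, mul_one]
    intro x hx
    induction hx using Submodule.mul_induction_on' with
    | mem_mul_mem u hu b hb =>
      rcases (by omega : j = N ∨ j < N) with rfl | hjN
      · rw [mul_assoc]
        exact Submodule.mul_mem_mul hu (hy b hb)
      · obtain ⟨b₁, h₁, b₂, h₂, e⟩ := h N hjN (by omega) b hb
        rw [mul_assoc, e, mul_add, ← mul_assoc]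
        exact add_mem (Submodule.mul_mem_mul
          (ih hjN (fun k hk hk' => h k hk (by omega)) u hu) h₁) (Submodule.mul_mem_mul hu h₂)
    | add x _ x' _ hx hx' =>
      rw [add_mul]
      exact add_mem hx hx'

/-- A product of spans of families is contained in the span of the ordered products. -/
theorem prod_span_le {α : Type*} [Nonempty α] (N : ℕ) (x : ℕ → α → A) :
    ((List.range N).map fun k => Submodule.span Kq (Set.range (x k))).prod ≤
      Submodule.span Kq (Set.range fun c : ℕ → α =>
        ((List.range N).map fun k => x k (c k)).prod) := by
  induction N with
  | zero =>
    rw [List.range_zero, List.map_nil, List.prod_nil, Submodule.one_eq_span]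
    refine Submodule.span_mono ?_
    rintro _ rfl
    exact ⟨fun _ => Classical.arbitrary α, rfl⟩
  | succ N ih =>
    simp only [List.range_succ, List.map_append, List.prod_append, List.map_cons, List.map_nil,
      List.prod_cons, List.prod_nil, mul_one]
    refine (mul_le_mul' ih le_rfl).trans ?_
    rw [Submodule.span_mul_span]
    refine Submodule.span_mono ?_
    rintro _ ⟨_, ⟨c, rfl⟩, _, ⟨a, rfl⟩, rfl⟩
    refine ⟨fun k => if k = N then a else c k, ?_⟩
    simp only [if_pos]
    congr 2
    refine List.map_congr_left fun k hk => ?_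
    rw [if_neg (List.mem_range.1 hk).ne]

/-- The span of the powers of `x`. -/
def powSpan (x : A) : Submodule Kq A := Submodule.span Kq (Set.range fun c : ℕ => x ^ c)

theorem one_mem_powSpan (x : A) : (1 : A) ∈ powSpan x := Submodule.subset_span ⟨0, pow_zero x⟩

theorem mul_mem_span_of_forall {S : Set A} {W : Submodule Kq A} {y b : A}
    (h : ∀ s ∈ S, s * y ∈ W) (hb : b ∈ Submodule.span Kq S) : b * y ∈ W := by
  induction hb using Submodule.span_induction with
  | mem s hs => exact h s hs
  | zero => rw [zero_mul]; exact W.zero_mem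
  | add a b _ _ ha hb => rw [add_mul]; exact W.add_mem ha hb
  | smul c a _ ha => rw [smul_mul_assoc]; exact W.smul_mem c ha

theorem mul_self_mem_powSpan {x b : A} (hb : b ∈ powSpan x) : b * x ∈ powSpan x := by
  refine mul_mem_span_of_forall ?_ hb
  rintro _ ⟨c, rfl⟩
  exact Submodule.subset_span ⟨c + 1, pow_succ x c⟩

theorem QC.pow_left {k : ℤ} {x y : A} (h : QC k x y) (c : ℕ) : QC (c * k) (x ^ c) y := by
  induction c with
  | zero => simpa using QC.one_left y
  | succ c ih =>
    rw [pow_succ]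
    refine (ih.mul_left h).of_eq ?_
    push_cast
    ring

theorem exists_mul_eq_of_mem_span {S : Set A} {y b : A} (h : ∀ s ∈ S, ∃ k, QC k s y)
    (hb : b ∈ Submodule.span Kq S) : ∃ b' ∈ Submodule.span Kq S, b * y = y * b' := by
  induction hb using Submodule.span_induction with
  | mem s hs =>
    obtain ⟨k, hk⟩ := h s hs
    exact ⟨_, Submodule.smul_mem _ (qq ^ k) (Submodule.subset_span hs),
      by rw [mul_smul_comm]; exact hk⟩
  | zero => exact ⟨0, zero_mem _, by simp⟩
  | add a b _ _ ha hb =>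
    obtain ⟨a', ha', ea⟩ := ha
    obtain ⟨b', hb', eb⟩ := hb
    exact ⟨_, add_mem ha' hb', by rw [add_mul, ea, eb, mul_add]⟩
  | smul c a _ ha =>
    obtain ⟨a', ha', ea⟩ := ha
    exact ⟨_, Submodule.smul_mem _ c ha', by rw [smul_mul_assoc, ea, mul_smul_comm]⟩

/-- The algebra generated by `q`-commuting elements is spanned by their ordered monomials. -/
theorem adjoin_le_prod_powSpan {N : ℕ} {x : ℕ → A}
    (h : ∀ j k, j < k → k < N → ∃ m, QC m (x k) (x j)) :
    Subalgebra.toSubmodule (Algebra.adjoin Kq (x '' {k | k < N})) ≤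
      ((List.range N).map fun k => powSpan (x k)).prod := by
  intro y hy
  refine mem_of_mem_adjoin (one_mem_prod fun k => one_mem_powSpan _) ?_ hy
  rintro _ ⟨j, hj, rfl⟩
  refine mul_mem_prod (j := j) hj (fun b hb => mul_self_mem_powSpan hb) fun k hjk hk b hb => ?_
  obtain ⟨m, hm⟩ := h j k hjk hk
  obtain ⟨b', hb', e⟩ := exists_mul_eq_of_mem_span (y := x j) (by
    rintro _ ⟨c, rfl⟩
    exact ⟨_, hm.pow_left c⟩) hb
  exact ⟨b', hb', 0, zero_mem _, by rw [e, add_zero]⟩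

/-- The ordered product of powers of root vectors with exponents `c`. -/
def rootMon (e : ℤ → A) (N : ℕ) (c : ℕ → ℕ → ℕ) : A :=
  ((List.range N).map fun m =>
    ((List.range (m + 1)).map fun k => rootVec e (m - k) (k + 1) ^ c m k).prod).prod

/-- The subalgebra generated by the root vectors ending in `m + 1`. -/
def rootCol (e : ℤ → A) (m : ℕ) : Subalgebra Kq A :=
  Algebra.adjoin Kq ((fun k : ℕ => rootVec e (m - k) (k + 1)) '' {k | k < m + 1})

theorem IsSerreSystem.rootCol_mul {N : ℕ} {e : ℤ → A} (he : IsSerreSystem N e) {m j : ℕ}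
    (hm : m < N) (hj : j < m) {x : A} (hx : x ∈ rootCol e m) :
    ∃ y ∈ rootCol e m, ∃ z ∈ rootCol e m, x * e (j + 1) = e (j + 1) * y + z := by
  have hgen : ∀ k < m + 1, rootVec e (m - k) (k + 1) ∈ rootCol e m := fun k hk =>
    Algebra.subset_adjoin ⟨k, hk, rfl⟩
  have key : ∀ k < m + 1, ∃ y ∈ rootCol e m, ∃ z ∈ rootCol e m,
      rootVec e (m - k) (k + 1) * e (j + 1) = e (j + 1) * y + z := by
    intro k hk
    rcases (by omega : j + 1 < k ∨ k = j + 1 ∨ k = j ∨ k < j) with h | rfl | rfl | h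
    · refine ⟨_, hgen k hk, 0, zero_mem _, ?_⟩
      rw [add_zero, he.far (m - k) (by omega) (by omega) (by omega)]
    · refine ⟨_, Subalgebra.smul_mem _ (hgen _ hk) qq, _,
        Subalgebra.smul_mem _ (hgen j (by omega)) (-qq), ?_⟩
      have : m - j = m - (j + 1) + 1 := by omega
      rw [this, rootVec_succ, qBr]
      push_cast
      rw [smul_sub, smul_smul, neg_mul, mul_inv_cancel₀ qq_ne_zero, mul_smul_comm, neg_smul,
        neg_smul, one_smul]
      abel
    · obtain ⟨l, hl⟩ : ∃ l, m - k = l + 1 := ⟨m - k - 1, by omega⟩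
      refine ⟨_, Subalgebra.smul_mem _ (hgen k hk) qq⁻¹, 0, zero_mem _, ?_⟩
      have h := (he.qserre_left l (k := k + 1) (by omega) (by omega)).mul_qBr qq_ne_zero
      rw [← rootVec_succ] at h
      rw [hl, add_zero, mul_smul_comm, h, smul_smul, inv_mul_cancel₀ qq_ne_zero, one_smul]
    · refine ⟨_, hgen k hk, 0, zero_mem _, ?_⟩
      rw [add_zero, he.inner (m - k) (by omega) (by omega) (by omega) (by omega)]
  unfold rootCol at hx
  induction hx using Algebra.adjoin_induction with
  | mem s hs =>
    obtain ⟨k, hk, rfl⟩ := hs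
    exact key k hk
  | algebraMap r =>
    exact ⟨_, Subalgebra.algebraMap_mem _ r, 0, zero_mem _, by rw [add_zero, Algebra.commutes]⟩
  | add x x' _ _ hx hx' =>
    obtain ⟨y, hy, z, hz, h⟩ := hx
    obtain ⟨y', hy', z', hz', h'⟩ := hx'
    exact ⟨_, add_mem hy hy', _, add_mem hz hz', by rw [add_mul, h, h', mul_add]; abel⟩
  | mul x x' hxm _ hx hx' =>
    obtain ⟨y, hy, z, hz, h⟩ := hx
    obtain ⟨y', hy', z', hz', h'⟩ := hx'
    refine ⟨_, mul_mem hy hy', _, add_mem (mul_mem hz hy') (mul_mem hxm hz'), ?_⟩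
    rw [mul_assoc, h', mul_add, ← mul_assoc, h, add_mul, mul_assoc, add_assoc]

/-- The algebra generated by a Serre system is spanned by the ordered monomials in its root
vectors. -/
theorem IsSerreSystem.adjoin_le {N : ℕ} {e : ℤ → A} (he : IsSerreSystem N e) :
    Subalgebra.toSubmodule (Algebra.adjoin Kq ((fun k : ℕ => e (k + 1)) '' {k | k < N})) ≤
      Submodule.span Kq (Set.range (rootMon e N)) := by
  have h1 : Subalgebra.toSubmodule (Algebra.adjoin Kq ((fun k : ℕ => e (k + 1)) '' {k | k < N})) ≤
      ((List.range N).map fun m => Subalgebra.toSubmodule (rootCol e m)).prod := by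
    intro y hy
    refine mem_of_mem_adjoin (one_mem_prod fun k => one_mem (rootCol e k)) ?_ hy
    rintro _ ⟨j, hj, rfl⟩
    refine mul_mem_prod (j := j) hj (fun b hb => mul_mem (S := Subalgebra Kq A) hb ?_)
      fun k hjk hk b hb => he.rootCol_mul hk hjk hb
    refine Algebra.subset_adjoin ⟨j, by simp, ?_⟩
    simp [rootVec]
  have h2 : ∀ m < N, Subalgebra.toSubmodule (rootCol e m) ≤
      Submodule.span Kq (Set.range fun c : ℕ → ℕ =>
        ((List.range (m + 1)).map fun k => rootVec e (m - k) (k + 1) ^ c k).prod) := by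
    intro m hm
    refine (adjoin_le_prod_powSpan ?_).trans (prod_span_le (m + 1)
      fun k c => rootVec e (m - k) (k + 1) ^ c)
    intro j k hjk hk
    refine ⟨_, (QC.of_eq (k := 1) ?_ rfl).symm⟩
    have h := he.rootVec_rootVec (m - k) (k - j - 1) (k := j + 1) (by omega) (by omega)
    rwa [show m - k + 1 + (k - j - 1) = m - j by omega,
      show (j : ℤ) + 1 + 1 + (k - j - 1 : ℕ) = k + 1 by omega] at h
  exact (h1.trans (prod_mono h2)).trans (prod_span_le N fun m (c : ℕ → ℕ) =>
    ((List.range (m + 1)).map fun k => rootVec e (m - k) (k + 1) ^ c k).prod)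

/-- The ordered product of powers of units. -/
def unitMon (u v : ℕ → Aˣ) (N : ℕ) (z : ℕ → ℤ × ℤ) : A :=
  ((List.range N).map fun k => ((u k ^ (z k).1 * v k ^ (z k).2 : Aˣ) : A)).prod

theorem adjoin_units_le {N : ℕ} {u v : ℕ → Aˣ} (huu : ∀ j k, u j * u k = u k * u j)
    (huv : ∀ j k, u j * v k = v k * u j) (hvv : ∀ j k, v j * v k = v k * v j) {S : Set A}
    (hS : ∀ s ∈ S, ∃ j < N, ∃ a b : ℤ, s = (u j ^ a * v j ^ b : Aˣ)) :
    Subalgebra.toSubmodule (Algebra.adjoin Kq S) ≤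
      Submodule.span Kq (Set.range (unitMon u v N)) := by
  have comm : ∀ (j k : ℕ) (a b c d : ℤ),
      (u k ^ a * v k ^ b) * (u j ^ c * v j ^ d) = (u j ^ c * v j ^ d) * (u k ^ a * v k ^ b) := by
    intro j k a b c d
    have h1 : Commute (u k) (u j) := huu k j
    have h2 : Commute (u k) (v j) := huv k j
    have h3 : Commute (v k) (u j) := (huv j k).symm
    have h4 : Commute (v k) (v j) := hvv k j
    exact ((h1.zpow_zpow a c).mul_right (h2.zpow_zpow a d)).mul_left
      ((h3.zpow_zpow b c).mul_right (h4.zpow_zpow b d))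
  refine le_trans ?_ (prod_span_le N fun k (z : ℤ × ℤ) => ((u k ^ z.1 * v k ^ z.2 : Aˣ) : A))
  intro y hy
  have h1 (k : ℕ) : (1 : A) ∈ Submodule.span Kq
      (Set.range fun z : ℤ × ℤ => ((u k ^ z.1 * v k ^ z.2 : Aˣ) : A)) :=
    Submodule.subset_span ⟨(0, 0), by simp⟩
  refine mem_of_mem_adjoin (one_mem_prod h1) ?_ hy
  intro s hs
  obtain ⟨j, hj, c, d, rfl⟩ := hS s hs
  refine mul_mem_prod (j := j) hj (fun b hb => mul_mem_span_of_forall ?_ hb)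
    fun k hjk hk b hb => ?_
  · rintro _ ⟨⟨a, b⟩, rfl⟩
    refine Submodule.subset_span ⟨(a + c, b + d), ?_⟩
    have h : v j ^ b * u j ^ c = u j ^ c * v j ^ b :=
      (Commute.zpow_zpow (show Commute (v j) (u j) from (huv j j).symm) b c)
    simp only [← Units.val_mul]
    rw [zpow_add, zpow_add, mul_assoc, mul_assoc, ← mul_assoc (u j ^ c), ← h]
    simp only [mul_assoc]
  · obtain ⟨b', hb', e⟩ := exists_mul_eq_of_mem_span (y := ((u j ^ c * v j ^ d : Aˣ) : A)) (by
      rintro _ ⟨⟨a, b⟩, rfl⟩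
      refine ⟨0, QC.comm_iff.2 ?_⟩
      rw [← Units.val_mul, ← Units.val_mul, comm]) hb
    exact ⟨b', hb', 0, zero_mem _, by rw [e, add_zero]⟩

end Spanning

section Double

variable {n : ℕ}

theorem DDgen_rel {x y : FreeAlgebra Kq (DDGen n)} (h : DDRel n x y) :
    RingQuot.mkAlgHom Kq (DDRel n) x = RingQuot.mkAlgHom Kq (DDRel n) y :=
  RingQuot.mkAlgHom_rel Kq h

theorem K_mul_Kinv (i : Idx n) : DDgen n (.K i) * DDgen n (.Kinv i) = 1 := by
  simpa [DDgen] using DDgen_rel (DDRel.K_Kinv i)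

theorem Kinv_mul_K (i : Idx n) : DDgen n (.Kinv i) * DDgen n (.K i) = 1 := by
  simpa [DDgen] using DDgen_rel (DDRel.Kinv_K i)

theorem K'_mul_K'inv (i : Idx n) : DDgen n (.K' i) * DDgen n (.K'inv i) = 1 := by
  simpa [DDgen] using DDgen_rel (DDRel.K'_K'inv i)

theorem K'inv_mul_K' (i : Idx n) : DDgen n (.K'inv i) * DDgen n (.K' i) = 1 := by
  simpa [DDgen] using DDgen_rel (DDRel.K'inv_K' i)

theorem K_E (i j : Idx n) : QC (cartanA i.1 j.1) (DDgen n (.K i)) (DDgen n (.E j)) := by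
  simpa [DDgen, QC] using DDgen_rel (DDRel.KE i j)

theorem K'_E (i j : Idx n) : QC (-cartanA i.1 j.1) (DDgen n (.K' i)) (DDgen n (.E j)) := by
  simpa [DDgen, QC] using DDgen_rel (DDRel.K'E i j)

theorem K_F (i j : Idx n) : QC (-cartanA i.1 j.1) (DDgen n (.K i)) (DDgen n (.F j)) := by
  simpa [DDgen, QC] using DDgen_rel (DDRel.KF i j)

theorem K'_F (i j : Idx n) : QC (cartanA i.1 j.1) (DDgen n (.K' i)) (DDgen n (.F j)) := by
  simpa [DDgen, QC] using DDgen_rel (DDRel.K'F i j)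

theorem K_K (i j : Idx n) :
    DDgen n (.K i) * DDgen n (.K j) = DDgen n (.K j) * DDgen n (.K i) := by
  simpa [DDgen] using DDgen_rel (DDRel.KK i j)

theorem K_K' (i j : Idx n) :
    DDgen n (.K i) * DDgen n (.K' j) = DDgen n (.K' j) * DDgen n (.K i) := by
  simpa [DDgen] using DDgen_rel (DDRel.KK' i j)

theorem K'_K' (i j : Idx n) :
    DDgen n (.K' i) * DDgen n (.K' j) = DDgen n (.K' j) * DDgen n (.K' i) := by
  simpa [DDgen] using DDgen_rel (DDRel.K'K' i j)

theorem E_F (i j : Idx n) : ∃ c : Kq, DDgen n (.E i) * DDgen n (.F j) =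
    DDgen n (.F j) * DDgen n (.E i) + c • (DDgen n (.K i) - DDgen n (.K' i)) := by
  refine ⟨if i.1 = j.1 then qq - qq⁻¹ else 0, ?_⟩
  simpa only [DDgen, map_mul, map_add, map_smul, map_sub] using DDgen_rel (DDRel.EF i j)

/-- The generators of the Cartan part of the double. -/
def cartanGens (n : ℕ) : Set (DDalg n) :=
  {x | ∃ i, x = DDgen n (.K i) ∨ x = DDgen n (.K' i) ∨ x = DDgen n (.Kinv i) ∨
    x = DDgen n (.K'inv i)}

theorem cartanGens_E {s : DDalg n} (hs : s ∈ cartanGens n) (j : Idx n) :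
    ∃ k, QC k s (DDgen n (.E j)) := by
  obtain ⟨i, rfl | rfl | rfl | rfl⟩ := hs
  · exact ⟨_, K_E i j⟩
  · exact ⟨_, K'_E i j⟩
  · exact ⟨_, (K_E i j).inv_left (K_mul_Kinv i) (Kinv_mul_K i)⟩
  · exact ⟨_, (K'_E i j).inv_left (K'_mul_K'inv i) (K'inv_mul_K' i)⟩

theorem cartanGens_F {s : DDalg n} (hs : s ∈ cartanGens n) (j : Idx n) :
    ∃ k, QC k s (DDgen n (.F j)) := by
  obtain ⟨i, rfl | rfl | rfl | rfl⟩ := hs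
  · exact ⟨_, K_F i j⟩
  · exact ⟨_, K'_F i j⟩
  · exact ⟨_, (K_F i j).inv_left (K_mul_Kinv i) (Kinv_mul_K i)⟩
  · exact ⟨_, (K'_F i j).inv_left (K'_mul_K'inv i) (K'inv_mul_K' i)⟩

/-- The positive part of the double. -/
def ddPos (n : ℕ) : Subalgebra Kq (DDalg n) :=
  Algebra.adjoin Kq (Set.range fun i => DDgen n (.E i))

/-- The negative part of the double. -/
def ddNeg (n : ℕ) : Subalgebra Kq (DDalg n) :=
  Algebra.adjoin Kq (Set.range fun i => DDgen n (.F i))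

/-- The Cartan part of the double. -/
def ddCartan (n : ℕ) : Subalgebra Kq (DDalg n) := Algebra.adjoin Kq (cartanGens n)

theorem ddPos_mul_F {p : DDalg n} (hp : p ∈ ddPos n) (j : Idx n) :
    p * DDgen n (.F j) ∈ Submodule.span Kq {DDgen n (.F j)} * Subalgebra.toSubmodule (ddPos n) ⊔
      Subalgebra.toSubmodule (ddCartan n) * Subalgebra.toSubmodule (ddPos n) := by
  refine mul_mem_of_mem_adjoin ?_ hp _ (Submodule.mem_sup_left ?_)
  · rintro _ ⟨i, rfl⟩ w hw
    have hE : DDgen n (.E i) ∈ ddPos n := Algebra.subset_adjoin ⟨i, rfl⟩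
    obtain ⟨a, ha, b, hb, rfl⟩ := Submodule.mem_sup.1 hw
    rw [mul_add]
    refine add_mem ?_ (Submodule.mem_sup_right ?_)
    · obtain ⟨p', hp', rfl⟩ := Submodule.mem_span_singleton_mul.1 ha
      obtain ⟨c, h⟩ := E_F i j
      rw [← mul_assoc, h, add_mul, mul_assoc]
      refine add_mem (Submodule.mem_sup_left ?_) (Submodule.mem_sup_right ?_)
      · exact Submodule.mul_mem_mul (Submodule.mem_span_singleton_self _)
          (mul_mem (S := Subalgebra Kq (DDalg n)) hE hp')
      · refine Submodule.mul_mem_mul ?_ hp'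
        refine Submodule.smul_mem _ _ (Submodule.sub_mem _ ?_ ?_)
        · exact Algebra.subset_adjoin ⟨i, by simp⟩
        · exact Algebra.subset_adjoin ⟨i, by simp⟩
    · clear hw
      induction hb using Submodule.mul_induction_on' with
      | mem_mul_mem h hh p' hp' =>
        obtain ⟨h', hh', e⟩ := exists_mul_eq_of_qc' (S := cartanGens n) (t := DDgen n (.E i))
          (fun s hs => (cartanGens_E hs i).imp' Neg.neg fun _ h => h.symm) hh
        rw [← mul_assoc, e, mul_assoc]
        exact Submodule.mul_mem_mul hh' (mul_mem (S := Subalgebra Kq (DDalg n)) hE hp')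
      | add x hx y hy ihx ihy =>
        rw [mul_add]
        exact add_mem ihx ihy
  · exact Submodule.mem_span_singleton_mul.2 ⟨1, one_mem (ddPos n), mul_one _⟩

theorem eq_top_of_mul_gen_mem {T : Submodule Kq (DDalg n)} (h1 : (1 : DDalg n) ∈ T)
    (hT : ∀ x ∈ T, ∀ g, x * DDgen n g ∈ T) : T = ⊤ := by
  rw [eq_top_iff]
  intro y _
  refine mem_of_mem_adjoin (S := Set.range (DDgen n)) h1 ?_ ?_
  · rintro _ ⟨g, rfl⟩ w hw
    exact hT w hw g
  · obtain ⟨z, rfl⟩ := RingQuot.mkAlgHom_surjective Kq (DDRel n) y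
    have hz : z ∈ Algebra.adjoin Kq (Set.range (FreeAlgebra.ι Kq : DDGen n → _)) := by
      rw [FreeAlgebra.adjoin_range_ι]
      trivial
    have := (Subalgebra.mem_map (f := RingQuot.mkAlgHom Kq (DDRel n))).2 ⟨z, hz, rfl⟩
    rw [AlgHom.map_adjoin, ← Set.range_comp] at this
    exact this

/-- The triangular decomposition of the double. -/
theorem triangular (n : ℕ) :
    Subalgebra.toSubmodule (ddNeg n) * Subalgebra.toSubmodule (ddCartan n) *
      Subalgebra.toSubmodule (ddPos n) = ⊤ := by
  refine eq_top_of_mul_gen_mem ?_ ?_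
  · have h1 (S : Subalgebra Kq (DDalg n)) : (1 : DDalg n) ∈ Subalgebra.toSubmodule S := S.one_mem
    simpa using Submodule.mul_mem_mul (Submodule.mul_mem_mul (h1 (ddNeg n)) (h1 (ddCartan n)))
      (h1 (ddPos n))
  intro x hx g
  have mul_mem {S : Subalgebra Kq (DDalg n)} {a b : DDalg n}
      (ha : a ∈ Subalgebra.toSubmodule S) (hb : b ∈ Subalgebra.toSubmodule S) :
      a * b ∈ Subalgebra.toSubmodule S := S.mul_mem ha hb
  have hcartan : ∀ s ∈ cartanGens n, ∀ u ∈ Subalgebra.toSubmodule (ddNeg n),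
      ∀ h ∈ Subalgebra.toSubmodule (ddCartan n), ∀ p ∈ Subalgebra.toSubmodule (ddPos n),
      u * h * p * s ∈ Subalgebra.toSubmodule (ddNeg n) *
        Subalgebra.toSubmodule (ddCartan n) * Subalgebra.toSubmodule (ddPos n) := by
    intro s hs u hu h hh p hp
    have hqc : ∀ e ∈ Set.range fun i => DDgen n (.E i), ∃ k, QC k e s := by
      rintro _ ⟨i, rfl⟩
      exact (cartanGens_E hs i).imp' Neg.neg fun _ h => h.symm
    obtain ⟨p', hp', e⟩ := exists_mul_eq_of_qc hqc hp
    rw [mul_assoc (u * h), e, ← mul_assoc, mul_assoc u]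
    exact Submodule.mul_mem_mul (Submodule.mul_mem_mul hu
      (mul_mem hh (Algebra.subset_adjoin hs))) hp'
  induction hx using Submodule.mul_induction_on' with
  | add x _ y _ ihx ihy =>
    rw [add_mul]
    exact add_mem ihx ihy
  | mem_mul_mem y hy p hp =>
    induction hy using Submodule.mul_induction_on' with
    | add x _ y _ ihx ihy =>
      rw [add_mul, add_mul]
      exact add_mem ihx ihy
    | mem_mul_mem u hu h hh =>
      cases g with
      | E i =>
        rw [mul_assoc (u * h)]
        exact Submodule.mul_mem_mul (Submodule.mul_mem_mul hu hh)
          (mul_mem hp (Algebra.subset_adjoin ⟨i, rfl⟩))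
      | F j =>
        obtain ⟨a, ha, b, hb, e⟩ := Submodule.mem_sup.1 (ddPos_mul_F hp j)
        rw [mul_assoc (u * h), ← e, mul_add]
        refine add_mem ?_ ?_
        · obtain ⟨p', hp', rfl⟩ := Submodule.mem_span_singleton_mul.1 ha
          obtain ⟨h', hh', e⟩ := exists_mul_eq_of_qc (fun s hs => cartanGens_F hs j) hh
          rw [← mul_assoc, mul_assoc u, e, ← mul_assoc]
          exact Submodule.mul_mem_mul (Submodule.mul_mem_mul
            (mul_mem hu (Algebra.subset_adjoin ⟨j, rfl⟩)) hh') hp'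
        · rw [mul_assoc u, mul_assoc (Subalgebra.toSubmodule (ddNeg n))]
          refine Submodule.mul_mem_mul hu ?_
          have := Submodule.mul_mem_mul hh hb
          rwa [← mul_assoc, (ddCartan n).isIdempotentElem_toSubmodule.eq] at this
      | K i => exact hcartan _ ⟨i, by simp⟩ u hu h hh p hp
      | K' i => exact hcartan _ ⟨i, by simp⟩ u hu h hh p hp
      | Kinv i => exact hcartan _ ⟨i, by simp⟩ u hu h hh p hp
      | K'inv i => exact hcartan _ ⟨i, by simp⟩ u hu h hh p hp

/-- `E_k`, with junk value `0`. -/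
def ddE (n : ℕ) (k : ℤ) : DDalg n :=
  if h : 1 ≤ k ∧ k ≤ (n : ℤ) then DDgen n (.E ⟨k, h⟩) else 0

/-- `F_{θ(k)}`, with junk value `0`. -/
def ddF (n : ℕ) (k : ℤ) : DDalg n :=
  if h : 1 ≤ k ∧ k ≤ (n : ℤ) then DDgen n (.F (thIdx n ⟨k, h⟩)) else 0

/-- The unit `K_{k + 1}`, with junk value `1`. -/
def ddK (n : ℕ) (k : ℕ) : (DDalg n)ˣ :=
  if h : 1 ≤ (k : ℤ) + 1 ∧ (k : ℤ) + 1 ≤ (n : ℤ) then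
    ⟨DDgen n (.K ⟨k + 1, h⟩), DDgen n (.Kinv ⟨k + 1, h⟩), K_mul_Kinv _, Kinv_mul_K _⟩
  else 1

/-- The unit `K'_{θ(k + 1)}`, with junk value `1`. -/
def ddK' (n : ℕ) (k : ℕ) : (DDalg n)ˣ :=
  if h : 1 ≤ (k : ℤ) + 1 ∧ (k : ℤ) + 1 ≤ (n : ℤ) then
    ⟨DDgen n (.K' (thIdx n ⟨k + 1, h⟩)), DDgen n (.K'inv (thIdx n ⟨k + 1, h⟩)),
      K'_mul_K'inv _, K'inv_mul_K' _⟩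
  else 1

theorem isSerreSystem_ddE (n : ℕ) : IsSerreSystem n (ddE n) where
  comm i j hi hij hj := by
    rw [ddE, ddE, dif_pos (by omega), dif_pos (by omega)]
    simpa [DDgen] using DDgen_rel (DDRel.EEc ⟨i, by omega⟩ ⟨j, by omega⟩ (by simp only; omega))
  serre_up i hi hj := by
    rw [QSerre, ddE, ddE, dif_pos (by omega), dif_pos (by omega)]
    simpa [DDgen] using DDgen_rel (DDRel.serreE ⟨i, by omega⟩ ⟨i + 1, by omega⟩
      (by simp only; omega))
  serre_down i hi hj := by
    rw [QSerre, ddE, ddE, dif_pos (by omega), dif_pos (by omega)]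
    simpa [DDgen] using DDgen_rel (DDRel.serreE ⟨i + 1, by omega⟩ ⟨i, by omega⟩
      (by simp only; omega))

theorem isSerreSystem_ddF (n : ℕ) : IsSerreSystem n (ddF n) where
  comm i j hi hij hj := by
    rw [ddF, ddF, dif_pos (by omega), dif_pos (by omega)]
    simpa [DDgen] using DDgen_rel (DDRel.FFc (thIdx n ⟨i, by omega⟩) (thIdx n ⟨j, by omega⟩)
      (by simp only [thIdx, th]; omega))
  serre_up i hi hj := by
    rw [QSerre, ddF, ddF, dif_pos (by omega), dif_pos (by omega)]
    simpa [DDgen] using DDgen_rel (DDRel.serreF (thIdx n ⟨i, by omega⟩)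
      (thIdx n ⟨i + 1, by omega⟩) (by simp only [thIdx, th]; omega))
  serre_down i hi hj := by
    rw [QSerre, ddF, ddF, dif_pos (by omega), dif_pos (by omega)]
    simpa [DDgen] using DDgen_rel (DDRel.serreF (thIdx n ⟨i + 1, by omega⟩)
      (thIdx n ⟨i, by omega⟩) (by simp only [thIdx, th]; omega))

theorem thIdx_thIdx (i : Idx n) : thIdx n (thIdx n i) = i := Subtype.ext (th_th n i.1)

theorem exists_idx_eq (i : Idx n) :
    ∃ (k : ℕ) (hk : 1 ≤ (k : ℤ) + 1 ∧ (k : ℤ) + 1 ≤ (n : ℤ)), i = ⟨k + 1, hk⟩ := by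
  obtain ⟨i, hi⟩ := i
  obtain ⟨k, rfl⟩ : ∃ k : ℕ, i = k + 1 := ⟨(i - 1).toNat, by omega⟩
  exact ⟨k, hi, rfl⟩

theorem exists_thIdx_eq (i : Idx n) :
    ∃ (k : ℕ) (hk : 1 ≤ (k : ℤ) + 1 ∧ (k : ℤ) + 1 ≤ (n : ℤ)), i = thIdx n ⟨k + 1, hk⟩ := by
  obtain ⟨k, hk, h⟩ := exists_idx_eq (thIdx n i)
  exact ⟨k, hk, by rw [← h, thIdx_thIdx]⟩

theorem ddPos_le (n : ℕ) : Subalgebra.toSubmodule (ddPos n) ≤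
    Submodule.span Kq (Set.range (rootMon (ddE n) n)) := by
  refine le_trans ?_ (isSerreSystem_ddE n).adjoin_le
  refine Algebra.adjoin_mono ?_
  rintro _ ⟨i, rfl⟩
  obtain ⟨k, hk, rfl⟩ := exists_idx_eq i
  exact ⟨k, by simpa using (by omega : k < n), by simp only [ddE, dif_pos hk]⟩

theorem ddNeg_le (n : ℕ) : Subalgebra.toSubmodule (ddNeg n) ≤
    Submodule.span Kq (Set.range (rootMon (ddF n) n)) := by
  refine le_trans ?_ (isSerreSystem_ddF n).adjoin_le
  refine Algebra.adjoin_mono ?_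
  rintro _ ⟨i, rfl⟩
  obtain ⟨k, hk, rfl⟩ := exists_thIdx_eq i
  exact ⟨k, by simpa using (by omega : k < n), by simp only [ddF, dif_pos hk]⟩

theorem ddCartan_le (n : ℕ) : Subalgebra.toSubmodule (ddCartan n) ≤
    Submodule.span Kq (Set.range (unitMon (ddK n) (ddK' n) n)) := by
  refine adjoin_units_le ?_ ?_ ?_ ?_
  · intro j k
    unfold ddK
    split_ifs <;> simp only [Units.ext_iff, Units.val_mul, one_mul, mul_one]
    exact K_K _ _
  · intro j k
    unfold ddK ddK'
    split_ifs <;> simp only [Units.ext_iff, Units.val_mul, one_mul, mul_one]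
    exact K_K' _ _
  · intro j k
    unfold ddK'
    split_ifs <;> simp only [Units.ext_iff, Units.val_mul, one_mul, mul_one]
    exact K'_K' _ _
  · rintro s ⟨i, rfl | rfl | rfl | rfl⟩
    · obtain ⟨k, hk, rfl⟩ := exists_idx_eq i
      refine ⟨k, by omega, 1, 0, ?_⟩
      rw [zpow_zero, mul_one, zpow_one, ddK, dif_pos hk]
    · obtain ⟨k, hk, rfl⟩ := exists_thIdx_eq i
      refine ⟨k, by omega, 0, 1, ?_⟩
      rw [zpow_zero, one_mul, zpow_one, ddK', dif_pos hk]
    · obtain ⟨k, hk, rfl⟩ := exists_idx_eq i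
      refine ⟨k, by omega, -1, 0, ?_⟩
      rw [zpow_zero, mul_one, zpow_neg_one, ddK, dif_pos hk]
      rfl
    · obtain ⟨k, hk, rfl⟩ := exists_thIdx_eq i
      refine ⟨k, by omega, 0, -1, ?_⟩
      rw [zpow_zero, one_mul, zpow_neg_one, ddK', dif_pos hk]
      rfl

/-- The ordered monomials in the generators of the double. -/
def ddMon (n : ℕ) (c : (ℕ → ℕ → ℕ) × (ℕ → ℤ × ℤ) × (ℕ → ℕ → ℕ)) : DDalg n :=
  rootMon (ddF n) n c.1 * unitMon (ddK n) (ddK' n) n c.2.1 * rootMon (ddE n) n c.2.2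

theorem span_ddMon (n : ℕ) : Submodule.span Kq (Set.range (ddMon n)) = ⊤ := by
  rw [eq_top_iff, ← triangular]
  refine (mul_le_mul' (mul_le_mul' (ddNeg_le n) (ddCartan_le n)) (ddPos_le n)).trans ?_
  rw [Submodule.span_mul_span, Submodule.span_mul_span]
  refine Submodule.span_mono ?_
  rintro _ ⟨_, ⟨_, ⟨c', rfl⟩, _, ⟨z, rfl⟩, rfl⟩, _, ⟨c, rfl⟩, rfl⟩
  exact ⟨(c', z, c), rfl⟩

end Double

section Leads

variable {n : ℕ}

theorem map_rootVec {A B : Type*} [Ring A] [Algebra Kq A] [Ring B] [Algebra Kq B] (f : A →ₐ[Kq] B)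
    {e : ℤ → A} {e' : ℤ → B} (l : ℕ) : ∀ {k : ℤ}, (∀ j, k ≤ j → j ≤ k + l → f (e j) = e' j) →
    f (rootVec e l k) = rootVec e' l k := by
  induction l with
  | zero => exact fun h => h _ le_rfl (by simp)
  | succ l ih =>
    intro k h
    simp only [rootVec, map_sub, map_mul, map_smul, h k le_rfl (by omega),
      ih (k := k + 1) fun j h1 h2 => h j (by omega) (by push_cast; omega)]

theorem map_chainTail {A B : Type*} [Ring A] [Algebra Kq A] [Ring B] [Algebra Kq B]
    (f : A →ₐ[Kq] B) (w : ℤ → ℤ → A) (l : ℕ) : ∀ k r : ℤ,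
    f (chainTail w l k r) = chainTail (fun k r => f (w k r)) l k r := by
  induction l with
  | zero => exact fun k r => rfl
  | succ l ih =>
    intro k r
    simp only [chainTail, map_mul, map_sum, ih]

/-- The exponent of the monomial along a path of the quiver. -/
def pathExp (x : ℤ → ℤ → DnLabel) (k r : ℤ) : ExpLat :=
  ∑ t ∈ Finset.Icc (-k) r, Finsupp.single (x k t) 1

theorem latDeg_pathExp (x : ℤ → ℤ → DnLabel) {k r : ℤ} (h : -k ≤ r + 1) :
    latDeg (pathExp x k r) = r + k + 1 := by
  simp only [pathExp, map_sum, latDeg_single, Finset.sum_const, Int.card_Icc, nsmul_eq_mul, mul_one]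
  omega

theorem isShift_pathProd {x : ℤ → DnLabel} {a : ℤ} (c : ℕ)
    (hx : ∀ t, a ≤ t → t < a + c → (x t).valid n) :
    IsShift (torusRep n (pathProd n x a (a + c - 1)))
      (∑ t ∈ Finset.Icc a (a + c - 1), Finsupp.single (x t) 1) := by
  induction c with
  | zero =>
    rw [pathProd_of_lt _ (by simp), map_one, Finset.Icc_eq_empty (by simp), Finset.sum_empty]
    exact IsShift.one
  | succ c ih =>
    have h : a + (c + 1 : ℕ) - 1 = a + c := by push_cast; ring
    have h2 : Finset.Icc a (a + c) = insert (a + c : ℤ) (Finset.Icc a (a + c - 1)) := by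
      ext t
      simp only [Finset.mem_Icc, Finset.mem_insert]
      omega
    rw [h, pathProd_succ _ (by omega), map_mul, h2, Finset.sum_insert (by simp),
      add_comm (Finsupp.single _ _)]
    refine (ih fun t h1 h2 => hx t h1 (by push_cast; omega)).mul ?_
    rw [torusRep_Xg (hx _ (by omega) (by push_cast; omega))]
    intro b
    rw [shiftOp_single, one_mul]
    exact ⟨_, zpow_ne_zero _ qq_ne_zero, by rw [Finsupp.smul_single, smul_eq_mul, mul_one]⟩

/-- `x i r` is a valid label whenever `V i r` is. -/
def IsLabelling (n : ℕ) (x : ℤ → ℤ → DnLabel) : Prop :=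
  ∀ i r : ℤ, DnLabel.valid n (.V i r) → (x i r).valid n

theorem IsLabelling.isShift {x : ℤ → ℤ → DnLabel} (hx : IsLabelling n x) {k r : ℤ}
    (hk : 1 ≤ k ∧ k ≤ n) (hr : -k ≤ r ∧ r ≤ k) :
    IsShift (torusRep n (pathProd n (x k) (-k) r)) (pathExp x k r) := by
  obtain ⟨c, rfl⟩ : ∃ c : ℕ, r = -k + c - 1 := ⟨(r + k + 1).toNat, by omega⟩
  exact isShift_pathProd c fun t h1 h2 => hx k t ⟨hk.1, hk.2, h1, by omega⟩

theorem ii_ne_zero : ii ≠ 0 := by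
  simp [ii]

theorem isShift_ww {k r : ℤ} (hk : 1 ≤ k ∧ k ≤ n) (hr : -k ≤ r ∧ r ≤ k - 1) :
    IsShift (torusRep n (ww n k r)) (pathExp .V k r) := by
  rw [ww, Vprod_eq, map_smul]
  exact (IsLabelling.isShift (x := DnLabel.V) (fun _ _ h => h) hk (by omega)).smul
    (mul_ne_zero ii_ne_zero (zpow_ne_zero _ qq_ne_zero))

theorem isShift_mm {k r : ℤ} (hk : 1 ≤ k ∧ k ≤ n) (hr : -k ≤ r ∧ r ≤ k - 1) :
    IsShift (torusRep n (mm n k r)) (pathExp (Lam n) k r) := by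
  rw [mm, Lprod_eq, map_smul]
  exact (IsLabelling.isShift (x := Lam n) (fun _ _ h => Lam_valid h) hk (by omega)).smul
    (mul_ne_zero ii_ne_zero (zpow_ne_zero _ qq_ne_zero))

theorem isShift_torusK {k : ℤ} (hk : 1 ≤ k ∧ k ≤ n) :
    IsShift (torusRep n (torusK n k)) (pathExp .V k k) := by
  rw [torusK, Vprod_eq, map_smul]
  exact (IsLabelling.isShift (x := DnLabel.V) (fun _ _ h => h) hk (by omega)).smul
    (zpow_ne_zero _ qq_ne_zero)

theorem isShift_torusK' {k : ℤ} (hk : 1 ≤ k ∧ k ≤ n) :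
    IsShift (torusRep n (torusK' n k)) (pathExp (Lam n) k k) := by
  rw [torusK', Lprod_eq, map_smul]
  exact (IsLabelling.isShift (x := Lam n) (fun _ _ h => Lam_valid h) hk (by omega)).smul
    (zpow_ne_zero _ qq_ne_zero)

/-- The lowest exponent in `chainTail w l k r`. -/
def tailExp (x : ℤ → ℤ → DnLabel) : ℕ → ℤ → ℤ → ExpLat
  | 0, k, r => pathExp x k r
  | l + 1, k, r => pathExp x k r + tailExp x l (k + 1) (thr r)

theorem latDeg_tailExp_lt (x : ℤ → ℤ → DnLabel) (l : ℕ) : ∀ {k r s : ℤ}, -k ≤ r → r < s →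
    latDeg (tailExp x l k r) < latDeg (tailExp x l k s) := by
  induction l with
  | zero =>
    intro k r s h h'
    rw [tailExp, tailExp, latDeg_pathExp _ (by omega), latDeg_pathExp _ (by omega)]
    omega
  | succ l ih =>
    intro k r s h h'
    have h1 := thr_cases r
    have h2 := thr_cases s
    rw [tailExp, tailExp, map_add, map_add, latDeg_pathExp _ (by omega),
      latDeg_pathExp _ (by omega)]
    have := ih (k := k + 1) (r := thr r) (s := thr s) (by omega) (by omega)
    omega

theorem tailExp_of_neg (x : ℤ → ℤ → DnLabel) (l : ℕ) : ∀ {k r : ℤ}, r < 0 →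
    tailExp x l k r = ∑ p ∈ Finset.range (l + 1), pathExp x (k + p) r := by
  induction l with
  | zero => intro k r _; simp [tailExp]
  | succ l ih =>
    intro k r hr
    rw [tailExp, thr, if_pos hr, ih hr, Finset.sum_range_succ' _ (l + 1), add_comm]
    congr 1
    · refine Finset.sum_congr rfl fun p _ => ?_
      congr 1
      push_cast
      ring
    · simp

variable {x : ℤ → ℤ → DnLabel} {w : ℤ → ℤ → Dtorus n}

theorem hasLead_chainTail {w : ℤ → ℤ → Module.End Kq (ExpLat →₀ Kq)}
    (hs : ∀ k r : ℤ, 1 ≤ k ∧ k ≤ n → -k ≤ r ∧ r ≤ k - 1 → IsShift (w k r) (pathExp x k r))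
    (l : ℕ) : ∀ {k r : ℤ}, 1 ≤ k → k + l ≤ n → -k ≤ r ∧ r ≤ k - 1 →
    HasLead (chainTail w l k r) (tailExp x l k r) := by
  induction l with
  | zero => exact fun hk hk' hr => (hs _ _ ⟨hk, by omega⟩ hr).hasLead
  | succ l ih =>
    intro k r hk hk' hr
    have h1 := thr_cases r
    refine (hs k r ⟨hk, by omega⟩ hr).hasLead.mul ?_
    refine HasLead.sum (t := tailExp x l (k + 1)) (Finset.left_mem_Icc.2 (by omega))
      (fun s hs => ?_) fun s hs hne => ?_
    · rw [Finset.mem_Icc] at hs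
      exact ih (by omega) (by push_cast at hk'; omega) (by omega)
    · rw [Finset.mem_Icc] at hs
      exact latDeg_tailExp_lt x l (by omega) (by omega)

theorem one_sub_qq_inv_mul_ne_zero : 1 - qq⁻¹ * qq⁻¹ ≠ 0 := by
  intro h
  have h1 : qq * qq - 1 = 0 := by
    have := congrArg (fun y => qq * qq * y) h
    have h0 := qq_ne_zero
    field_simp at this
    simpa [sq] using this
  have h2 : (RatFunc.X * RatFunc.X - 1 : RatFunc ℂ) =
      algebraMap (Polynomial ℂ) _ (Polynomial.X ^ 2 - 1) := by
    simp [RatFunc.algebraMap_X, sq]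
  rw [qq, h2, map_eq_zero_iff _ (IsFractionRing.injective (Polynomial ℂ) (RatFunc ℂ))] at h1
  exact Polynomial.X_pow_sub_C_ne_zero (by norm_num : 0 < 2) (1 : ℂ) (by simpa using h1)

theorem hasLead_rootVec (hw : IsWChain n w)
    (hs : ∀ k r : ℤ, 1 ≤ k ∧ k ≤ n → -k ≤ r ∧ r ≤ k - 1 →
      IsShift (torusRep n (w k r)) (pathExp x k r))
    (l : ℕ) {k : ℤ} (hk : 1 ≤ k) (hk' : k + l ≤ n) :
    HasLead (torusRep n (rootVec (chainSum w) l k)) (tailExp x l k (-k)) := by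
  rw [hw.rootVec_eq l hk hk', map_smul, map_sum]
  refine HasLead.smul ?_ (pow_ne_zero _ one_sub_qq_inv_mul_ne_zero)
  refine HasLead.sum (t := tailExp x l k) (Finset.left_mem_Icc.2 (by omega))
    (fun s hs' => ?_) fun s hs' hne => ?_
  · rw [Finset.mem_Icc] at hs'
    rw [map_chainTail (B := Module.End Kq (ExpLat →₀ Kq)) (torusRep n) w]
    exact hasLead_chainTail hs l hk hk' hs'
  · rw [Finset.mem_Icc] at hs'
    exact latDeg_tailExp_lt x l (by omega) (by omega)

/-- The lowest exponent of an ordered monomial in root vectors. -/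
def rootExp (x : ℤ → ℤ → DnLabel) (n : ℕ) (c : ℕ → ℕ → ℕ) : ExpLat :=
  ∑ m ∈ Finset.range n, ∑ k ∈ Finset.range (m + 1), c m k • tailExp x (m - k) (k + 1) (-(k + 1))

theorem hasLead_rootMon (hw : IsWChain n w)
    (hs : ∀ k r : ℤ, 1 ≤ k ∧ k ≤ n → -k ≤ r ∧ r ≤ k - 1 →
      IsShift (torusRep n (w k r)) (pathExp x k r)) {e : ℤ → DDalg n}
    (he : ∀ j : ℤ, 1 ≤ j → j ≤ n → iotaHom n (e j) = chainSum w j) (c : ℕ → ℕ → ℕ) :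
    HasLead (torusRep n (iotaHom n (rootMon e n c))) (rootExp x n c) := by
  rw [rootMon, map_list_prod, map_list_prod, List.map_map, List.map_map]
  refine HasLead.listProd fun m hm => ?_
  simp only [Function.comp_apply, map_list_prod, List.map_map]
  refine HasLead.listProd fun k hk => ?_
  simp only [Function.comp_apply, map_pow]
  rw [map_rootVec (iotaHom n) (m - k) fun j h1 h2 => he j (by omega) (by omega)]
  exact (hasLead_rootVec hw hs (m - k) (by omega) (by omega)).pow _

/-- The exponent of an ordered monomial in the Cartan part. -/
def cartanExp (n : ℕ) (z : ℕ → ℤ × ℤ) : ExpLat :=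
  ∑ k ∈ Finset.range n, ((z k).1 • pathExp .V (k + 1) (k + 1) +
    (z k).2 • pathExp (Lam n) (k + 1) (k + 1))

theorem hasLead_unitMon (z : ℕ → ℤ × ℤ) :
    HasLead (torusRep n (iotaHom n (unitMon (ddK n) (ddK' n) n z))) (cartanExp n z) := by
  rw [unitMon, map_list_prod, map_list_prod, List.map_map, List.map_map]
  refine HasLead.listProd fun k hk => ?_
  have hk' : 1 ≤ (k : ℤ) + 1 ∧ (k : ℤ) + 1 ≤ n := by omega
  let f : DDalg n →* Module.End Kq (ExpLat →₀ Kq) :=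
    ((torusRep n).comp (iotaHom n) : DDalg n →ₐ[Kq] _)
  have h1 : IsShift (Units.map f (ddK n k)).1 (pathExp .V (k + 1) (k + 1)) := by
    have : (Units.map f (ddK n k)).1 = torusRep n (torusK n (k + 1)) := by
      simp [f, ddK, hk', iotaHom_gen, iotaGen]
    rw [this]
    exact isShift_torusK hk'
  have h2 : IsShift (Units.map f (ddK' n k)).1 (pathExp (Lam n) (k + 1) (k + 1)) := by
    have : (Units.map f (ddK' n k)).1 = torusRep n (torusK' n (k + 1)) := by
      simp [f, ddK', hk', iotaHom_gen, iotaGen, thIdx, th_th]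
    rw [this]
    exact isShift_torusK' hk'
  have h3 := ((h1.zpow (z k).1).mul (h2.zpow (z k).2)).hasLead
  rw [← map_zpow, ← map_zpow, ← Units.val_mul, ← map_mul] at h3
  exact h3

theorem iotaHom_ddE {j : ℤ} (h1 : 1 ≤ j) (h2 : j ≤ n) :
    iotaHom n (ddE n j) = chainSum (ww n) j := by
  rw [ddE, dif_pos ⟨h1, h2⟩, iotaHom_gen]
  rfl

theorem iotaHom_ddF {j : ℤ} (h1 : 1 ≤ j) (h2 : j ≤ n) :
    iotaHom n (ddF n j) = chainSum (mm n) j := by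
  rw [ddF, dif_pos ⟨h1, h2⟩, iotaHom_gen]
  simp only [iotaGen, thIdx, th_th]

theorem hasLead_ddMon (c : (ℕ → ℕ → ℕ) × (ℕ → ℤ × ℤ) × (ℕ → ℕ → ℕ)) :
    HasLead (torusRep n (iotaHom n (ddMon n c)))
      (rootExp (Lam n) n c.1 + cartanExp n c.2.1 + rootExp .V n c.2.2) := by
  rw [ddMon, map_mul, map_mul, map_mul, map_mul]
  exact ((hasLead_rootMon isWChain_mm (fun _ _ => isShift_mm) (fun _ => iotaHom_ddF) _).mul
    (hasLead_unitMon _)).mul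
    (hasLead_rootMon isWChain_ww (fun _ _ => isShift_ww) (fun _ => iotaHom_ddE) _)

end Leads

section Injectivity

variable {n : ℕ} {x : ℤ → ℤ → DnLabel} {v : DnLabel}

theorem pathExp_apply (x : ℤ → ℤ → DnLabel) (k r : ℤ) (v : DnLabel) :
    pathExp x k r v = ∑ t ∈ Finset.Icc (-k) r, if x k t = v then 1 else 0 := by
  simp only [pathExp, Finsupp.finsetSum_apply, Finsupp.single_apply]

theorem pathExp_apply_of_ne {k r : ℤ} (h : ∀ t, -k ≤ t → t ≤ r → x k t ≠ v) :
    pathExp x k r v = 0 := by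
  rw [pathExp_apply]
  refine Finset.sum_eq_zero fun t ht => if_neg ?_
  rw [Finset.mem_Icc] at ht
  exact h t ht.1 ht.2

theorem pathExp_apply_of_iff {k r s : ℤ} {P : Prop} [Decidable P] (hs : P → -k ≤ s ∧ s ≤ r)
    (h : ∀ t, -k ≤ t → t ≤ r → (x k t = v ↔ P ∧ t = s)) :
    pathExp x k r v = if P then 1 else 0 := by
  rw [pathExp_apply]
  by_cases hP : P
  · rw [if_pos hP, Finset.sum_eq_single s]
    · rw [if_pos ((h s (hs hP).1 (hs hP).2).2 ⟨hP, rfl⟩)]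
    · intro t ht hne
      rw [Finset.mem_Icc] at ht
      exact if_neg fun h' => hne ((h t ht.1 ht.2).1 h').2
    · exact fun h' => absurd (Finset.mem_Icc.2 (hs hP)) h'
  · rw [if_neg hP]
    refine Finset.sum_eq_zero fun t ht => if_neg ?_
    rw [Finset.mem_Icc] at ht
    exact fun h' => hP ((h t ht.1 ht.2).1 h').1

theorem rootExp_apply (x : ℤ → ℤ → DnLabel) (c : ℕ → ℕ → ℕ) (v : DnLabel) :
    rootExp x n c v = ∑ m ∈ Finset.range n, ∑ k ∈ Finset.range (m + 1),
      c m k * ∑ p ∈ Finset.range (m - k + 1), pathExp x (k + 1 + p) (-(k + 1)) v := by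
  simp only [rootExp, Finsupp.finsetSum_apply, Finsupp.smul_apply, nsmul_eq_mul]
  refine Finset.sum_congr rfl fun m _ => Finset.sum_congr rfl fun k _ => ?_
  rw [tailExp_of_neg _ _ (by omega), Finsupp.finsetSum_apply]

theorem rootExp_apply_of_ne (c : ℕ → ℕ → ℕ)
    (h : ∀ k t : ℤ, 1 ≤ k → k ≤ n → -k ≤ t → t < 0 → x k t ≠ v) : rootExp x n c v = 0 := by
  rw [rootExp_apply]
  refine Finset.sum_eq_zero fun m hm => Finset.sum_eq_zero fun k hk => ?_
  rw [Finset.mem_range] at hm hk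
  rw [Finset.sum_eq_zero, mul_zero]
  intro p hp
  rw [Finset.mem_range] at hp
  exact pathExp_apply_of_ne fun t h1 h2 => h _ _ (by omega) (by omega) h1 (by omega)

theorem rootExp_apply_of_iff (c : ℕ → ℕ → ℕ) {p i : ℕ} (hip : i ≤ p) (hp : p < n)
    (h : ∀ k t : ℤ, 1 ≤ k → k ≤ n → -k ≤ t → t < 0 → (x k t = v ↔ k = p + 1 ∧ t = -(i + 1))) :
    rootExp x n c v = ∑ m ∈ Finset.Ico p n, ∑ k ∈ Finset.range (i + 1), (c m k : ℤ) := by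
  have h1 : ∀ m < n, ∀ k < m + 1, ∑ j ∈ Finset.range (m - k + 1),
      pathExp x (k + 1 + j) (-(k + 1)) v = if p ≤ m ∧ k ≤ i then 1 else 0 := by
    intro m hm k hk
    have h2 : ∀ j ∈ Finset.range (m - k + 1), pathExp x (k + 1 + j) (-(k + 1)) v =
        if j = p - k ∧ k ≤ i then 1 else 0 := by
      intro j hj
      rw [Finset.mem_range] at hj
      by_cases hk' : k ≤ i
      · refine pathExp_apply_of_iff (s := -(i + 1)) (by omega) fun t h1 h2 => ?_
        rw [h _ _ (by omega) (by omega) h1 (by omega)]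
        omega
      · rw [if_neg (by omega)]
        refine pathExp_apply_of_ne fun t h1 h2 => ?_
        rw [Ne, h _ _ (by omega) (by omega) h1 (by omega)]
        omega
    rw [Finset.sum_congr rfl h2]
    by_cases hk' : k ≤ i
    · simp only [hk', and_true, Finset.sum_ite_eq', Finset.mem_range]
      exact if_congr (by omega) rfl rfl
    · simp [hk']
  rw [rootExp_apply, Finset.range_eq_Ico, ← Finset.sum_Ico_consecutive _ (Nat.zero_le p) hp.le,
    Finset.sum_eq_zero, zero_add]
  · refine Finset.sum_congr rfl fun m hm => ?_
    rw [Finset.mem_Ico] at hm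
    rw [← Finset.sum_subset (Finset.range_subset_range.2 (by omega : i + 1 ≤ m + 1))]
    · refine Finset.sum_congr rfl fun k hk => ?_
      rw [Finset.mem_range] at hk
      rw [h1 m hm.2 k (by omega), if_pos (by omega), mul_one]
    · intro k hk hk'
      rw [Finset.mem_range] at hk hk'
      rw [h1 m hm.2 k hk, if_neg (by omega), mul_zero]
  · intro m hm
    rw [Finset.mem_Ico] at hm
    refine Finset.sum_eq_zero fun k hk => ?_
    rw [Finset.mem_range] at hk
    rw [h1 m (by omega) k (by omega), if_neg (by omega), mul_zero]

theorem eq_of_sums_eq {c c' : ℕ → ℕ → ℕ}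
    (h : ∀ p < n, ∀ i ≤ p, ∑ m ∈ Finset.Ico p n, ∑ k ∈ Finset.range (i + 1), (c m k : ℤ) =
      ∑ m ∈ Finset.Ico p n, ∑ k ∈ Finset.range (i + 1), (c' m k : ℤ)) :
    ∀ m < n, ∀ k ≤ m, c m k = c' m k := by
  have h1 : ∀ p < n, ∀ i ≤ p + 1, ∑ k ∈ Finset.range i, (c p k : ℤ) =
      ∑ k ∈ Finset.range i, (c' p k : ℤ) := by
    intro p hp i hi
    cases i with
    | zero => simp
    | succ i =>
      have h2 := h p hp i (by omega)
      rw [Finset.sum_eq_sum_Ico_succ_bot hp, Finset.sum_eq_sum_Ico_succ_bot hp] at h2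
      rcases (by omega : p + 1 < n ∨ p + 1 = n) with h3 | h3
      · have := h (p + 1) h3 i (by omega)
        linarith
      · simpa [h3] using h2
  intro m hm k hk
  have h2 := h1 m hm (k + 1) (by omega)
  rw [Finset.sum_range_succ, Finset.sum_range_succ, h1 m hm k (by omega)] at h2
  exact_mod_cast add_left_cancel h2

theorem rootMon_congr {A : Type*} [Ring A] [Algebra Kq A] (e : ℤ → A) {c c' : ℕ → ℕ → ℕ}
    (h : ∀ m < n, ∀ k ≤ m, c m k = c' m k) : rootMon e n c = rootMon e n c' := by
  unfold rootMon
  congr 1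
  refine List.map_congr_left fun m hm => ?_
  congr 1
  refine List.map_congr_left fun k hk => ?_
  rw [h m (List.mem_range.1 hm) k (Nat.lt_succ_iff.1 (List.mem_range.1 hk))]

theorem unitMon_congr {A : Type*} [Ring A] [Algebra Kq A] (u v : ℕ → Aˣ) {z z' : ℕ → ℤ × ℤ}
    (h : ∀ k < n, z k = z' k) : unitMon u v n z = unitMon u v n z' := by
  unfold unitMon
  congr 1
  refine List.map_congr_left fun k hk => ?_
  rw [h k (List.mem_range.1 hk)]

theorem cartanExp_congr {z z' : ℕ → ℤ × ℤ} (h : ∀ k < n, z k = z' k) :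
    cartanExp n z = cartanExp n z' :=
  Finset.sum_congr rfl fun k hk => by rw [h k (Finset.mem_range.1 hk)]

theorem cartanExp_V_zero (z : ℕ → ℤ × ℤ) {a : ℕ} (ha : a < n) :
    cartanExp n z (.V (a + 1) 0) = (z a).1 := by
  have h1 : ∀ k ∈ Finset.range n, ((z k).1 • pathExp .V (k + 1) (k + 1) +
      (z k).2 • pathExp (Lam n) (k + 1) (k + 1)) (.V (a + 1) 0) = if k = a then (z k).1 else 0 := by
    intro k hk
    rw [Finset.mem_range] at hk
    rw [Finsupp.add_apply, Finsupp.smul_apply, Finsupp.smul_apply,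
      pathExp_apply_of_iff (P := k = a) (s := 0) (by omega), pathExp_apply_of_ne]
    · simp
    · intro t h1 h2
      rw [Ne, Lam_eq_V_iff]
      omega
    · intro t h1 h2
      rw [V_eq_V_iff]
      omega
  rw [cartanExp, Finsupp.finsetSum_apply, Finset.sum_congr rfl h1, Finset.sum_ite_eq',
    if_pos (Finset.mem_range.2 ha)]

theorem cartanExp_C (z : ℕ → ℤ × ℤ) {a : ℕ} (ha : a < n) :
    cartanExp n z (.C (a + 1)) = (z a).2 := by
  have h1 : ∀ k ∈ Finset.range n, ((z k).1 • pathExp .V (k + 1) (k + 1) +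
      (z k).2 • pathExp (Lam n) (k + 1) (k + 1)) (.C (a + 1)) = if k = a then (z k).2 else 0 := by
    intro k hk
    rw [Finset.mem_range] at hk
    rw [Finsupp.add_apply, Finsupp.smul_apply, Finsupp.smul_apply, add_comm,
      pathExp_apply_of_iff (P := k = a) (s := 0) (by omega), pathExp_apply_of_ne]
    · simp
    · intro t h1 h2
      simp
    · intro t h1 h2
      rw [Lam_eq_C_iff]
      omega
  rw [cartanExp, Finsupp.finsetSum_apply, Finset.sum_congr rfl h1, Finset.sum_ite_eq',
    if_pos (Finset.mem_range.2 ha)]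

theorem ddMon_eq_of_exp_eq {c c' : (ℕ → ℕ → ℕ) × (ℕ → ℤ × ℤ) × (ℕ → ℕ → ℕ)}
    (h : rootExp (Lam n) n c.1 + cartanExp n c.2.1 + rootExp .V n c.2.2 =
      rootExp (Lam n) n c'.1 + cartanExp n c'.2.1 + rootExp .V n c'.2.2) :
    ddMon n c = ddMon n c' := by
  have hz : ∀ k < n, c.2.1 k = c'.2.1 k := by
    intro k hk
    have hL : ∀ b : ℕ → ℕ → ℕ, rootExp (Lam n) n b (.V (k + 1) 0) = 0 := fun b =>
      rootExp_apply_of_ne b fun j t _ _ _ _ => by rw [Ne, Lam_eq_V_iff]; omega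
    have hV : ∀ b : ℕ → ℕ → ℕ, rootExp .V n b (.V (k + 1) 0) = 0 := fun b =>
      rootExp_apply_of_ne b fun j t _ _ _ _ => by rw [Ne, V_eq_V_iff]; omega
    have hL' : ∀ b : ℕ → ℕ → ℕ, rootExp (Lam n) n b (.C (k + 1)) = 0 := fun b =>
      rootExp_apply_of_ne b fun j t _ _ _ _ => by rw [Ne, Lam_eq_C_iff]; omega
    have hV' : ∀ b : ℕ → ℕ → ℕ, rootExp .V n b (.C (k + 1)) = 0 := fun b =>
      rootExp_apply_of_ne b fun j t _ _ _ _ => by simp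
    have h1 := DFunLike.congr_fun h (.V (k + 1) 0)
    have h2 := DFunLike.congr_fun h (.C (k + 1))
    simp only [Finsupp.add_apply, hL, hV, cartanExp_V_zero _ hk, zero_add, add_zero] at h1
    simp only [Finsupp.add_apply, hL', hV', cartanExp_C _ hk, zero_add, add_zero] at h2
    exact Prod.ext h1 h2
  rw [cartanExp_congr hz] at h
  have hE : ∀ m < n, ∀ k ≤ m, c.2.2 m k = c'.2.2 m k := by
    refine eq_of_sums_eq fun p hp i hi => ?_
    have hL : ∀ b : ℕ → ℕ → ℕ, rootExp (Lam n) n b (.V (p + 1) (-(i + 1))) = 0 := fun b =>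
      rootExp_apply_of_ne b fun j t _ _ _ _ => by rw [Ne, Lam_eq_V_iff]; omega
    have hV : ∀ b : ℕ → ℕ → ℕ, rootExp .V n b (.V (p + 1) (-(i + 1))) =
        ∑ m ∈ Finset.Ico p n, ∑ k ∈ Finset.range (i + 1), (b m k : ℤ) := fun b =>
      rootExp_apply_of_iff b hi hp fun j t _ _ _ _ => V_eq_V_iff
    have h1 := DFunLike.congr_fun h (.V (p + 1) (-(i + 1)))
    simpa only [Finsupp.add_apply, hL, hV, zero_add, add_right_inj] using h1
  have hF : ∀ m < n, ∀ k ≤ m, c.1 m k = c'.1 m k := by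
    refine eq_of_sums_eq fun p hp i hi => ?_
    have hV : ∀ b : ℕ → ℕ → ℕ, rootExp .V n b (.V (n - i) (n - p)) = 0 := fun b =>
      rootExp_apply_of_ne b fun j t _ _ _ _ => by rw [Ne, V_eq_V_iff]; omega
    have hL : ∀ b : ℕ → ℕ → ℕ, rootExp (Lam n) n b (.V (n - i) (n - p)) =
        ∑ m ∈ Finset.Ico p n, ∑ k ∈ Finset.range (i + 1), (b m k : ℤ) := fun b =>
      rootExp_apply_of_iff b hi hp fun j t _ _ _ _ => by rw [Lam_eq_V_iff]; omega
    have h1 := DFunLike.congr_fun h (.V (n - i) (n - p))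
    simpa only [Finsupp.add_apply, hL, hV, add_zero, add_left_inj] using h1
  rw [ddMon, ddMon, rootMon_congr _ hE, rootMon_congr _ hF, unitMon_congr _ _ hz]

theorem iotaHom_injective (n : ℕ) : Function.Injective (iotaHom n) := by
  have h := injective_of_hasLead ((torusRep n).toLinearMap ∘ₗ (iotaHom n).toLinearMap) (ddMon n)
    (fun c => rootExp (Lam n) n c.1 + cartanExp n c.2.1 + rootExp .V n c.2.2) (span_ddMon n)
    (fun c => hasLead_ddMon c) fun _ _ => ddMon_eq_of_exp_eq
  exact Function.Injective.of_comp h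

end Injectivity

/-- There is an injective homomorphism of `𝕂`-algebras
`ι : 𝔇ₙ → 𝒟ₙ` determined on the generators by
`ι(E_i) = Σ_{r=−i}^{i−1} w_i^r`, `ι(K_i) = q^{2i} X_{V_{i,−i}} ⋯ X_{V_{i,i}}`,
`ι(F_{θ(i)}) = Σ_{r=−i}^{i−1} m_i^r`, `ι(K'_{θ(i)}) = q^{2i} X_{Λ_{i,−i}} ⋯ X_{Λ_{i,i}}`. -/
theorem statement0 (n : ℕ) (hn : 1 ≤ n) :
    ∃ f : DDalg n →ₐ[Kq] Dtorus n, Function.Injective f ∧ iotaSpec n f := by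
  exact ⟨iotaHom n, iotaHom_injective n, iotaHom_spec n⟩

end
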